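/- arXiv:1406.2827 — 2 statements merged into one kernel-verified Lean document; each statement's English description precedes it below -/
import Mathlib

section
/- For (a,b) equal to (2,0), (2,1), (2,2), (3,0), (3,1), (3,2), (4,0), (4,1), the presented group G_{3,3,6}(a,b) = ⟨P, Q, R | P³, Q³, R⁶, (PQ)², (QR)², (PQR)², (QR⁴)^a (RQR³)^b⟩ is finite, of order 120, 336, 1440, 648, 2184, 6840, 7680, 8064 respectively (equal to 12 times the numbers 10, 28, 120, 54, 182, 570, 640, 672 of ideal tetrahedra of the corresponding universal regular tessellation listed in Table 1). -/
/-- The relators of the presentation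
⟨P, Q, R | P^p, Q^q, R^r, (PQ)², (QR)², (PQR)², (Q R^{r/2+1})^a (R Q R^{r/2})^b⟩
of the orientation-preserving symmetry group of the universal regular
tessellation of type {p,q,r} and cusp modulus a+bu, u = e^{2πi/r}.
The generators P, Q, R are `FreeGroup.of 0`, `FreeGroup.of 1`, `FreeGroup.of 2`. -/
def tessRels (p q r a b : ℕ) : Set (FreeGroup (Fin 3)) :=
  {(FreeGroup.of 0) ^ p, (FreeGroup.of 1) ^ q, (FreeGroup.of 2) ^ r,
   (FreeGroup.of 0 * FreeGroup.of 1) ^ 2,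
   (FreeGroup.of 1 * FreeGroup.of 2) ^ 2,
   (FreeGroup.of 0 * FreeGroup.of 1 * FreeGroup.of 2) ^ 2,
   (FreeGroup.of 1 * (FreeGroup.of 2) ^ (r / 2 + 1)) ^ a *
     (FreeGroup.of 2 * FreeGroup.of 1 * (FreeGroup.of 2) ^ (r / 2)) ^ b}

/-- G_{p,q,r}(a,b), the presented group of the above presentation. -/
def tessGroup (p q r a b : ℕ) : Type := PresentedGroup (tessRels p q r a b)

instance (p q r a b : ℕ) : Group (tessGroup p q r a b) :=
  inferInstanceAs (Group (PresentedGroup _))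

namespace CosetEnumeration

/-- An edge `(g, i, j)` of a partial coset graph: the generator `g` sends vertex `i` to `j`. -/
abbrev Edge := ℕ × ℕ × ℕ

/-- The steps of a Todd–Coxeter coset enumeration. -/
inductive Step where
  /-- Add a fresh vertex as the image of vertex `i` under the generator `g`. -/
  | new (g i : ℕ)
  /-- Deduce the only unknown edge, ending in `j`, of the closed path at `j` labelled by the
  `r`-th relator rotated by `k` letters. -/
  | ded (r k j : ℕ)
  /-- Identify the two ends of the path from `j` labelled by a rotated relator. -/
  | col (r k j : ℕ)
  /-- Identify two vertices which are images of `i` under the generator `g`. -/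
  | img (g i : ℕ)
  /-- Identify two vertices which are mapped to `j` by the generator `g`. -/
  | pre (g j : ℕ)

/-- The image of the vertex `i` under the generator `g`, if known. -/
def image (S : List Edge) (g i : ℕ) : Option ℕ :=
  (S.find? fun e => Nat.beq e.2.1 i && Nat.beq e.1 g).map fun e => e.2.2

/-- The end of the path from `i` labelled by a word (read from right to left), if known. -/
def walk (S : List Edge) : List ℕ → ℕ → Option ℕ
  | [], i => some i
  | g :: w, i => (walk S w i).bind (image S g)

/-- Replace the vertex `j` by `i`. -/
def replace (i j : ℕ) (S : List Edge) : List Edge :=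
  S.map fun e =>
    (e.1, bif Nat.beq e.2.1 j then i else e.2.1, bif Nat.beq e.2.2 j then i else e.2.2)

/-- Replace the larger of two identified vertices by the smaller one. -/
def merge (i j : ℕ) (S : List Edge) : List Edge :=
  bif Nat.ble i j then replace i j S else replace j i S

/-- Perform a step on a partial coset graph with vertices below `s.1` and edges `s.2`. -/
def step (rels : List (List ℕ)) (s : ℕ × List Edge) : Step → Option (ℕ × List Edge)
  | .new g i => bif i < s.1 then some (s.1 + 1, (g, i, s.1) :: s.2) else none
  | .ded r k j =>
    match (rels.getD r []).rotate k with
    | [] => none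
    | g :: w => bif j < s.1 then (walk s.2 w j).map fun i => (s.1, (g, i, j) :: s.2) else none
  | .col r k j =>
    bif j < s.1 then
      (walk s.2 ((rels.getD r []).rotate k) j).map fun i => (s.1, merge i j s.2)
    else none
  | .img g i =>
    (s.2.find? fun e => e.1 == g && e.2.1 == i).bind fun e =>
      (s.2.find? fun e' => e'.1 == g && e'.2.1 == i && e'.2.2 != e.2.2).map fun e' =>
        (s.1, merge e.2.2 e'.2.2 s.2)
  | .pre g j =>
    (s.2.find? fun e => e.1 == g && e.2.2 == j).bind fun e =>
      (s.2.find? fun e' => e'.1 == g && e'.2.2 == j && e'.2.1 != e.2.1).map fun e' =>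
        (s.1, merge e.2.1 e'.2.1 s.2)

/-- Perform a list of steps. -/
def run (rels : List (List ℕ)) : List Step → ℕ × List Edge → Option (ℕ × List Edge)
  | [], s => some s
  | t :: l, s => (step rels s t).bind (run rels l)

/-- The coset graph is closed under the generators on the vertices in `V`. -/
def closed (gens V : List ℕ) (S : List Edge) : Bool :=
  V.contains 0 && V.all fun v => gens.all fun g => ((image S g v).map V.contains).getD false

/-- Starting from the base vertex fixed by the generators in `sub`, the given steps end in a
complete coset graph on at most `d` vertices. -/
def completes (rels : List (List ℕ)) (gens sub : List ℕ) (l : List Step) (d : ℕ) : Bool :=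
  match run rels l (1, sub.map fun g => (g, 0, 0)) with
  | none => false
  | some s =>
    let V := (List.range s.1).filter fun v => (gens.head?.bind (image s.2 · v)).isSome
    V.length ≤ d && closed gens V s.2

section Soundness

open scoped Pointwise

variable {G X : Type*} [Group G] [MulAction G X]

/-- The labelling `f` of vertices by points of `X` is compatible with the edges of `S`. -/
def Realizes (γ : ℕ → G) (f : ℕ → X) (S : List Edge) : Prop :=
  ∀ e ∈ S, γ e.1 • f e.2.1 = f e.2.2

/-- The partial coset graph `s` maps to the action of `G` on the orbit of `x`. -/
def Valid (γ : ℕ → G) (x : X) (s : ℕ × List Edge) : Prop :=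
  0 < s.1 ∧ (∀ e ∈ s.2, e.2.1 < s.1 ∧ e.2.2 < s.1) ∧ ∃ f : ℕ → X, f 0 = x ∧ Realizes γ f s.2

variable {γ : ℕ → G} {f : ℕ → X} {x : X} {S : List Edge} {rels : List (List ℕ)}

theorem mem_of_image {g i j : ℕ} (h : image S g i = some j) : (g, i, j) ∈ S := by
  obtain ⟨⟨g', i', j'⟩, he, rfl⟩ := Option.map_eq_some_iff.1 h
  have hm := List.mem_of_find?_eq_some he
  have hp := List.find?_some he
  simp only [Bool.and_eq_true, Nat.beq_eq] at hp
  obtain ⟨rfl, rfl⟩ := hp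
  exact hm

theorem Realizes.walk (hf : Realizes γ f S) {w : List ℕ} {i j : ℕ}
    (h : walk S w i = some j) : (w.map γ).prod • f i = f j := by
  induction w generalizing j with
  | nil => simp_all [CosetEnumeration.walk]
  | cons g w ih =>
    obtain ⟨k, hk, hj⟩ := Option.bind_eq_some_iff.1 h
    rw [List.map_cons, List.prod_cons, mul_smul, ih hk]
    exact hf _ (mem_of_image hj)

theorem walk_lt {n : ℕ} (hS : ∀ e ∈ S, e.2.1 < n ∧ e.2.2 < n) {w : List ℕ} {i j : ℕ}
    (hi : i < n) (h : walk S w i = some j) : j < n := by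
  cases w with
  | nil => simp_all [walk]
  | cons g w =>
    obtain ⟨k, -, hj⟩ := Option.bind_eq_some_iff.1 h
    exact (hS _ (mem_of_image hj)).2

theorem prod_rotate_eq_one {w : List ℕ} (h : (w.map γ).prod = 1) (k : ℕ) :
    ((w.rotate k).map γ).prod = 1 := by
  rw [List.map_rotate]
  exact List.prod_rotate_eq_one_of_prod_eq_one h k

theorem prod_relator (hrels : ∀ w ∈ rels, (w.map γ).prod = 1) (r k : ℕ) :
    (((rels.getD r []).rotate k).map γ).prod = 1 := by
  refine prod_rotate_eq_one ?_ k
  rw [List.getD_eq_getElem?_getD]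
  cases h : rels[r]? with
  | none => simp
  | some w => exact hrels w (List.mem_of_getElem? h)

theorem Valid.replace {n i j : ℕ} (hS : ∀ e ∈ S, e.2.1 < n ∧ e.2.2 < n) (hi : i < n)
    (hf0 : f 0 = x) (hf : Realizes γ f S) (h : f i = f j) : Valid γ x (n, replace i j S) := by
  have hc : ∀ v, f (bif Nat.beq v j then i else v) = f v := by
    intro v
    cases hv : Nat.beq v j with
    | false => rfl
    | true => rw [cond_true, h, Nat.eq_of_beq_eq_true hv]
  have hlt : ∀ v < n, (bif Nat.beq v j then i else v) < n := by
    intro v hv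
    cases Nat.beq v j with
    | false => exact hv
    | true => exact hi
  refine ⟨(Nat.zero_le i).trans_lt hi, ?_, f, hf0, ?_⟩
  · intro e he
    obtain ⟨e', he', rfl⟩ := List.mem_map.1 he
    exact ⟨hlt _ (hS e' he').1, hlt _ (hS e' he').2⟩
  · intro e he
    obtain ⟨e', he', rfl⟩ := List.mem_map.1 he
    simpa only [hc] using hf e' he'

theorem Valid.merge {n i j : ℕ} (hS : ∀ e ∈ S, e.2.1 < n ∧ e.2.2 < n) (hi : i < n) (hj : j < n)
    (hf0 : f 0 = x) (hf : Realizes γ f S) (h : f i = f j) : Valid γ x (n, merge i j S) := by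
  unfold CosetEnumeration.merge
  cases Nat.ble i j with
  | false => exact Valid.replace hS hj hf0 hf h.symm
  | true => exact Valid.replace hS hi hf0 hf h

theorem Valid.step (hrels : ∀ w ∈ rels, (w.map γ).prod = 1) {s s' : ℕ × List Edge} {t : Step}
    (hs : Valid γ x s) (h : step rels s t = some s') : Valid γ x s' := by
  obtain ⟨hn, hS, f, hf0, hf⟩ := hs
  cases t with
  | new g i =>
    by_cases hi : i < s.1
    · simp only [CosetEnumeration.step, hi, decide_true, cond_true, Option.some.injEq] at h
      subst h
      refine ⟨Nat.succ_pos _, ?_, Function.update f s.1 (γ g • f i), ?_, ?_⟩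
      · rintro e (_ | ⟨_, he⟩)
        · exact ⟨hi.trans (Nat.lt_succ_self _), Nat.lt_succ_self _⟩
        · exact (hS e he).imp Nat.lt_succ_of_lt Nat.lt_succ_of_lt
      · rw [Function.update_of_ne hn.ne, hf0]
      · rintro e (_ | ⟨_, he⟩)
        · simp [Function.update_of_ne hi.ne]
        · rw [Function.update_of_ne (hS e he).1.ne, Function.update_of_ne (hS e he).2.ne]
          exact hf e he
    · simp [CosetEnumeration.step, hi] at h
  | ded r k j =>
    have hw := prod_relator hrels r k
    simp only [CosetEnumeration.step] at h
    split at h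
    · cases h
    · next g w hr =>
      rw [hr, List.map_cons, List.prod_cons] at hw
      by_cases hj : j < s.1
      · simp only [hj, decide_true, cond_true] at h
        obtain ⟨i, hi, rfl⟩ := Option.map_eq_some_iff.1 h
        refine ⟨hn, ?_, f, hf0, ?_⟩
        · rintro e (_ | ⟨_, he⟩)
          · exact ⟨walk_lt hS hj hi, hj⟩
          · exact hS e he
        · rintro e (_ | ⟨_, he⟩)
          · simp only [← hf.walk hi, ← mul_smul, hw, one_smul]
          · exact hf e he
      · simp [hj] at h
  | col r k j =>
    by_cases hj : j < s.1
    · simp only [CosetEnumeration.step, hj, decide_true, cond_true] at h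
      obtain ⟨i, hi, rfl⟩ := Option.map_eq_some_iff.1 h
      have hij := hf.walk hi
      rw [prod_relator hrels, one_smul] at hij
      exact Valid.merge hS (walk_lt hS hj hi) hj hf0 hf hij.symm
    · simp [CosetEnumeration.step, hj] at h
  | img g i =>
    obtain ⟨e, he, h⟩ := Option.bind_eq_some_iff.1 h
    obtain ⟨e', he', rfl⟩ := Option.map_eq_some_iff.1 h
    have hm := List.mem_of_find?_eq_some he
    have hm' := List.mem_of_find?_eq_some he'
    have hp := List.find?_some he
    have hp' := List.find?_some he'
    simp only [Bool.and_eq_true, beq_iff_eq] at hp hp'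
    refine Valid.merge hS (hS _ hm).2 (hS _ hm').2 hf0 hf ?_
    rw [← hf _ hm, ← hf _ hm', hp.1, hp.2, hp'.1.1, hp'.1.2]
  | pre g j =>
    obtain ⟨e, he, h⟩ := Option.bind_eq_some_iff.1 h
    obtain ⟨e', he', rfl⟩ := Option.map_eq_some_iff.1 h
    have hm := List.mem_of_find?_eq_some he
    have hm' := List.mem_of_find?_eq_some he'
    have h₁ := hf _ hm
    have h₂ := hf _ hm'
    have hp := List.find?_some he
    have hp' := List.find?_some he'
    simp only [Bool.and_eq_true, beq_iff_eq] at hp hp'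
    refine Valid.merge hS (hS _ hm).1 (hS _ hm').1 hf0 hf (MulAction.injective (γ g) ?_)
    rw [hp.1, hp.2] at h₁
    rw [hp'.1.1, hp'.1.2] at h₂
    exact h₁.trans h₂.symm

theorem Valid.run (hrels : ∀ w ∈ rels, (w.map γ).prod = 1) {l : List Step}
    {s s' : ℕ × List Edge} (hs : Valid γ x s) (h : run rels l s = some s') : Valid γ x s' := by
  induction l generalizing s with
  | nil => cases h; exact hs
  | cons t l ih =>
    obtain ⟨s₁, h₁, h₂⟩ := Option.bind_eq_some_iff.1 h
    exact ih (hs.step hrels h₁) h₂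

/-- A completed coset enumeration bounds the size of an orbit. -/
theorem exists_finite_set_of_completes {gens sub : List ℕ} {l : List Step} {d : ℕ}
    (hrels : ∀ w ∈ rels, (w.map γ).prod = 1) (hsub : ∀ g ∈ sub, γ g • x = x)
    (h : completes rels gens sub l d = true) :
    ∃ Y : Set X, Y.Finite ∧ Y.ncard ≤ d ∧ x ∈ Y ∧ ∀ g ∈ gens, ∀ y ∈ Y, γ g • y ∈ Y := by
  unfold completes at h
  split at h
  · cases h
  next s hs =>
  have hv : Valid γ x s := by
    refine Valid.run hrels ⟨Nat.one_pos, ?_, fun _ => x, rfl, ?_⟩ hs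
    · intro e he
      obtain ⟨g, -, rfl⟩ := List.mem_map.1 he
      simp
    · intro e he
      obtain ⟨g, hg, rfl⟩ := List.mem_map.1 he
      exact hsub g hg
  obtain ⟨-, -, f, hf0, hf⟩ := hv
  simp only [Bool.and_eq_true, decide_eq_true_eq] at h
  obtain ⟨hlen, hcl⟩ := h
  generalize (List.range s.1).filter _ = V at hlen hcl
  simp only [closed, Bool.and_eq_true, List.contains_iff_mem, List.all_eq_true] at hcl
  classical
  refine ⟨(V.map f).toFinset, Finset.finite_toSet _, ?_, ?_, ?_⟩
  · rw [Set.ncard_coe_finset]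
    exact (List.toFinset_card_le _).trans (by simpa using hlen)
  · simp only [List.coe_toFinset, Set.mem_ofPred_eq, List.mem_map]
    exact ⟨0, hcl.1, hf0⟩
  · intro g hg y hy
    simp only [List.coe_toFinset, Set.mem_ofPred_eq, List.mem_map] at hy ⊢
    obtain ⟨v, hv, rfl⟩ := hy
    have hvg := hcl.2 v hv g hg
    cases hj : image s.2 g v with
    | none => simp [hj] at hvg
    | some j => exact ⟨j, by simpa [hj] using hvg, (hf _ (mem_of_image hj)).symm⟩

theorem relIndex_le_of_completes {gens sub : List ℕ} {l : List Step} {d : ℕ} {K : Subgroup G}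
    (hrels : ∀ w ∈ rels, (w.map γ).prod = 1) (hsub : ∀ g ∈ sub, γ g ∈ K)
    (h : completes rels gens sub l d = true) :
    K.relIndex (Subgroup.closure (γ '' {g | g ∈ gens})) ≠ 0 ∧
      K.relIndex (Subgroup.closure (γ '' {g | g ∈ gens})) ≤ d := by
  set H := Subgroup.closure (γ '' {g | g ∈ gens})
  obtain ⟨Y, hfin, hcard, h1, hY⟩ := exists_finite_set_of_completes (x := ((1 : G) : G ⧸ K)) hrels
    (fun g hg => by
      rw [← MulAction.mem_stabilizer_iff, MulAction.stabilizer_quotient]; exact hsub g hg) h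
  have hH : H ≤ MulAction.stabilizer G Y := by
    refine (Subgroup.closure_le _).2 ?_
    rintro _ ⟨g, hg, rfl⟩
    rw [SetLike.mem_coe, MulAction.mem_stabilizer_set_iff_smul_set_subset hfin]
    rintro _ ⟨y, hy, rfl⟩
    exact hY g hg y hy
  have horb : MulAction.orbit H ((1 : G) : G ⧸ K) ⊆ Y := by
    rintro _ ⟨k, rfl⟩
    have hk := hH k.2
    rw [MulAction.mem_stabilizer_set_iff_smul_set_subset hfin] at hk
    exact hk ⟨_, h1, rfl⟩
  have hstab : MulAction.stabilizer H ((1 : G) : G ⧸ K) = K.subgroupOf H := by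
    ext k
    exact (SetLike.ext_iff.1 (MulAction.stabilizer_quotient K) (k : G)).trans
      Subgroup.mem_subgroupOf.symm
  rw [Subgroup.relIndex, ← hstab, MulAction.index_stabilizer]
  refine ⟨?_, (Set.ncard_le_ncard horb hfin).trans hcard⟩
  exact ((Set.ncard_pos (hfin.subset horb)).2 ⟨_, MulAction.mem_orbit_self _⟩).ne'

end Soundness

section Orbits

variable {α : Type*} [DecidableEq α]

/-- Each entry of the list is `x` or the image of a later entry under one of the `σ g`. -/
def reaches (σ : ℕ → Equiv.Perm α) (gens : List ℕ) (x : α) : List α → Bool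
  | [] => true
  | y :: L => (y == x || L.any fun z => gens.any fun g => σ g z == y) && reaches σ gens x L

theorem mem_orbit_of_reaches {G : Type*} [Group G] {γ : ℕ → G} {σ : ℕ → Equiv.Perm α}
    (φ : G →* Equiv.Perm α) (hφ : ∀ g, φ (γ g) = σ g) {gens : List ℕ} {x : α} {L : List α}
    (h : reaches σ gens x L = true) :
    ∀ y ∈ L, ∃ k ∈ Subgroup.closure (γ '' {g | g ∈ gens}), φ k x = y := by
  induction L with
  | nil => simp
  | cons y L ih =>
    simp only [reaches, Bool.and_eq_true, Bool.or_eq_true, beq_iff_eq, List.any_eq_true] at h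
    obtain ⟨h, hL⟩ := h
    rintro _ (_ | ⟨_, hy⟩)
    · rcases h with rfl | ⟨z, hz, g, hg, rfl⟩
      · exact ⟨1, one_mem _, by simp⟩
      · obtain ⟨k, hk, rfl⟩ := ih hL z hz
        exact ⟨γ g * k, mul_mem (Subgroup.subset_closure ⟨g, hg, rfl⟩) hk, by simp [hφ]⟩
    · exact ih hL _ hy

theorem le_relIndex_of_reaches [Finite α] {G : Type*} [Group G] {γ : ℕ → G}
    {σ : ℕ → Equiv.Perm α} (φ : G →* Equiv.Perm α) (hφ : ∀ g, φ (γ g) = σ g) {gens : List ℕ}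
    {x : α} {L : List α} (h : reaches σ gens x L = true) (hL : L.Nodup) {K : Subgroup G}
    (hK : ∀ k ∈ K, φ k x = x)
    (h0 : K.relIndex (Subgroup.closure (γ '' {g | g ∈ gens})) ≠ 0) :
    L.length ≤ K.relIndex (Subgroup.closure (γ '' {g | g ∈ gens})) := by
  let : MulAction G α := MulAction.compHom α φ
  set H := Subgroup.closure (γ '' {g | g ∈ gens})
  have hle : K.subgroupOf H ≤ MulAction.stabilizer H x := fun k hk => hK k hk
  refine le_trans ?_ (Nat.le_of_dvd (Nat.pos_of_ne_zero h0) (Subgroup.index_dvd_of_le hle))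
  rw [MulAction.index_stabilizer, ← List.toFinset_card_of_nodup hL, ← Set.ncard_coe_finset]
  refine Set.ncard_le_ncard ?_ (Set.toFinite _)
  intro y hy
  obtain ⟨k, hk, rfl⟩ := mem_orbit_of_reaches φ hφ h y (by simpa using hy)
  exact ⟨⟨k, hk⟩, rfl⟩

/-- The permutation of `Fin d` given by a table, with the `m`-th iterate of the table as inverse. -/
def tablePerm {d : ℕ} [NeZero d] (l : List ℕ) (m : ℕ)
    (h : ∀ i : Fin d, (fun j : Fin d => Fin.ofNat d (l.getD j 0))^[m + 1] i = i) :
    Equiv.Perm (Fin d) where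
  toFun j := Fin.ofNat d (l.getD j 0)
  invFun := (fun j => Fin.ofNat d (l.getD j 0))^[m]
  left_inv i := h i
  right_inv i := by simpa only [Function.iterate_succ_apply'] using h i

end Orbits

end CosetEnumeration

open CosetEnumeration

/-- The sequence of generators starting with `P`, `Q`, `R`. -/
def genSeq {M : Type*} (P Q R : M) : ℕ → M
  | 0 => P
  | 1 => Q
  | _ => R

/-- The relators of type `{3,3,6}` as words in the generators. -/
def tessWords (a b : ℕ) : List (List ℕ) :=
  [[0, 0, 0], [1, 1, 1], [2, 2, 2, 2, 2, 2], [0, 1, 0, 1], [1, 2, 1, 2], [0, 1, 2, 0, 1, 2],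
    (List.replicate a [1, 2, 2, 2, 2]).flatten ++ (List.replicate b [2, 1, 2, 2, 2]).flatten]

theorem lift_tessRels_iff {M : Type*} [Group M] (P Q R : M) (a b : ℕ) :
    (∀ r ∈ tessRels 3 3 6 a b, FreeGroup.lift ![P, Q, R] r = 1) ↔
      ∀ w ∈ tessWords a b, (w.map (genSeq P Q R)).prod = 1 := by
  simp [tessRels, tessWords, genSeq, List.prod_flatten, pow_succ, mul_assoc]

namespace tessGroup

variable {a b : ℕ}

/-- The generators of `tessGroup`. -/
def of (a b : ℕ) (i : Fin 3) : tessGroup 3 3 6 a b :=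
  PresentedGroup.of (rels := tessRels 3 3 6 a b) i

/-- The generators of `tessGroup` as a sequence. -/
def gen (a b : ℕ) : ℕ → tessGroup 3 3 6 a b := genSeq (of a b 0) (of a b 1) (of a b 2)

theorem prod_gen : ∀ w ∈ tessWords a b, (w.map (gen a b)).prod = 1 := by
  refine (lift_tessRels_iff _ _ _ a b).1 fun r hr => ?_
  have h : FreeGroup.lift ![of a b 0, of a b 1, of a b 2] =
      PresentedGroup.mk (tessRels 3 3 6 a b) := by
    ext i
    fin_cases i <;> simp [of] <;> rfl
  rw [h]
  exact PresentedGroup.one_of_mem hr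

theorem closure_gen : Subgroup.closure (gen a b '' {g | g ∈ [0, 1, 2]}) = ⊤ := by
  rw [eq_top_iff]
  refine (PresentedGroup.closure_range_of (tessRels 3 3 6 a b)).ge.trans ?_
  refine (Subgroup.closure_le _).2 ?_
  rintro _ ⟨i, rfl⟩
  refine Subgroup.subset_closure ⟨i, by fin_cases i <;> simp, ?_⟩
  fin_cases i <;> rfl

/-- The homomorphism to a group whose elements `P`, `Q`, `R` satisfy the relations. -/
theorem exists_hom {M : Type*} [Group M] {P Q R : M}
    (h : ∀ w ∈ tessWords a b, (w.map (genSeq P Q R)).prod = 1) :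
    ∃ φ : tessGroup 3 3 6 a b →* M, ∀ g, φ (gen a b g) = genSeq P Q R g := by
  refine ⟨PresentedGroup.toGroup ((lift_tessRels_iff P Q R a b).2 h), fun g => ?_⟩
  match g with
  | 0 => exact PresentedGroup.toGroup.of _
  | 1 => exact PresentedGroup.toGroup.of _
  | _ + 2 => exact PresentedGroup.toGroup.of _

/-- The order of `tessGroup`, from coset enumerations of the subgroup generated by `Q`, `R` in the
group and of the subgroup generated by `R` in the former, and a permutation representation in which
the first subgroup fixes `0` and the second fixes `x`. -/
theorem finite_and_card {d n : ℕ} [NeZero d] {P Q R : Equiv.Perm (Fin d)}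
    (l₁ l₂ : List Step) (x : Fin d) (L : List (Fin d))
    (h₁ : completes (tessWords a b) [0, 1, 2] [1, 2] l₁ d = true)
    (h₂ : completes (tessWords a b) [1, 2] [2] l₂ n = true)
    (hperm : ∀ w ∈ tessWords a b, (w.map (genSeq P Q R)).prod = 1)
    (hsign : ∀ w ∈ tessWords a b, (w.map (genSeq (1 : ℤˣ) 1 (-1))).prod = 1)
    (hfix : Q 0 = 0 ∧ R 0 = 0 ∧ R x = x) (hR : R ^ 2 ≠ 1)
    (hd : reaches (genSeq P Q R) [0, 1, 2] 0 (List.finRange d).reverse = true)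
    (hn : reaches (genSeq P Q R) [1, 2] x L = true) (hL : L.Nodup) (hlen : L.length = n) :
    Finite (tessGroup 3 3 6 a b) ∧ Nat.card (tessGroup 3 3 6 a b) = 6 * n * d := by
  obtain ⟨φ, hφ⟩ := exists_hom hperm
  obtain ⟨ε, hε⟩ := exists_hom hsign
  set H := Subgroup.closure (gen a b '' {g | g ∈ [1, 2]}) with hH
  set K := Subgroup.zpowers (gen a b 2) with hK
  have hKH : K ≤ H := by
    rw [hK, Subgroup.zpowers_le]
    exact Subgroup.subset_closure ⟨2, by simp, rfl⟩
  have hindex : H.index = d := by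
    have h := relIndex_le_of_completes (K := H) prod_gen
      (fun g hg => Subgroup.subset_closure ⟨g, hg, rfl⟩) h₁
    have hle := le_relIndex_of_reaches φ hφ hd (List.nodup_reverse.2 (List.nodup_finRange d))
      (K := H) (fun k hk => ?_) h.1
    · rw [closure_gen, Subgroup.relIndex_top_right] at h hle
      exact h.2.antisymm (by simpa using hle)
    · have hst : H ≤ (MulAction.stabilizer (Equiv.Perm (Fin d)) (0 : Fin d)).comap φ := by
        refine (Subgroup.closure_le _).2 ?_
        rintro _ ⟨g, hg, rfl⟩
        simp only [List.mem_cons, List.not_mem_nil, or_false, Set.mem_ofPred_eq] at hg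
        rcases hg with rfl | rfl
        · rw [SetLike.mem_coe, Subgroup.mem_comap, hφ]; exact hfix.1
        · rw [SetLike.mem_coe, Subgroup.mem_comap, hφ]; exact hfix.2.1
      exact hst hk
  obtain ⟨hne, hle⟩ := relIndex_le_of_completes (K := K) prod_gen
    (fun g hg => by
      rw [List.mem_singleton.1 hg]
      exact Subgroup.mem_zpowers _) h₂
  have hrel : K.relIndex H = n := by
    have hge := le_relIndex_of_reaches φ hφ hn hL (K := K) (fun k hk => ?_) hne
    · exact hle.antisymm (hlen ▸ hge)
    · have hst : K ≤ (MulAction.stabilizer (Equiv.Perm (Fin d)) x).comap φ := by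
        rw [hK, Subgroup.zpowers_le]
        rw [Subgroup.mem_comap, hφ]; exact hfix.2.2
      exact hst hk
  have horder : orderOf (gen a b 2) = 6 := by
    refine orderOf_eq_of_pow_and_pow_div_prime (by norm_num) ?_ ?_
    · simpa [pow_succ, mul_assoc] using prod_gen (a := a) (b := b) [2, 2, 2, 2, 2, 2]
        (by simp [tessWords])
    · intro p hp hp6 h
      have hp' : p ∈ Nat.primeFactors 6 := by simp [hp, hp6]
      rw [show Nat.primeFactors 6 = {2, 3} by decide +kernel] at hp'
      simp only [Finset.mem_insert, Finset.mem_singleton] at hp'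
      rcases hp' with rfl | rfl
      · have := congrArg ε h
        rw [map_pow, hε, map_one] at this
        exact absurd this (by decide)
      · have := congrArg φ h
        rw [map_pow, hφ, map_one] at this
        exact hR this
  have hcard : Nat.card (tessGroup 3 3 6 a b) = 6 * n * d := by
    rw [← H.card_mul_index, hindex, ← Subgroup.relIndex_bot_left,
      ← Subgroup.relIndex_mul_relIndex _ _ _ bot_le hKH, hrel, Subgroup.relIndex_bot_left,
      Nat.card_zpowers, horder]
  refine ⟨Nat.finite_of_card_ne_zero ?_, hcard⟩
  rw [hcard]
  exact mul_ne_zero (mul_ne_zero (by norm_num) (hrel ▸ hne)) (NeZero.ne d)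

theorem card_2_0 :
    Finite (tessGroup 3 3 6 2 0) ∧ Nat.card (tessGroup 3 3 6 2 0) = 120 :=
  finite_and_card (d := 5) (n := 4)
    (P := tablePerm
      [1, 2, 0, 3, 4] 2 (by decide +kernel))
    (Q := tablePerm
      [0, 2, 3, 1, 4] 2 (by decide +kernel))
    (R := tablePerm
      [0, 1, 3, 4, 2] 5 (by decide +kernel))
    [.new 0 0, .new 0 1, .ded 0 0 0, .ded 3 1 2, .ded 5 2 1, .new 1 2, .ded 1 0 1, .ded 3 2 3,
     .ded 4 1 3, .new 2 3, .ded 6 2 2, .ded 6 5 4, .ded 5 3 4]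
    [.new 1 0, .new 1 1, .ded 1 0 0, .ded 4 1 2, .new 2 2, .ded 6 2 1, .ded 6 5 3]
    1 [4, 3, 2, 1]
    (by decide +kernel) (by decide +kernel) (by decide +kernel) (by decide +kernel)
    (by decide +kernel) (by decide +kernel) (by decide +kernel) (by decide +kernel)
    (by decide +kernel) rfl

theorem card_2_1 :
    Finite (tessGroup 3 3 6 2 1) ∧ Nat.card (tessGroup 3 3 6 2 1) = 336 :=
  finite_and_card (d := 8) (n := 7)
    (P := tablePerm
      [1, 2, 0, 3, 5, 7, 6, 4] 2 (by decide +kernel))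
    (Q := tablePerm
      [0, 2, 3, 1, 6, 5, 7, 4] 2 (by decide +kernel))
    (R := tablePerm
      [0, 1, 3, 4, 7, 6, 2, 5] 5 (by decide +kernel))
    [.new 0 0, .new 1 1, .ded 3 0 0, .ded 5 2 1, .ded 0 1 2, .new 2 2, .ded 4 0 1, .ded 1 1 3,
     .ded 3 2 3, .new 2 3, .new 1 4, .ded 4 1 2, .ded 5 3 5, .new 1 5, .ded 1 0 4, .ded 3 0 4,
     .new 0 4, .ded 0 1 6, .ded 3 1 7, .new 2 4, .new 2 8, .ded 2 1 5, .col 6 5 8, .ded 4 2 9,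
     .col 5 3 9]
    [.new 1 0, .new 1 1, .ded 1 0 0, .ded 4 1 2, .new 2 2, .new 1 3, .ded 4 1 1, .new 1 4,
     .ded 1 0 3, .new 2 3, .new 2 6, .ded 2 1 4, .col 6 5 6, .ded 4 2 7]
    1 [5, 7, 6, 4, 3, 2, 1]
    (by decide +kernel) (by decide +kernel) (by decide +kernel) (by decide +kernel)
    (by decide +kernel) (by decide +kernel) (by decide +kernel) (by decide +kernel)
    (by decide +kernel) rfl

theorem card_2_2 :
    Finite (tessGroup 3 3 6 2 2) ∧ Nat.card (tessGroup 3 3 6 2 2) = 1440 :=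
  finite_and_card (d := 20) (n := 12)
    (P := tablePerm
      [1, 2, 0, 3, 5, 8, 6, 10, 4, 14, 16, 12, 15, 17, 18, 11, 7, 19, 9, 13] 2 (by decide +kernel))
    (Q := tablePerm
      [0, 2, 3, 1, 6, 5, 8, 11, 4, 15, 14, 18, 16, 12, 17, 19, 13, 10, 7, 9] 2 (by decide +kernel))
    (R := tablePerm
      [0, 1, 3, 4, 7, 9, 2, 12, 13, 15, 17, 8, 6, 11, 14, 5, 18, 10, 16, 19] 5 (by decide +kernel))
    [.new 0 0, .new 0 1, .ded 0 0 0, .ded 3 1 2, .ded 5 2 1, .new 1 2, .ded 1 0 1, .ded 3 2 3,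
     .ded 4 1 3, .new 2 3, .new 1 4, .ded 4 1 2, .ded 5 3 5, .new 1 5, .ded 1 0 4, .ded 3 0 4,
     .new 0 4, .ded 0 1 6, .ded 3 1 7, .new 2 4, .new 1 8, .ded 4 1 6, .new 1 9, .ded 1 0 8,
     .new 2 8, .ded 2 1 5, .ded 5 3 11, .new 0 11, .ded 0 0 9, .new 1 11, .ded 3 0 8, .ded 4 1 10,
     .ded 6 18 13, .new 0 8, .ded 0 1 13, .new 1 13, .ded 1 0 11, .ded 4 3 15, .ded 4 1 9,
     .ded 5 2 7, .new 0 10, .ded 3 1 12, .ded 4 3 16, .new 0 16, .ded 0 0 10, .ded 3 1 17,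
     .new 1 12, .ded 1 1 16, .ded 3 2 15, .ded 5 2 12, .ded 4 1 18, .new 0 15, .ded 0 1 18,
     .ded 3 1 14, .ded 3 3 19, .ded 5 2 14, .ded 5 2 19, .ded 5 5 17]
    [.new 1 0, .new 1 1, .ded 1 0 0, .ded 4 1 2, .new 2 2, .new 1 3, .ded 4 1 1, .new 1 4,
     .ded 1 0 3, .new 2 3, .new 1 6, .ded 4 1 5, .new 1 7, .ded 1 0 6, .new 2 6, .ded 2 1 4,
     .new 2 5, .ded 4 2 9, .ded 6 13 7, .new 1 9, .ded 1 1 10, .ded 4 1 8, .ded 4 3 11]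
    1 [16, 18, 13, 12, 11, 8, 7, 6, 4, 3, 2, 1]
    (by decide +kernel) (by decide +kernel) (by decide +kernel) (by decide +kernel)
    (by decide +kernel) (by decide +kernel) (by decide +kernel) (by decide +kernel)
    (by decide +kernel) rfl

theorem card_3_0 :
    Finite (tessGroup 3 3 6 3 0) ∧ Nat.card (tessGroup 3 3 6 3 0) = 648 :=
  finite_and_card (d := 12) (n := 9)
    (P := tablePerm
      [1, 2, 0, 3, 5, 8, 6, 7, 4, 10, 11, 9] 2 (by decide +kernel))
    (Q := tablePerm
      [0, 2, 3, 1, 6, 5, 8, 10, 4, 9, 11, 7] 2 (by decide +kernel))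
    (R := tablePerm
      [0, 1, 3, 4, 7, 9, 2, 11, 10, 5, 8, 6] 5 (by decide +kernel))
    [.new 0 0, .new 1 1, .ded 3 0 0, .ded 5 2 1, .ded 0 1 2, .new 2 2, .ded 4 0 1, .ded 1 1 3,
     .ded 3 2 3, .new 2 3, .new 1 4, .ded 4 1 2, .ded 5 3 5, .new 1 5, .ded 1 0 4, .ded 3 0 4,
     .new 0 4, .ded 0 1 6, .ded 3 1 7, .new 2 4, .new 2 8, .ded 2 1 5, .ded 6 5 8, .new 1 8,
     .ded 1 1 9, .ded 4 1 6, .ded 4 3 10, .ded 5 3 9, .ded 3 0 8, .new 0 9, .ded 0 1 10,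
     .ded 3 1 11, .ded 5 2 7, .ded 5 5 11]
    [.new 1 0, .new 1 1, .ded 1 0 0, .ded 4 1 2, .new 2 2, .new 1 3, .ded 4 1 1, .new 1 4,
     .ded 1 0 3, .new 2 3, .new 2 6, .ded 2 1 4, .ded 6 5 6, .new 2 5, .ded 4 2 7, .ded 1 2 8,
     .ded 4 1 5]
    1 [11, 10, 8, 7, 6, 4, 3, 2, 1]
    (by decide +kernel) (by decide +kernel) (by decide +kernel) (by decide +kernel)
    (by decide +kernel) (by decide +kernel) (by decide +kernel) (by decide +kernel)
    (by decide +kernel) rfl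

theorem card_3_1 :
    Finite (tessGroup 3 3 6 3 1) ∧ Nat.card (tessGroup 3 3 6 3 1) = 2184 :=
  finite_and_card (d := 28) (n := 13)
    (P := tablePerm
      [1, 2, 0, 3, 5, 8, 6, 10, 4, 14, 16, 12, 15, 17, 18, 11, 7, 20, 9, 21, 13, 23, 22, 19, 25, 27,
       26, 24] 2 (by decide +kernel))
    (Q := tablePerm
      [0, 2, 3, 1, 6, 5, 8, 11, 4, 15, 14, 18, 16, 12, 17, 20, 13, 10, 7, 19, 9, 23, 21, 22, 26, 25,
       27, 24] 2 (by decide +kernel))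
    (R := tablePerm
      [0, 1, 3, 4, 7, 9, 2, 12, 13, 10, 17, 8, 6, 19, 20, 5, 18, 21, 11, 16, 22, 15, 24, 14, 26, 25,
       23, 27] 5 (by decide +kernel))
    [.new 0 0, .new 0 1, .ded 0 0 0, .ded 3 1 2, .ded 5 2 1, .new 1 2, .ded 1 0 1, .ded 3 2 3,
     .ded 4 1 3, .new 2 3, .new 1 4, .ded 4 1 2, .ded 5 3 5, .new 1 5, .ded 1 0 4, .ded 3 0 4,
     .new 0 4, .ded 0 1 6, .ded 3 1 7, .new 2 4, .new 1 8, .ded 4 1 6, .new 1 9, .ded 1 0 8,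
     .new 2 8, .ded 2 1 5, .ded 5 3 11, .new 0 11, .ded 0 0 9, .new 1 11, .ded 3 0 8, .ded 4 1 10,
     .ded 6 18 9, .new 0 8, .ded 0 1 13, .new 1 13, .ded 1 0 11, .ded 4 3 15, .ded 5 2 7, .new 0 10,
     .ded 3 1 12, .ded 4 3 16, .new 0 16, .ded 0 0 10, .ded 3 1 17, .ded 5 2 14, .new 1 12,
     .ded 1 1 16, .ded 3 2 15, .ded 4 1 18, .new 0 15, .ded 0 1 18, .ded 3 1 14, .ded 3 3 19,
     .ded 5 2 19, .new 2 15, .ded 2 3 13, .ded 6 10 20, .new 2 19, .ded 2 1 12, .ded 5 3 21,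
     .new 0 21, .ded 0 0 20, .ded 3 1 22, .ded 4 1 17, .new 1 22, .ded 1 0 21, .ded 3 2 23,
     .ded 4 3 23, .new 2 23, .new 1 24, .ded 4 1 22, .ded 2 2 25, .ded 5 3 25, .new 1 25,
     .ded 1 0 24, .ded 3 0 24, .ded 4 1 26, .new 0 24, .ded 0 1 26, .ded 3 1 27, .ded 5 2 27]
    [.new 1 0, .new 1 1, .ded 1 0 0, .ded 4 1 2, .new 2 2, .new 1 3, .ded 4 1 1, .new 1 4,
     .ded 1 0 3, .new 2 3, .new 1 6, .ded 4 1 5, .new 1 7, .ded 1 0 6, .new 2 6, .ded 2 1 4,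
     .new 2 5, .ded 4 2 9, .new 1 9, .ded 1 1 10, .ded 4 1 8, .ded 6 8 7, .new 2 10, .ded 2 3 11,
     .ded 6 10 12]
    1 [19, 16, 18, 13, 12, 11, 8, 7, 6, 4, 3, 2, 1]
    (by decide +kernel) (by decide +kernel) (by decide +kernel) (by decide +kernel)
    (by decide +kernel) (by decide +kernel) (by decide +kernel) (by decide +kernel)
    (by decide +kernel) rfl

theorem card_3_2 :
    Finite (tessGroup 3 3 6 3 2) ∧ Nat.card (tessGroup 3 3 6 3 2) = 6840 :=
  finite_and_card (d := 60) (n := 19)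
    (P := tablePerm
      [1, 2, 0, 3, 5, 8, 6, 10, 4, 14, 17, 12, 15, 18, 19, 11, 23, 7, 22, 9, 28, 31, 13, 30, 36, 37,
       39, 25, 43, 38, 16, 35, 24, 44, 45, 21, 32, 27, 40, 42, 29, 49, 26, 20, 51, 48, 46, 47, 34,
       50, 41, 33, 54, 56, 58, 55, 59, 57, 52, 53] 2 (by decide +kernel))
    (Q := tablePerm
      [0, 2, 3, 1, 6, 5, 8, 11, 4, 15, 14, 19, 17, 12, 18, 22, 24, 13, 10, 7, 29, 32, 9, 31, 35, 23,
       40, 36, 39, 42, 27, 25, 37, 33, 38, 16, 30, 21, 43, 45, 48, 49, 20, 34, 51, 28, 44, 41, 26,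
       47, 50, 46, 55, 57, 54, 58, 56, 59, 52, 53] 2 (by decide +kernel))
    (R := tablePerm
      [0, 1, 3, 4, 7, 9, 2, 12, 13, 16, 18, 8, 6, 20, 21, 5, 25, 19, 26, 27, 30, 33, 34, 35, 22, 38,
       41, 42, 32, 17, 36, 44, 10, 37, 43, 46, 11, 45, 15, 47, 14, 28, 50, 31, 24, 40, 52, 53, 39,
       48, 29, 23, 55, 57, 54, 51, 56, 49, 58, 59] 5 (by decide +kernel))
    [.new 0 0, .new 1 1, .ded 3 0 0, .ded 5 2 1, .ded 0 1 2, .new 2 2, .ded 4 0 1, .ded 1 1 3,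
     .ded 3 2 3, .new 2 3, .new 1 4, .ded 4 1 2, .ded 5 3 5, .new 1 5, .ded 1 0 4, .ded 3 0 4,
     .new 0 4, .ded 0 1 6, .ded 3 1 7, .new 2 4, .new 2 8, .ded 2 1 5, .new 1 8, .ded 4 1 6,
     .ded 5 3 9, .new 2 6, .ded 4 2 9, .new 0 9, .ded 0 1 10, .ded 5 2 7, .new 2 7, .ded 4 2 12,
     .new 1 10, .ded 1 0 8, .ded 3 2 13, .new 0 13, .ded 0 1 14, .new 1 9, .ded 1 1 11, .ded 3 0 8,
     .ded 4 1 14, .new 0 8, .ded 0 1 16, .ded 3 1 15, .new 2 17, .ded 5 1 17, .ded 1 2 18,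
     .ded 3 2 18, .new 0 18, .ded 0 0 11, .ded 3 1 19, .ded 3 1 13, .new 2 19, .new 1 20,
     .ded 4 1 12, .new 0 21, .ded 5 2 15, .new 2 18, .ded 4 2 22, .new 0 22, .ded 0 0 21,
     .ded 5 2 16, .new 2 11, .ded 4 2 24, .new 1 21, .ded 1 0 20, .ded 3 2 25, .new 1 24,
     .ded 1 1 25, .ded 3 0 23, .new 1 22, .ded 1 1 23, .ded 3 0 20, .new 0 20, .ded 0 1 28,
     .new 1 29, .ded 3 0 26, .ded 0 2 30, .new 1 30, .ded 1 0 29, .ded 3 0 27, .ded 3 2 31,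
     .new 2 25, .new 2 32, .ded 2 1 10, .ded 6 10 32, .new 2 14, .ded 4 2 33, .ded 6 6 27,
     .ded 1 2 34, .new 2 27, .ded 2 2 24, .ded 6 16 35, .new 0 35, .ded 5 2 30, .new 0 34,
     .ded 5 2 21, .new 0 33, .ded 5 2 17, .new 2 13, .ded 2 3 37, .new 1 39, .ded 4 1 19,
     .ded 5 3 33, .ded 0 1 40, .ded 3 2 39, .new 2 15, .ded 4 2 38, .new 1 37, .ded 3 0 32,
     .ded 0 1 42, .new 2 42, .ded 4 0 39, .ded 1 1 43, .ded 3 2 41, .new 2 26, .ded 4 2 37,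
     .ded 1 1 44, .ded 3 2 43, .ded 0 2 44, .new 0 37, .ded 0 0 34, .ded 3 1 45, .ded 3 1 41,
     .ded 5 2 29, .ded 5 5 38, .ded 2 3 36, .new 1 36, .ded 3 0 35, .ded 4 1 28, .ded 0 1 46,
     .new 2 31, .ded 4 2 36, .ded 1 1 47, .ded 3 2 47, .new 2 47, .new 1 48, .ded 4 1 46,
     .ded 5 3 49, .new 1 49, .ded 1 0 48, .ded 3 0 48, .new 0 48, .ded 0 1 50, .ded 3 1 51,
     .new 2 51, .new 1 52, .ded 4 1 51, .new 0 53, .ded 5 2 50, .new 2 48, .ded 4 2 54, .new 0 54,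
     .ded 0 0 53, .ded 5 2 49, .new 2 50, .ded 4 2 56, .new 1 53, .ded 1 0 52, .ded 3 2 57,
     .new 1 56, .ded 1 1 57, .ded 3 0 55, .new 1 54, .ded 1 1 55, .ded 3 0 52, .new 0 52,
     .ded 0 1 60, .new 1 61, .ded 3 0 58, .ded 0 2 62, .new 1 62, .ded 1 0 61, .ded 3 0 59,
     .ded 3 2 63, .new 2 55, .new 2 64, .ded 2 0 31, .ded 6 18 54, .ded 4 1 59, .ded 5 5 53,
     .ded 5 2 63, .col 6 0 51, .pre 2 51, .pre 0 51, .img 1 56, .img 0 55, .pre 2 55, .pre 0 56,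
     .img 0 56, .pre 1 56, .pre 2 54, .img 2 56, .pre 2 49, .img 2 49, .img 2 46, .ded 4 1 22,
     .ded 5 5 26, .new 2 41, .ded 2 3 45, .ded 6 5 66, .new 2 44, .ded 2 1 40, .ded 5 3 67,
     .new 1 67, .ded 3 0 66, .ded 4 1 42, .ded 0 1 68, .new 2 43, .ded 4 2 67, .ded 1 1 69,
     .ded 3 2 69, .new 2 69, .new 1 70, .ded 4 1 68, .ded 2 2 71, .ded 5 3 71, .new 1 71,
     .ded 1 0 70, .ded 3 0 70, .ded 4 1 72, .new 0 70, .ded 0 1 72, .ded 3 1 73, .ded 5 2 73]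
    [.new 1 0, .new 1 1, .ded 1 0 0, .ded 4 1 2, .new 2 2, .new 1 3, .ded 4 1 1, .new 1 4,
     .ded 1 0 3, .new 2 3, .new 2 6, .ded 2 1 4, .new 1 6, .ded 4 1 5, .new 1 8, .ded 1 0 6,
     .new 1 7, .ded 4 1 9, .new 1 10, .ded 1 0 7, .ded 4 3 11, .new 2 11, .new 1 12, .ded 4 1 10,
     .new 1 13, .ded 1 0 12, .new 2 12, .new 2 15, .ded 2 1 8, .ded 6 10 15, .new 2 9, .ded 4 2 16,
     .ded 6 6 14, .ded 1 2 17, .new 2 14, .ded 2 2 13, .ded 6 16 18]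
    1 [50, 42, 36, 30, 29, 27, 20, 17, 19, 13, 12, 11, 8, 7, 6, 4, 3, 2, 1]
    (by decide +kernel) (by decide +kernel) (by decide +kernel) (by decide +kernel)
    (by decide +kernel) (by decide +kernel) (by decide +kernel) (by decide +kernel)
    (by decide +kernel) rfl

theorem card_4_0 :
    Finite (tessGroup 3 3 6 4 0) ∧ Nat.card (tessGroup 3 3 6 4 0) = 7680 :=
  finite_and_card (d := 80) (n := 16)
    (P := tablePerm
      [1, 2, 0, 3, 5, 8, 6, 10, 4, 14, 17, 12, 15, 18, 19, 11, 23, 7, 22, 9, 16, 29, 13, 20, 32, 34,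
       24, 35, 25, 33, 38, 31, 26, 21, 28, 36, 27, 43, 46, 48, 50, 52, 55, 49, 39, 59, 30, 62, 44,
       37, 60, 45, 64, 53, 54, 58, 56, 71, 42, 51, 40, 57, 63, 47, 41, 66, 70, 68, 69, 67, 65, 61,
       75, 72, 74, 73, 77, 79, 78, 76] 2 (by decide +kernel))
    (Q := tablePerm
      [0, 2, 3, 1, 6, 5, 8, 11, 4, 15, 14, 19, 17, 12, 18, 22, 24, 13, 10, 7, 27, 26, 9, 29, 33, 34,
       36, 32, 28, 35, 39, 25, 20, 16, 31, 23, 21, 44, 43, 49, 51, 53, 48, 55, 58, 60, 42, 59, 46,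
       30, 62, 63, 52, 64, 66, 38, 69, 50, 37, 71, 61, 45, 57, 40, 41, 65, 70, 56, 68, 67, 54, 47,
       75, 73, 72, 74, 78, 77, 79, 76] 2 (by decide +kernel))
    (R := tablePerm
      [0, 1, 3, 4, 7, 9, 2, 12, 13, 16, 18, 8, 6, 20, 21, 5, 25, 19, 26, 27, 28, 30, 29, 31, 22, 35,
       10, 17, 32, 37, 40, 41, 11, 42, 33, 15, 14, 45, 47, 36, 39, 54, 56, 57, 23, 48, 61, 50, 24,
       63, 38, 49, 65, 34, 67, 68, 70, 72, 69, 55, 58, 73, 71, 51, 66, 52, 64, 44, 43, 46, 53, 74,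
       59, 60, 76, 62, 78, 77, 75, 79] 5 (by decide +kernel))
    [.new 0 0, .new 0 1, .ded 0 0 0, .ded 3 1 2, .ded 5 2 1, .new 1 2, .ded 1 0 1, .ded 3 2 3,
     .ded 4 1 3, .new 2 3, .new 1 4, .ded 4 1 2, .ded 5 3 5, .new 1 5, .ded 1 0 4, .ded 3 0 4,
     .new 0 4, .ded 0 1 6, .ded 3 1 7, .new 2 4, .new 1 8, .ded 4 1 6, .new 1 9, .ded 1 0 8,
     .new 2 8, .ded 2 1 5, .ded 5 3 11, .new 0 11, .ded 0 0 9, .new 1 11, .ded 3 0 8, .ded 4 1 10,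
     .new 0 8, .ded 0 1 13, .new 1 13, .ded 1 0 11, .ded 4 3 15, .ded 5 2 7, .new 0 10, .ded 3 1 12,
     .ded 4 3 16, .new 0 16, .ded 0 0 10, .ded 3 1 17, .new 1 12, .ded 1 1 16, .ded 3 2 15,
     .new 0 15, .ded 0 1 18, .ded 3 1 14, .ded 3 3 19, .ded 5 2 19, .new 2 10, .ded 6 7 13,
     .new 1 20, .ded 4 1 9, .new 1 21, .ded 1 0 20, .ded 4 3 22, .new 2 22, .ded 2 2 21,
     .ded 6 10 23, .new 0 21, .ded 5 2 14, .new 0 24, .ded 0 0 21, .new 1 24, .ded 3 0 20,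
     .ded 5 5 24, .ded 4 1 17, .new 0 20, .ded 0 1 26, .ded 5 2 12, .new 1 26, .ded 1 0 24,
     .ded 4 3 28, .ded 5 2 18, .new 0 22, .ded 3 1 25, .ded 4 3 29, .new 0 29, .ded 0 0 22,
     .ded 3 1 30, .new 1 25, .ded 1 1 29, .ded 3 2 28, .new 0 28, .ded 0 1 31, .ded 3 1 27,
     .ded 3 3 32, .ded 4 3 32, .new 2 29, .ded 2 2 27, .ded 5 3 33, .new 0 33, .ded 0 0 23,
     .ded 3 1 34, .ded 4 1 31, .new 1 34, .ded 1 0 33, .ded 3 2 35, .ded 4 3 35, .new 2 28,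
     .new 1 36, .ded 4 1 26, .new 1 37, .ded 1 0 36, .new 2 36, .ded 2 2 37, .new 1 39, .ded 4 1 38,
     .new 1 40, .ded 1 0 39, .ded 4 3 41, .ded 6 13 40, .new 0 37, .ded 5 2 25, .new 0 42,
     .ded 0 0 37, .new 1 42, .ded 3 0 36, .new 0 36, .ded 0 1 44, .new 1 44, .ded 1 0 42,
     .ded 4 3 46, .ded 5 2 30, .new 0 38, .ded 3 1 43, .ded 4 3 47, .new 0 47, .ded 0 0 38,
     .ded 3 1 48, .new 1 43, .ded 1 1 47, .ded 3 2 46, .new 0 46, .ded 0 1 49, .ded 3 1 45,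
     .ded 3 3 50, .new 2 47, .ded 2 2 42, .ded 5 3 51, .new 0 51, .ded 0 0 40, .new 1 51,
     .ded 3 0 39, .ded 4 1 49, .new 0 39, .ded 0 1 53, .ded 5 2 45, .new 1 53, .ded 1 0 51,
     .ded 4 3 55, .ded 5 2 50, .new 0 41, .ded 3 1 52, .ded 4 3 56, .new 0 56, .ded 0 0 41,
     .ded 3 1 57, .ded 5 2 54, .new 1 52, .ded 1 1 56, .ded 3 2 55, .ded 4 1 58, .new 0 55,
     .ded 0 1 58, .ded 3 1 54, .ded 3 3 59, .ded 4 3 59, .new 2 55, .ded 6 7 53, .ded 4 2 60,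
     .new 2 49, .ded 2 0 44, .new 2 46, .ded 4 2 61, .new 1 61, .ded 1 1 62, .ded 4 1 43,
     .ded 5 3 63, .ded 3 0 62, .new 0 63, .ded 0 0 61, .ded 3 1 64, .ded 5 2 48, .ded 5 5 64,
     .new 2 59, .ded 2 3 52, .ded 5 3 65, .new 0 65, .ded 0 0 60, .ded 3 1 66, .ded 4 1 57,
     .new 1 66, .ded 1 0 65, .ded 3 2 67, .ded 4 3 67, .new 2 35, .new 1 68, .ded 4 1 34,
     .ded 5 3 69, .new 1 69, .ded 1 0 68, .ded 3 0 68, .new 0 68, .ded 0 1 70, .ded 3 1 71,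
     .new 2 68, .ded 2 2 63, .new 2 62, .ded 4 2 72, .ded 2 2 69, .ded 5 3 72, .new 1 72,
     .ded 1 1 73, .ded 3 2 73, .ded 4 1 70, .ded 4 3 74, .new 0 73, .ded 0 1 74, .ded 3 1 75,
     .ded 5 2 71, .ded 5 5 75, .new 2 67, .new 1 76, .ded 4 1 66, .ded 2 2 77, .ded 5 3 77,
     .new 1 77, .ded 1 0 76, .ded 3 0 76, .ded 4 1 78, .new 0 76, .ded 0 1 78, .ded 3 1 79,
     .ded 5 2 79]
    [.new 1 0, .new 1 1, .ded 1 0 0, .ded 4 1 2, .new 2 2, .new 1 3, .ded 4 1 1, .new 1 4,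
     .ded 1 0 3, .new 2 3, .new 1 6, .ded 4 1 5, .new 1 7, .ded 1 0 6, .new 2 6, .ded 2 1 4,
     .new 2 5, .ded 4 2 9, .new 1 9, .ded 1 1 10, .ded 4 1 8, .new 2 8, .ded 6 7 11, .new 1 12,
     .ded 4 1 7, .new 1 13, .ded 1 0 12, .ded 4 3 14, .new 2 14, .ded 2 2 13, .ded 6 10 15]
    1 [32, 28, 27, 20, 17, 19, 13, 12, 11, 8, 7, 6, 4, 3, 2, 1]
    (by decide +kernel) (by decide +kernel) (by decide +kernel) (by decide +kernel)
    (by decide +kernel) (by decide +kernel) (by decide +kernel) (by decide +kernel)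
    (by decide +kernel) rfl

theorem card_4_1 :
    Finite (tessGroup 3 3 6 4 1) ∧ Nat.card (tessGroup 3 3 6 4 1) = 8064 :=
  finite_and_card (d := 64) (n := 21)
    (P := tablePerm
      [1, 2, 0, 3, 5, 8, 6, 10, 4, 14, 17, 12, 15, 18, 19, 11, 23, 7, 22, 9, 28, 31, 13, 35, 37, 39,
       42, 45, 46, 41, 44, 38, 24, 52, 53, 16, 55, 32, 21, 49, 30, 43, 48, 29, 40, 51, 20, 59, 26,
       25, 50, 27, 56, 58, 47, 57, 33, 36, 34, 54, 61, 63, 62, 60] 2 (by decide +kernel))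
    (Q := tablePerm
      [0, 2, 3, 1, 6, 5, 8, 11, 4, 15, 14, 19, 17, 12, 18, 22, 24, 13, 10, 7, 29, 32, 9, 31, 38, 40,
       43, 37, 42, 48, 49, 45, 51, 52, 41, 27, 44, 35, 16, 55, 57, 46, 53, 58, 59, 23, 34, 39, 20,
       54, 33, 21, 50, 28, 30, 47, 56, 25, 26, 36, 62, 61, 63, 60] 2 (by decide +kernel))
    (R := tablePerm
      [0, 1, 3, 4, 7, 9, 2, 12, 13, 16, 18, 8, 6, 20, 21, 5, 25, 19, 26, 27, 30, 33, 34, 36, 22, 41,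
       44, 35, 47, 17, 37, 50, 10, 23, 40, 54, 43, 11, 56, 53, 38, 15, 55, 14, 45, 32, 57, 28, 49,
       48, 60, 31, 51, 39, 29, 42, 24, 46, 59, 58, 62, 61, 52, 63] 5 (by decide +kernel))
    [.new 0 0, .new 1 1, .ded 3 0 0, .ded 5 2 1, .ded 0 1 2, .new 1 2, .ded 1 0 1, .ded 3 2 3,
     .ded 4 1 3, .new 2 3, .new 1 4, .ded 4 1 2, .ded 5 3 5, .new 1 5, .ded 1 0 4, .ded 3 0 4,
     .new 0 4, .ded 0 1 6, .ded 3 1 7, .new 2 4, .new 1 8, .ded 4 1 6, .new 2 8, .ded 2 1 5,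
     .ded 5 3 10, .new 0 10, .ded 0 0 9, .new 2 6, .ded 4 2 10, .ded 5 2 7, .new 1 10, .ded 1 1 12,
     .ded 3 0 8, .new 2 13, .ded 4 0 8, .ded 1 1 14, .new 0 8, .ded 0 1 13, .new 0 14, .ded 3 1 11,
     .ded 4 3 16, .new 1 11, .ded 1 1 16, .ded 3 2 12, .new 0 12, .ded 0 1 17, .ded 3 1 15,
     .ded 5 2 18, .new 1 15, .ded 1 1 18, .ded 3 0 14, .ded 3 2 19, .new 2 18, .new 1 20,
     .ded 4 1 19, .new 1 21, .ded 1 0 20, .new 0 21, .ded 5 2 13, .new 0 23, .ded 0 0 21, .new 2 17,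
     .ded 5 4 24, .ded 3 2 25, .ded 4 1 11, .new 1 23, .ded 3 0 20, .new 1 24, .ded 1 1 25,
     .new 0 20, .ded 0 1 26, .new 0 25, .ded 0 0 22, .ded 3 1 29, .new 2 12, .ded 4 2 23,
     .ded 1 1 30, .ded 3 2 30, .new 0 30, .ded 0 0 27, .ded 3 1 28, .ded 3 1 31, .new 2 30,
     .new 1 32, .ded 4 1 26, .new 1 33, .ded 1 0 32, .new 2 32, .ded 2 1 9, .ded 6 23 33,
     .ded 6 24 23, .new 0 33, .ded 5 2 24, .new 0 36, .ded 0 0 33, .new 2 16, .ded 2 3 36,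
     .new 0 34, .ded 3 1 37, .ded 5 2 31, .ded 5 5 39, .ded 4 1 29, .new 1 35, .ded 4 1 34,
     .new 2 27, .ded 4 2 36, .new 1 38, .ded 4 1 17, .ded 5 3 35, .ded 3 2 38, .new 2 14,
     .ded 4 2 35, .ded 2 3 40, .ded 6 5 43, .new 1 37, .ded 1 1 39, .ded 3 2 41, .ded 4 3 44,
     .new 0 39, .ded 0 0 34, .ded 5 2 22, .new 0 35, .ded 0 1 42, .ded 5 2 15, .new 0 38,
     .ded 0 1 40, .new 1 42, .ded 1 0 38, .new 1 36, .ded 1 1 41, .ded 3 0 32, .ded 4 1 48,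
     .new 1 46, .ded 3 0 43, .new 0 43, .ded 0 1 50, .ded 3 1 47, .ded 5 2 46, .new 0 32,
     .ded 0 1 49, .ded 3 1 45, .ded 4 3 52, .ded 2 2 51, .new 1 50, .ded 1 0 46, .ded 3 2 53,
     .ded 4 3 53, .new 0 41, .ded 0 1 44, .ded 3 1 54, .ded 3 1 52, .ded 4 3 54, .new 0 53,
     .ded 0 0 48, .ded 3 3 55, .ded 3 1 51, .ded 4 3 55, .new 2 41, .new 1 56, .ded 4 1 49,
     .new 0 57, .ded 5 2 37, .new 1 58, .ded 3 0 56, .new 0 56, .ded 0 1 59, .new 1 57, .ded 1 0 56,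
     .new 0 58, .ded 0 0 57, .new 1 59, .ded 1 0 58, .ded 4 3 63, .ded 5 2 45, .new 2 54,
     .ded 4 2 62, .ded 3 2 64, .new 0 63, .ded 3 1 60, .new 0 64, .ded 0 0 61, .ded 3 3 66,
     .ded 1 1 65, .new 1 62, .ded 1 1 64, .ded 3 2 63, .ded 3 2 67, .new 2 55, .new 1 68,
     .ded 4 1 47, .new 1 69, .ded 1 0 68, .new 0 69, .ded 5 2 50, .new 0 71, .ded 0 0 69, .new 2 48,
     .ded 5 4 72, .ded 3 2 73, .ded 4 1 42, .new 0 73, .ded 0 0 70, .new 2 53, .ded 4 2 71,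
     .new 1 72, .ded 1 1 73, .ded 3 2 75, .new 1 71, .ded 1 1 75, .ded 3 0 68, .new 0 75,
     .ded 0 1 76, .ded 3 3 78, .new 0 68, .ded 0 1 77, .ded 3 1 74, .ded 3 1 79, .new 2 73,
     .new 1 80, .ded 4 1 76, .new 0 81, .ded 5 2 69, .new 0 82, .ded 0 0 81, .new 1 81, .ded 1 0 80,
     .new 1 82, .ded 3 0 80, .new 2 74, .ded 5 4 83, .ded 3 2 86, .ded 4 1 79, .new 2 70,
     .ded 4 2 82, .ded 1 1 87, .new 2 80, .ded 2 2 57, .new 0 80, .ded 0 1 85, .new 2 64,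
     .ded 2 2 82, .new 1 88, .ded 4 1 84, .ded 5 3 90, .new 1 90, .ded 3 0 88, .ded 4 1 67,
     .new 0 86, .ded 0 0 84, .ded 3 1 93, .new 0 88, .ded 0 1 92, .new 2 85, .ded 4 2 90,
     .ded 6 23 92, .ded 1 1 95, .new 2 66, .ded 5 4 94, .ded 3 2 96, .ded 4 1 60, .new 2 61,
     .ded 4 2 88, .ded 1 1 97, .new 1 94, .ded 1 1 96, .ded 3 2 97, .new 0 90, .ded 0 1 91,
     .new 2 84, .ded 6 7 61, .new 2 97, .ded 2 3 91, .ded 4 2 101, .new 2 56, .ded 4 2 100,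
     .new 0 96, .ded 0 0 95, .ded 3 1 103, .ded 5 2 99, .ded 4 1 98, .new 0 97, .ded 0 1 98,
     .ded 3 1 99, .ded 3 1 104, .ded 5 5 104, .new 1 83, .ded 1 1 86, .ded 3 2 87, .new 1 93,
     .ded 1 0 89, .ded 3 2 106, .ded 3 2 105, .ded 4 1 106, .new 0 101, .ded 5 2 94, .new 0 100,
     .ded 5 2 58, .new 0 107, .ded 0 0 101, .ded 3 1 109, .ded 5 2 107, .ded 4 1 103, .new 2 98,
     .ded 4 2 107, .ded 1 1 110, .ded 3 2 110, .new 2 60, .ded 2 4 89, .new 1 100, .ded 1 1 102,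
     .ded 4 1 81, .ded 5 3 111, .new 0 108, .ded 0 0 100, .ded 3 1 113, .ded 4 1 65, .new 0 111,
     .ded 0 1 112, .new 1 113, .ded 1 0 111, .ded 4 3 115, .ded 5 2 105, .new 2 59, .ded 4 2 108,
     .ded 3 2 116, .new 2 86, .ded 4 2 114, .ded 3 2 117, .new 1 108, .ded 1 1 116, .ded 3 0 102,
     .ded 0 1 118, .new 0 116, .ded 0 0 115, .ded 3 3 119, .ded 3 1 117, .new 2 65, .new 1 120,
     .ded 4 1 66, .col 6 13 113, .img 1 113, .ded 2 2 93, .ded 5 2 59, .ded 5 5 114, .ded 5 5 85,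
     .ded 6 24 62, .ded 4 3 118, .ded 4 3 83, .new 2 118, .new 2 122, .ded 2 0 28, .ded 6 9 108,
     .col 6 1 28, .pre 2 28, .pre 2 118, .pre 2 28, .pre 0 44, .pre 2 54, .pre 2 47, .pre 0 69,
     .img 2 72, .img 1 72, .img 0 72, .pre 1 69, .pre 0 77, .pre 1 68, .pre 2 69, .img 0 69,
     .pre 2 72, .img 2 70, .pre 2 68, .img 1 55, .img 1 54, .pre 1 54, .pre 0 54, .pre 2 53,
     .img 1 53, .pre 2 52, .img 0 52, .pre 0 52, .pre 0 51, .pre 1 49, .img 1 48, .img 0 47,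
     .img 2 46, .pre 0 46, .img 2 45, .img 0 45, .pre 0 45, .pre 1 44, .pre 2 37, .pre 2 43,
     .img 2 42, .pre 2 41, .pre 2 39, .pre 2 38, .img 0 37, .img 2 36, .img 2 34, .pre 2 33,
     .img 2 35, .pre 2 32, .pre 2 30, .pre 0 29, .img 2 24, .img 0 24, .img 2 23, .pre 2 20,
     .pre 2 16, .pre 0 15, .pre 1 13, .pre 2 12, .img 2 10, .pre 2 8, .new 2 68, .new 2 124,
     .ded 2 1 70, .ded 6 10 125, .ded 5 3 125, .new 1 125, .ded 1 0 124, .ded 3 0 124, .ded 4 1 126,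
     .new 0 124, .ded 0 1 126, .ded 3 1 127, .ded 5 2 127]
    [.new 1 0, .new 1 1, .ded 1 0 0, .ded 4 1 2, .new 2 2, .new 1 3, .ded 4 1 1, .new 1 4,
     .ded 1 0 3, .new 2 3, .new 1 6, .ded 4 1 5, .new 1 7, .ded 1 0 6, .new 2 6, .ded 2 1 4,
     .new 2 5, .ded 4 2 9, .new 1 9, .ded 1 1 10, .ded 4 1 8, .new 2 8, .new 1 12, .ded 4 1 7,
     .new 1 13, .ded 1 0 12, .new 2 10, .new 1 15, .ded 4 1 11, .new 1 16, .ded 1 0 15, .new 2 15,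
     .ded 2 2 13, .new 2 14, .ded 4 2 18, .ded 6 8 16, .ded 6 12 14, .new 1 18, .ded 1 1 19,
     .ded 4 1 17, .ded 4 3 20]
    1 [54, 49, 48, 35, 37, 30, 29, 27, 20, 17, 19, 13, 12, 11, 8, 7, 6, 4, 3, 2, 1]
    (by decide +kernel) (by decide +kernel) (by decide +kernel) (by decide +kernel)
    (by decide +kernel) (by decide +kernel) (by decide +kernel) (by decide +kernel)
    (by decide +kernel) rfl

end tessGroup

/-- the tetrahedral {3,3,6} groups G_{3,3,6}(a,b) are finite of the
stated orders (12 times the number of tetrahedra in Table 1). -/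
theorem tessGroup_336_orders :
    (Finite (tessGroup 3 3 6 2 0) ∧ Nat.card (tessGroup 3 3 6 2 0) = 120) ∧
    (Finite (tessGroup 3 3 6 2 1) ∧ Nat.card (tessGroup 3 3 6 2 1) = 336) ∧
    (Finite (tessGroup 3 3 6 2 2) ∧ Nat.card (tessGroup 3 3 6 2 2) = 1440) ∧
    (Finite (tessGroup 3 3 6 3 0) ∧ Nat.card (tessGroup 3 3 6 3 0) = 648) ∧
    (Finite (tessGroup 3 3 6 3 1) ∧ Nat.card (tessGroup 3 3 6 3 1) = 2184) ∧
    (Finite (tessGroup 3 3 6 3 2) ∧ Nat.card (tessGroup 3 3 6 3 2) = 6840) ∧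
    (Finite (tessGroup 3 3 6 4 0) ∧ Nat.card (tessGroup 3 3 6 4 0) = 7680) ∧
    (Finite (tessGroup 3 3 6 4 1) ∧ Nat.card (tessGroup 3 3 6 4 1) = 8064) :=
  ⟨tessGroup.card_2_0, tessGroup.card_2_1, tessGroup.card_2_2, tessGroup.card_3_0,
    tessGroup.card_3_1, tessGroup.card_3_2, tessGroup.card_4_0, tessGroup.card_4_1⟩
end

section
/- For (a,b) equal to (2,0), (2,1), (2,2), (3,0), (3,1), (3,2), (4,1), (4,2), the presented group G_{3,4,4}(a,b) = ⟨P, Q, R | P³, Q⁴, R⁴, (PQ)², (QR)², (PQR)², (QR³)^a (RQR²)^b⟩ is finite, of order 96, 120, 384, 720, 720, 2184, 4896, 2949120 respectively (equal to 24 times the numbers 4, 5, 16, 30, 30, 91, 204, 122880 of ideal octahedra of the corresponding universal regular tessellation listed in Table 1). -/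
namespace TessCert

/-! ### Words

A word is a list of letters; the letter `2 * k` stands for the `k`-th generator and
`2 * k + 1` for its inverse. -/

section Words

variable {G : Type*} [Group G]

/-- The element of the group represented by a letter. -/
def letter (g : ℕ → G) (x : ℕ) : G := if x % 2 = 0 then g (x / 2) else (g (x / 2))⁻¹

/-- The element of the group represented by a word. -/
def ev (g : ℕ → G) (w : List ℕ) : G := (w.map (letter g)).prod

/-- The inverse letter. -/
def flip (x : ℕ) : ℕ := bif Nat.beq (x % 2) 0 then x + 1 else x - 1

/-- The inverse word. -/
def inv (w : List ℕ) : List ℕ := (w.map flip).reverse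

/-- Multiply a reduced word by a letter on the left. -/
def push (x : ℕ) : List ℕ → List ℕ
  | [] => [x]
  | y :: w => bif Nat.beq y (flip x) then w else x :: y :: w

/-- Free reduction. -/
def red (w : List ℕ) : List ℕ := w.foldr push []

/-- Cyclic rotation. -/
def rot (s : ℕ) (w : List ℕ) : List ℕ := w.drop s ++ w.take s

/-- Equality test for words. -/
def weq : List ℕ → List ℕ → Bool
  | [], [] => true
  | x :: v, y :: w => Nat.beq x y && weq v w
  | _, _ => false

/-- List access with a default value. -/
def nth {α : Type*} (d : α) : List α → ℕ → α
  | [], _ => d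
  | a :: _, 0 => a
  | _ :: l, n + 1 => nth d l n

/-- Relator number `j / 2`, inverted if `j` is odd. -/
def signed (R : List (List ℕ)) (j : ℕ) : List ℕ :=
  bif Nat.beq (j % 2) 0 then nth [] R (j / 2) else inv (nth [] R (j / 2))

theorem letter_flip (g : ℕ → G) (x : ℕ) : letter g (flip x) = (letter g x)⁻¹ := by
  unfold flip letter
  rcases Nat.mod_two_eq_zero_or_one x with h | h
  · have h1 : (x + 1) % 2 ≠ 0 := by omega
    have h2 : (x + 1) / 2 = x / 2 := by omega
    simp [h, h1, h2]
  · have h1 : (x - 1) % 2 = 0 := by omega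
    have h2 : (x - 1) / 2 = x / 2 := by omega
    have h3 : Nat.beq 1 0 = false := rfl
    simp [h, h1, h2, h3]

@[simp] theorem ev_nil (g : ℕ → G) : ev g [] = 1 := rfl

@[simp] theorem ev_cons (g : ℕ → G) (x : ℕ) (w : List ℕ) :
    ev g (x :: w) = letter g x * ev g w := by simp [ev]

@[simp] theorem ev_append (g : ℕ → G) (v w : List ℕ) : ev g (v ++ w) = ev g v * ev g w := by
  simp [ev]

@[simp] theorem ev_inv (g : ℕ → G) (w : List ℕ) : ev g (inv w) = (ev g w)⁻¹ := by
  induction w with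
  | nil => simp [inv]
  | cons x w ih =>
    have : inv (x :: w) = inv w ++ [flip x] := by simp [inv]
    rw [this, ev_append, ih]
    simp [letter_flip]

theorem ev_push (g : ℕ → G) (x : ℕ) (w : List ℕ) : ev g (push x w) = letter g x * ev g w := by
  cases w with
  | nil => simp [push]
  | cons y w =>
    unfold push
    cases h : Nat.beq y (flip x) with
    | false => simp [h]
    | true => simp [Nat.eq_of_beq_eq_true h, letter_flip]

@[simp] theorem ev_red (g : ℕ → G) (w : List ℕ) : ev g (red w) = ev g w := by
  induction w with
  | nil => rfl
  | cons x w ih =>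
    have : red (x :: w) = push x (red w) := rfl
    rw [this, ev_push, ih, ev_cons]

theorem ev_rot (g : ℕ → G) (s : ℕ) (w : List ℕ) (h : ev g w = 1) : ev g (rot s w) = 1 := by
  rw [rot, ev_append]
  apply mul_eq_one_comm.mp
  rw [← ev_append, List.take_append_drop, h]

theorem eq_of_weq : ∀ {v w : List ℕ}, weq v w = true → v = w
  | [], [], _ => rfl
  | x :: v, y :: w, h => by
    simp only [weq, Bool.and_eq_true] at h
    rw [Nat.eq_of_beq_eq_true h.1, eq_of_weq h.2]
  | [], _ :: _, h => by simp [weq] at h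
  | _ :: _, [], h => by simp [weq] at h

theorem nth_eq_or_mem {α : Type*} (d : α) : ∀ (l : List α) (n : ℕ), nth d l n = d ∨ nth d l n ∈ l
  | [], _ => Or.inl rfl
  | _ :: _, 0 => Or.inr (List.mem_cons_self ..)
  | a :: l, n + 1 => (nth_eq_or_mem d l n).imp id (List.mem_cons_of_mem a)

theorem nth_of_length_le {α : Type*} (d : α) : ∀ (l : List α) (n : ℕ), l.length ≤ n → nth d l n = d
  | [], _, _ => rfl
  | _ :: _, 0, h => by simp at h
  | _ :: l, n + 1, h => nth_of_length_le d l n (by simpa using h)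

theorem nth_mem {α : Type*} (d : α) : ∀ (l : List α) (n : ℕ), n < l.length → nth d l n ∈ l
  | [], _, h => by simp at h
  | _ :: _, 0, _ => List.mem_cons_self ..
  | a :: l, n + 1, h => List.mem_cons_of_mem a (nth_mem d l n (by simpa using h))

theorem ev_signed (g : ℕ → G) (R : List (List ℕ)) (hR : ∀ r ∈ R, ev g r = 1) (j : ℕ) :
    ev g (signed R j) = 1 := by
  have h : ev g (nth [] R (j / 2)) = 1 := by
    rcases nth_eq_or_mem [] R (j / 2) with h | h
    · rw [h, ev_nil]
    · exact hR _ h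
  unfold signed
  cases Nat.beq (j % 2) 0 <;> simp [h]

theorem ev_mem_closure (g : ℕ → G) (w : List ℕ) : ev g w ∈ Subgroup.closure (Set.range g) := by
  induction w with
  | nil => exact one_mem _
  | cons x w ih =>
    rw [ev_cons]
    refine mul_mem ?_ ih
    have h : g (x / 2) ∈ Subgroup.closure (Set.range g) := Subgroup.subset_closure ⟨_, rfl⟩
    unfold letter
    split_ifs
    · exact h
    · exact inv_mem h

end Words

/-! ### Coset tables with labels -/

/-- An edge `c --k--> dst` of the coset graph of a subgroup, with its label `lab`, a word in the
generators of the subgroup. The incoming edge with the same generator at `c` starts at `src`.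
An edge of positive rank is deduced from relator `rel` rotated by `shift`, using only edges of
lower rank. -/
structure Edge where
  dst : ℕ
  src : ℕ
  rank : ℕ
  rel : ℕ
  shift : ℕ
  lab : List ℕ

/-- A relator `word` of the subgroup: relator `rel` of the group, read off at the given coset, and
then transformed by rotating it and inserting earlier relators of the subgroup. -/
structure Derivation where
  word : List ℕ
  coset : ℕ
  rel : ℕ
  steps : List (ℕ × ℕ × ℕ)

/-- One step of a descending chain of subgroups: coset representatives, generators of the
subgroup, the labelled coset table (one row for each coset), and relators of the subgroup. -/
structure Level where
  rep : List (List ℕ)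
  sub : List (List ℕ)
  table : List (List Edge)
  child : List Derivation

namespace Level

variable (L : Level)

/-- The edge labelled by generator `k` at coset `c`. -/
def edge (c k : ℕ) : Option Edge := nth none ((nth [] L.table c).map some) k

/-- Follow one letter through the edges of rank less than `b`. -/
def step (b c x : ℕ) : Option (ℕ × List ℕ) :=
  match L.edge c (x / 2) with
  | none => none
  | some e =>
    bif Nat.beq (x % 2) 0 then
      bif Nat.ble (e.rank + 1) b then some (e.dst, e.lab) else none
    else
      match L.edge e.src (x / 2) with
      | none => none
      | some f =>
        bif Nat.beq f.dst c && Nat.ble (f.rank + 1) b then some (e.src, inv f.lab) else none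

/-- Follow a word through the edges of rank less than `b`. -/
def trace (b : ℕ) : ℕ → List ℕ → Option (ℕ × List ℕ)
  | c, [] => some (c, [])
  | c, x :: w =>
    match L.step b c x with
    | none => none
    | some (d, u) =>
      match trace b d w with
      | none => none
      | some (e, v) => some (e, u ++ v)

/-- Substitute the generators of the subgroup into a word. -/
def expand (w : List ℕ) : List ℕ := w.flatMap (signed L.sub)

/-- The edge is justified, either by free reduction or by a relator. -/
def edgeOk (R : List (List ℕ)) (c k : ℕ) (e : Edge) : Bool :=
  match e.rank with
  | 0 => weq (red (nth [] L.rep c ++ [2 * k])) (red (L.expand e.lab ++ nth [] L.rep e.dst))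
  | b + 1 =>
    match rot e.shift (signed R e.rel) with
    | [] => false
    | x :: r =>
      Nat.beq x (2 * k) &&
      match L.trace (b + 1) c (inv r) with
      | none => false
      | some (d, v) => Nat.beq d e.dst && weq (red v) e.lab

/-- The edge has an incoming counterpart, and leads to one of the cosets. -/
def edgeClosed (c k : ℕ) (e : Edge) : Bool :=
  Nat.ble (e.dst + 1) L.rep.length && Nat.ble (e.src + 1) L.rep.length &&
  match L.edge e.src k with
  | none => false
  | some f => Nat.beq f.dst c

/-- Check the edges of one row of the table, starting with generator `k`. -/
def rowOk (m : ℕ) (R : List (List ℕ)) (c : ℕ) : ℕ → List Edge → Bool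
  | k, [] => Nat.beq k m
  | k, e :: es => L.edgeOk R c k e && L.edgeClosed c k e && rowOk m R c (k + 1) es

/-- Check the rows of the table, starting with coset `c`. -/
def rowsOk (m : ℕ) (R : List (List ℕ)) : ℕ → List (List Edge) → Bool
  | c, [] => Nat.beq c L.rep.length
  | c, es :: rows => L.rowOk m R c 0 es && rowsOk m R (c + 1) rows

/-- A strict upper bound for the ranks of all edges. -/
def maxRank : ℕ := (L.table.map fun es => (es.map fun e => e.rank + 1).sum).sum

/-- Transform a relator by rotations and insertions of known relators. -/
def transform (K : List (List ℕ)) : List (ℕ × ℕ × ℕ) → List ℕ → List ℕ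
  | [], w => w
  | (p, j, s) :: st, w => transform K st (red (rot s (signed K j) ++ rot p w))

/-- Check the derivations of the relators of the subgroup; `K` are those already known. -/
def childOk (R : List (List ℕ)) (b : ℕ) (K : List (List ℕ)) : List Derivation → Bool
  | [] => true
  | D :: Ds =>
    (match L.trace b D.coset (signed R D.rel) with
      | none => false
      | some (d, v) => Nat.beq d D.coset && weq (transform K D.steps (red v)) D.word) &&
    childOk R b (K ++ [D.word]) Ds

/-- The complete check of one step of the chain. -/
def check (m : ℕ) (R : List (List ℕ)) : Bool :=
  weq (nth [0] L.rep 0) [] && L.rowsOk m R 0 L.table && L.childOk R L.maxRank [] L.child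

end Level

/-- Check a descending chain of subgroups ending with the trivial group. -/
def checkTower : ℕ → List (List ℕ) → List Level → Bool
  | m, _, [] => Nat.beq m 0
  | m, R, L :: Ls => L.check m R && checkTower L.sub.length (L.child.map Derivation.word) Ls

/-- The product of the indices of a chain of subgroups. -/
def towerIndex (Ls : List Level) : ℕ := (Ls.map fun L => L.rep.length).prod

namespace Level

variable {G : Type*} [Group G] (L : Level) (g : ℕ → G)

/-- The coset representative. -/
def cosetRep (c : ℕ) : G := ev g (nth [] L.rep c)

/-- The generators of the subgroup. -/
def subGen (j : ℕ) : G := ev g (nth [] L.sub j)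

/-- The edges of rank less than `b` are correctly labelled. -/
def Sound (b : ℕ) : Prop :=
  ∀ c k e, L.edge c k = some e → e.rank < b →
    L.cosetRep g c * g k = ev (L.subGen g) e.lab * L.cosetRep g e.dst

theorem ev_expand (w : List ℕ) : ev g (L.expand w) = ev (L.subGen g) w := by
  induction w with
  | nil => rfl
  | cons x w ih =>
    have h : L.expand (x :: w) = signed L.sub x ++ L.expand w := by simp [expand]
    rw [h, ev_append, ih, ev_cons]
    congr 1
    unfold signed letter subGen
    rcases Nat.mod_two_eq_zero_or_one x with h | h
    · simp [h]
    · have h3 : Nat.beq 1 0 = false := rfl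
      simp [h, h3]

variable {L g}

theorem Sound.step {b c x d : ℕ} {u : List ℕ} (hb : L.Sound g b)
    (h : L.step b c x = some (d, u)) :
    L.cosetRep g c * letter g x = ev (L.subGen g) u * L.cosetRep g d := by
  unfold Level.step at h
  unfold letter
  cases he : L.edge c (x / 2) with
  | none => simp [he] at h
  | some e =>
    rw [he] at h
    rcases Nat.mod_two_eq_zero_or_one x with hx | hx
    · have h3 : Nat.beq 0 0 = true := rfl
      simp only [hx, h3, cond_true] at h
      cases hr : Nat.ble (e.rank + 1) b with
      | false => simp [hr] at h
      | true =>
        simp only [hr, cond_true, Option.some.injEq, Prod.mk.injEq] at h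
        rw [if_pos hx, hb c _ e he (Nat.le_of_ble_eq_true hr), h.1, h.2]
    · have h3 : Nat.beq 1 0 = false := rfl
      simp only [hx, h3, cond_false] at h
      cases hf : L.edge e.src (x / 2) with
      | none => simp [hf] at h
      | some f =>
        simp only [hf] at h
        cases hr : (Nat.beq f.dst c && Nat.ble (f.rank + 1) b) with
        | false => simp [hr] at h
        | true =>
          simp only [hr, cond_true, Option.some.injEq, Prod.mk.injEq] at h
          rw [Bool.and_eq_true] at hr
          have h4 := hb _ _ f hf (Nat.le_of_ble_eq_true hr.2)
          rw [Nat.eq_of_beq_eq_true hr.1] at h4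
          rw [if_neg (by omega), ← h.1, ← h.2, ev_inv, mul_inv_eq_iff_eq_mul, mul_assoc, h4,
            inv_mul_cancel_left]

theorem Sound.trace {b : ℕ} (hb : L.Sound g b) : ∀ {w : List ℕ} {c d : ℕ} {u : List ℕ},
    L.trace b c w = some (d, u) →
    L.cosetRep g c * ev g w = ev (L.subGen g) u * L.cosetRep g d
  | [], c, d, u, h => by
    simp only [Level.trace, Option.some.injEq, Prod.mk.injEq] at h
    simp [← h.1, ← h.2]
  | x :: w, c, d, u, h => by
    unfold Level.trace at h
    cases h1 : L.step b c x with
    | none => simp [h1] at h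
    | some p =>
      obtain ⟨d1, u1⟩ := p
      simp only [h1] at h
      cases h2 : L.trace b d1 w with
      | none => simp [h2] at h
      | some q =>
        obtain ⟨d2, u2⟩ := q
        simp only [h2, Option.some.injEq, Prod.mk.injEq] at h
        rw [ev_cons, ← mul_assoc, hb.step h1, mul_assoc, hb.trace h2, ← h.1, ← h.2, ev_append,
          mul_assoc]

variable {m : ℕ} {R : List (List ℕ)}

theorem rowOk_get {c : ℕ} : ∀ {k : ℕ} {es : List Edge}, L.rowOk m R c k es = true →
    es.length + k = m ∧ ∀ i e, nth none (es.map some) i = some e →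
      L.edgeOk R c (k + i) e = true ∧ L.edgeClosed c (k + i) e = true
  | k, [], h => ⟨by simpa using Nat.eq_of_beq_eq_true h, fun i e he => by simp [nth] at he⟩
  | k, e :: es, h => by
    simp only [rowOk, Bool.and_eq_true] at h
    obtain ⟨h1, h2⟩ := rowOk_get h.2
    refine ⟨by simp; omega, fun i f hf => ?_⟩
    cases i with
    | zero =>
      simp only [List.map_cons, nth, Option.some.injEq] at hf
      subst hf
      exact h.1
    | succ i =>
      have := h2 i f hf
      rwa [show k + (i + 1) = k + 1 + i by omega]

theorem rowsOk_get : ∀ {c : ℕ} {rows : List (List Edge)}, L.rowsOk m R c rows = true →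
    rows.length + c = L.rep.length ∧ ∀ i, i < rows.length →
      L.rowOk m R (c + i) 0 (nth [] rows i) = true
  | c, [], h => ⟨by simpa using Nat.eq_of_beq_eq_true h, fun i hi => by simp at hi⟩
  | c, es :: rows, h => by
    simp only [rowsOk, Bool.and_eq_true] at h
    obtain ⟨h1, h2⟩ := rowsOk_get h.2
    refine ⟨by simp; omega, fun i hi => ?_⟩
    cases i with
    | zero => exact h.1
    | succ i =>
      have := h2 i (by simpa using hi)
      rwa [show c + (i + 1) = c + 1 + i by omega]

theorem edge_spec (h : L.rowsOk m R 0 L.table = true) {c k : ℕ} {e : Edge}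
    (he : L.edge c k = some e) : L.edgeOk R c k e = true ∧ L.edgeClosed c k e = true := by
  obtain ⟨-, h2⟩ := rowsOk_get h
  by_cases hc : c < L.table.length
  · have := (rowOk_get (h2 c hc)).2 k e he
    simpa using this
  · rw [edge, nth_of_length_le _ _ _ (not_lt.mp hc)] at he
    simp [nth] at he

theorem edge_ne_none (h : L.rowsOk m R 0 L.table = true) {c k : ℕ} (hc : c < L.rep.length)
    (hk : k < m) : ∃ e, L.edge c k = some e := by
  obtain ⟨h1, h2⟩ := rowsOk_get h
  have h3 := (rowOk_get (h2 c (by omega))).1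
  have := nth_mem none ((nth [] L.table c).map some) k (by simp; omega)
  obtain ⟨e, -, he⟩ := List.mem_map.mp this
  exact ⟨e, he.symm⟩

theorem rank_lt_maxRank {c k : ℕ} {e : Edge} (he : L.edge c k = some e) :
    e.rank < L.maxRank := by
  have h1 : nth [] L.table c ∈ L.table := by
    rcases nth_eq_or_mem [] L.table c with h | h
    · rw [edge, h] at he
      simp [nth] at he
    · exact h
  have h2 : e ∈ nth [] L.table c := by
    rcases nth_eq_or_mem none ((nth [] L.table c).map some) k with h | h
    · rw [edge, h] at he
      simp at he
    · rw [edge] at he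
      simpa [he] using h
  calc e.rank + 1 ≤ ((nth [] L.table c).map fun e => e.rank + 1).sum :=
        List.single_le_sum (by simp) _ (List.mem_map.mpr ⟨e, h2, rfl⟩)
    _ ≤ L.maxRank := List.single_le_sum (by simp) _ (List.mem_map.mpr ⟨_, h1, rfl⟩)

theorem sound (hR : ∀ r ∈ R, ev g r = 1) (h : L.rowsOk m R 0 L.table = true) (b : ℕ) :
    L.Sound g b := by
  induction b with
  | zero => intro c k e _ h; simp at h
  | succ b ih =>
    intro c k e he hr
    have h1 := (edge_spec h he).1
    have hk : letter g (2 * k) = g k := by simp [letter]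
    unfold edgeOk at h1
    split at h1
    · have h2 := congrArg (ev g) (eq_of_weq h1)
      simpa [ev_expand, hk, cosetRep] using h2
    · rename_i b' hb'
      split at h1
      · simp at h1
      · rename_i x r hxr
        rw [Bool.and_eq_true] at h1
        have hs : L.Sound g (b' + 1) := fun c k e he hr' => ih c k e he (by omega)
        split at h1
        · simp at h1
        · rename_i d v htr
          have h3 := hs.trace htr
          obtain ⟨hx, h1⟩ := h1
          rw [Bool.and_eq_true] at h1
          have h4 := ev_rot g e.shift _ (ev_signed g R hR e.rel)
          rw [hxr, ev_cons, Nat.eq_of_beq_eq_true hx, hk] at h4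
          rw [ev_inv, ← eq_inv_of_mul_eq_one_left h4, Nat.eq_of_beq_eq_true h1.1] at h3
          rw [h3, ← eq_of_weq h1.2, ev_red]

theorem ev_transform {h : ℕ → G} {K : List (List ℕ)} (hK : ∀ r ∈ K, ev h r = 1) :
    ∀ {st : List (ℕ × ℕ × ℕ)} {w : List ℕ}, ev h w = 1 → ev h (transform K st w) = 1
  | [], _, hw => hw
  | (p, j, s) :: st, w, hw => by
    refine ev_transform hK (st := st) ?_
    rw [ev_red, ev_append, ev_rot h s _ (ev_signed h K hK j), ev_rot h p _ hw, mul_one]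

theorem childOk_sound (hR : ∀ r ∈ R, ev g r = 1) {b : ℕ} (hb : L.Sound g b) :
    ∀ {Ds : List Derivation} {K : List (List ℕ)}, L.childOk R b K Ds = true →
      (∀ r ∈ K, ev (L.subGen g) r = 1) →
      ∀ r ∈ Ds.map Derivation.word, ev (L.subGen g) r = 1
  | [], _, _, _ => by simp
  | D :: Ds, K, h, hK => by
    unfold childOk at h
    rw [Bool.and_eq_true] at h
    have hD : ev (L.subGen g) D.word = 1 := by
      obtain ⟨h, -⟩ := h
      split at h
      · simp at h
      · rename_i d v htr
        rw [Bool.and_eq_true] at h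
        have h1 := hb.trace htr
        rw [ev_signed g R hR, mul_one, Nat.eq_of_beq_eq_true h.1, eq_comm, mul_eq_right] at h1
        rw [← eq_of_weq h.2]
        exact ev_transform hK (by rw [ev_red, h1])
    have h2 := childOk_sound hR hb h.2 (by
      intro r hr
      rcases List.mem_append.mp hr with hr | hr
      · exact hK r hr
      · rw [List.mem_singleton.mp hr, hD])
    intro r hr
    rcases List.mem_cons.mp hr with hr | hr
    · rw [hr, hD]
    · exact h2 r hr

theorem exists_step (hR : ∀ r ∈ R, ev g r = 1) (h : L.rowsOk m R 0 L.table = true) {c k : ℕ}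
    (hc : c < L.rep.length) (hk : k < m) :
    (∃ d < L.rep.length, ∃ u, L.cosetRep g c * g k = ev (L.subGen g) u * L.cosetRep g d) ∧
    (∃ d < L.rep.length, ∃ u, L.cosetRep g c * (g k)⁻¹ = ev (L.subGen g) u * L.cosetRep g d) := by
  obtain ⟨e, he⟩ := edge_ne_none h hc hk
  have hs := sound hR h L.maxRank
  have h1 := (edge_spec h he).2
  unfold edgeClosed at h1
  rw [Bool.and_eq_true, Bool.and_eq_true] at h1
  obtain ⟨⟨hd, hsrc⟩, h1⟩ := h1
  refine ⟨⟨e.dst, Nat.le_of_ble_eq_true hd, e.lab, hs c k e he (rank_lt_maxRank he)⟩,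
    ⟨e.src, Nat.le_of_ble_eq_true hsrc, ?_⟩⟩
  split at h1
  · simp at h1
  · rename_i f hf
    refine ⟨inv f.lab, ?_⟩
    have h2 := hs _ _ f hf (rank_lt_maxRank hf)
    rw [Nat.eq_of_beq_eq_true h1] at h2
    rw [ev_inv, mul_inv_eq_iff_eq_mul, mul_assoc, h2, inv_mul_cancel_left]

theorem exists_coset (hR : ∀ r ∈ R, ev g r = 1) (hg : ∀ k, m ≤ k → g k = 1)
    (h : L.check m R = true) {x : G} (hx : x ∈ Subgroup.closure (Set.range g)) :
    ∃ c < L.rep.length, ∃ u, x = ev (L.subGen g) u * L.cosetRep g c := by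
  unfold check at h
  rw [Bool.and_eq_true, Bool.and_eq_true] at h
  obtain ⟨⟨h0, h⟩, -⟩ := h
  have h0 := eq_of_weq h0
  induction hx using Subgroup.closure_induction_right with
  | one =>
    cases hr : L.rep with
    | nil => simp [hr, nth] at h0
    | cons w ws =>
      refine ⟨0, by simp, [], ?_⟩
      have : w = [] := by simpa [hr, nth] using h0
      simp [cosetRep, hr, nth, this]
  | mul_right x hx y hy ih =>
    obtain ⟨k, rfl⟩ := hy
    obtain ⟨c, hc, u, rfl⟩ := ih
    by_cases hk : k < m
    · obtain ⟨d, hd, v, hv⟩ := (exists_step hR h hc hk).1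
      exact ⟨d, hd, u ++ v, by rw [mul_assoc, hv, ev_append, mul_assoc]⟩
    · exact ⟨c, hc, u, by rw [hg k (by omega), mul_one]⟩
  | mul_inv_cancel x hx y hy ih =>
    obtain ⟨k, rfl⟩ := hy
    obtain ⟨c, hc, u, rfl⟩ := ih
    by_cases hk : k < m
    · obtain ⟨d, hd, v, hv⟩ := (exists_step hR h hc hk).2
      exact ⟨d, hd, u ++ v, by rw [mul_assoc, hv, ev_append, mul_assoc]⟩
    · exact ⟨c, hc, u, by rw [hg k (by omega), inv_one, mul_one]⟩

end Level

theorem exists_finset_of_checkTower {G : Type*} [Group G] :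
    ∀ {Ls : List Level} {m : ℕ} {R : List (List ℕ)} {g : ℕ → G},
      checkTower m R Ls = true → (∀ r ∈ R, ev g r = 1) → (∀ k, m ≤ k → g k = 1) →
      ∃ s : Finset G, s.card ≤ towerIndex Ls ∧ ∀ x ∈ Subgroup.closure (Set.range g), x ∈ s
  | [], m, R, g, h, _, hg => by
    refine ⟨{1}, by simp [towerIndex], fun x hx => ?_⟩
    have hm : m = 0 := Nat.eq_of_beq_eq_true h
    have : Set.range g ⊆ {1} := by
      rintro _ ⟨k, rfl⟩
      exact hg k (by omega)
    have := (Subgroup.closure_mono this) hx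
    rw [Subgroup.closure_singleton_one, Subgroup.mem_bot] at this
    simpa using this
  | L :: Ls, m, R, g, h, hR, hg => by
    classical
    unfold checkTower at h
    rw [Bool.and_eq_true] at h
    have h1 := h.1
    unfold Level.check at h1
    rw [Bool.and_eq_true, Bool.and_eq_true] at h1
    obtain ⟨s, hs, hmem⟩ := exists_finset_of_checkTower (g := L.subGen g) h.2
      (Level.childOk_sound hR (Level.sound hR h1.1.2 _) h1.2 (by simp))
      (fun k hk => by rw [Level.subGen, nth_of_length_le _ _ _ hk, ev_nil])
    refine ⟨Finset.image₂ (fun c u => u * L.cosetRep g c) (Finset.range L.rep.length) s, ?_, ?_⟩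
    · refine (Finset.card_image₂_le _ _ _).trans ?_
      rw [Finset.card_range, towerIndex, List.map_cons, List.prod_cons]
      exact Nat.mul_le_mul_left _ hs
    · intro x hx
      obtain ⟨c, hc, u, rfl⟩ := Level.exists_coset hR hg h.1 hx
      exact Finset.mem_image₂.mpr
        ⟨c, Finset.mem_range.mpr hc, _, hmem _ (ev_mem_closure _ u), rfl⟩

/-! ### Permutation representations -/

/-- The `i`-th digit of `N` in base `256`. -/
def digit (N i : ℕ) : ℕ := N / 256 ^ i % 256

/-- A permutation of the numbers less than `n` together with its inverse, both written as a list of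
digits in base `256`. -/
def permOk (n : ℕ) (p : ℕ × ℕ) : Bool :=
  (List.range n).all fun i =>
    Nat.ble (digit p.1 i + 1) n && Nat.ble (digit p.2 i + 1) n &&
    Nat.beq (digit p.2 (digit p.1 i)) i && Nat.beq (digit p.1 (digit p.2 i)) i

/-- The action of a letter on the numbers less than `n`. -/
def act (T : List (ℕ × ℕ)) (x i : ℕ) : ℕ :=
  bif Nat.beq (x % 2) 0 then digit (nth (0, 0) T (x / 2)).1 i
  else digit (nth (0, 0) T (x / 2)).2 i

/-- The action of a word on the numbers less than `n`. -/
def actWord (T : List (ℕ × ℕ)) (w : List ℕ) (i : ℕ) : ℕ := w.foldr (act T) i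

/-- The letters of the word are among the first `m` generators and their inverses. -/
def wordOk (m : ℕ) (w : List ℕ) : Bool := w.all fun x => Nat.ble (x / 2 + 1) m

/-- The word acts trivially. -/
def trivialOk (n : ℕ) (T : List (ℕ × ℕ)) (w : List ℕ) : Bool :=
  wordOk T.length w && (List.range n).all fun i => Nat.beq (actWord T w i) i

/-- One step of a chain of point stabilizers: a base point, words fixing the previous base points,
and a list of entries `(y, j, x)` saying that word number `j` sends the point `x`, which is already
known to lie in the orbit of the base point, to a new point `y`. -/
structure Orbit where
  base : ℕ
  words : List (List ℕ)
  path : List (ℕ × ℕ × ℕ)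

/-- Check the entries of the path; `V` are the points already known to lie in the orbit. -/
def pathOk (T : List (ℕ × ℕ)) (W : List (List ℕ)) : List ℕ → List (ℕ × ℕ × ℕ) → Bool
  | _, [] => true
  | V, (y, j, x) :: p =>
    (V.any fun v => Nat.beq v x) && (V.all fun v => !Nat.beq v y) &&
    Nat.beq (actWord T (nth [] W j) x) y && pathOk T W (y :: V) p

/-- Check a chain of point stabilizers; `F` are the previous base points. -/
def chainOk (n : ℕ) (T : List (ℕ × ℕ)) : List ℕ → List Orbit → Bool
  | _, [] => true
  | F, O :: Os =>
    Nat.ble (O.base + 1) n &&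
    (O.words.all fun w => wordOk T.length w && F.all fun i => Nat.beq (actWord T w i) i) &&
    pathOk T O.words [O.base] O.path && chainOk n T (O.base :: F) Os

/-- The product of the lengths of the orbits. -/
def chainIndex (Os : List Orbit) : ℕ := (Os.map fun O => O.path.length + 1).prod

section Perm

variable {n : ℕ}

/-- The permutation given by lists of digits. -/
def toPerm (n : ℕ) (p : ℕ × ℕ) (h : permOk n p = true) : Equiv.Perm (Fin n) :=
  have h' : ∀ i < n, ((digit p.1 i + 1 ≤ n ∧ digit p.2 i + 1 ≤ n) ∧
      digit p.2 (digit p.1 i) = i) ∧ digit p.1 (digit p.2 i) = i := fun i hi => by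
    have := List.all_eq_true.mp h i (List.mem_range.mpr hi)
    simp only [Bool.and_eq_true] at this
    exact ⟨⟨⟨Nat.le_of_ble_eq_true this.1.1.1, Nat.le_of_ble_eq_true this.1.1.2⟩,
      Nat.eq_of_beq_eq_true this.1.2⟩, Nat.eq_of_beq_eq_true this.2⟩
  { toFun := fun i => ⟨digit p.1 i, (h' i i.2).1.1.1⟩
    invFun := fun i => ⟨digit p.2 i, (h' i i.2).1.1.2⟩
    left_inv := fun i => Fin.ext (h' i i.2).1.2
    right_inv := fun i => Fin.ext (h' i i.2).2 }

/-- The permutations given by a list of lists of digits. -/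
def perms (n : ℕ) (T : List (ℕ × ℕ)) (k : ℕ) : Equiv.Perm (Fin n) :=
  if h : k < T.length ∧ permOk n (nth (0, 0) T k) = true then toPerm n _ h.2 else 1

theorem letter_perms {T : List (ℕ × ℕ)} (hT : T.all (permOk n) = true) {x : ℕ}
    (hx : x / 2 < T.length) (i : Fin n) : (letter (perms n T) x i : ℕ) = act T x i := by
  have h : x / 2 < T.length ∧ permOk n (nth (0, 0) T (x / 2)) = true :=
    ⟨hx, List.all_eq_true.mp hT _ (nth_mem _ _ _ hx)⟩
  unfold letter act perms
  rw [dif_pos h]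
  rcases Nat.mod_two_eq_zero_or_one x with hx | hx
  · rw [if_pos hx, hx]
    rfl
  · rw [if_neg (by omega), hx]
    rfl

theorem ev_perms {T : List (ℕ × ℕ)} (hT : T.all (permOk n) = true) {w : List ℕ}
    (hw : wordOk T.length w = true) (i : Fin n) :
    (ev (perms n T) w i : ℕ) = actWord T w i := by
  induction w with
  | nil => rfl
  | cons x w ih =>
    simp only [wordOk, List.all_cons, Bool.and_eq_true] at hw
    rw [ev_cons, Equiv.Perm.mul_apply, letter_perms hT (Nat.le_of_ble_eq_true hw.1), ih hw.2]
    rfl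

theorem ev_perms_eq_one {T : List (ℕ × ℕ)} (hT : T.all (permOk n) = true) {w : List ℕ}
    (hw : trivialOk n T w = true) : ev (perms n T) w = 1 := by
  unfold trivialOk at hw
  rw [Bool.and_eq_true] at hw
  refine Equiv.ext fun i => Fin.ext ?_
  rw [ev_perms hT hw.1]
  exact Nat.eq_of_beq_eq_true (List.all_eq_true.mp hw.2 i (List.mem_range.mpr i.2))

variable {G : Type*} [Group G]

/-- The elements whose images fix all the points of a list. -/
def fixing (φ : G →* Equiv.Perm (Fin n)) (F : List ℕ) : Subgroup G where
  carrier := {x | ∀ i : Fin n, (i : ℕ) ∈ F → φ x i = i}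
  one_mem' := fun i _ => by simp
  mul_mem' := fun {x y} hx hy i hi => by
    rw [map_mul, Equiv.Perm.mul_apply, hy i hi, hx i hi]
  inv_mem' := fun {x} hx i hi => by
    rw [map_inv, Equiv.Perm.inv_eq_iff_eq, hx i hi]

theorem exists_orbit {T : List (ℕ × ℕ)} (hT : T.all (permOk n) = true)
    {φ : G →* Equiv.Perm (Fin n)} {g : ℕ → G} (hφ : ∀ w, φ (ev g w) = ev (perms n T) w)
    {W : List (List ℕ)} (hW : W.all (wordOk T.length) = true) {H : Subgroup G}
    (hH : ∀ w ∈ W, ev g w ∈ H) (b : Fin n) :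
    ∀ {p : List (ℕ × ℕ × ℕ)} {V : List ℕ}, pathOk T W V p = true → V.Nodup →
      (∀ v ∈ V, ∃ x ∈ H, (φ x b : ℕ) = v) →
      ∃ U : List ℕ, U.length = p.length + V.length ∧ U.Nodup ∧
        ∀ v ∈ U, ∃ x ∈ H, (φ x b : ℕ) = v
  | [], V, _, hV, h => ⟨V, by simp, hV, h⟩
  | (y, j, x) :: p, V, hp, hV, h => by
    simp only [pathOk, Bool.and_eq_true, List.any_eq_true, List.all_eq_true,
      Bool.not_eq_eq_eq_not, Bool.not_true] at hp
    obtain ⟨⟨⟨⟨v, hv, hvx⟩, hy⟩, hact⟩, hp⟩ := hp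
    obtain ⟨U, hU, hU'⟩ := exists_orbit hT hφ hW hH b hp
      (List.nodup_cons.mpr ⟨fun hmem => by simpa using hy y hmem, hV⟩) (by
        intro u hu
        rcases List.mem_cons.mp hu with rfl | hu
        · obtain ⟨z, hz, hzb⟩ := h v hv
          rw [Nat.eq_of_beq_eq_true hvx] at hzb
          have hWj : wordOk T.length (nth [] W j) = true ∧ ev g (nth [] W j) ∈ H := by
            rcases nth_eq_or_mem [] W j with hj | hj
            · rw [hj]
              exact ⟨rfl, one_mem H⟩
            · exact ⟨List.all_eq_true.mp hW _ hj, hH _ hj⟩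
          refine ⟨ev g (nth [] W j) * z, mul_mem hWj.2 hz, ?_⟩
          rw [map_mul, Equiv.Perm.mul_apply, hφ, ev_perms hT hWj.1, hzb]
          exact Nat.eq_of_beq_eq_true hact
        · exact h u hu)
    exact ⟨U, by rw [hU]; simp; omega, hU'⟩

theorem mul_card_fixing_le [Finite G] {φ : G →* Equiv.Perm (Fin n)} {F : List ℕ} (b : Fin n)
    {U : List ℕ} (hU : U.Nodup) (h : ∀ v ∈ U, ∃ x ∈ fixing φ F, (φ x b : ℕ) = v) :
    U.length * Nat.card (fixing φ (b :: F)) ≤ Nat.card (fixing φ F) := by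
  choose x hx hxb using h
  have hle : ∀ {z}, z ∈ fixing φ (b :: F) → z ∈ fixing φ F :=
    fun hz i hi => hz i (List.mem_cons_of_mem _ hi)
  have hfix : ∀ {z}, z ∈ fixing φ (b :: F) → φ z b = b := fun hz => hz b (List.mem_cons_self ..)
  let f : Fin U.length × fixing φ (b :: F) → fixing φ F := fun q =>
    ⟨x (U.get q.1) (List.get_mem ..) * q.2, mul_mem (hx _ _) (hle q.2.2)⟩
  have hf : Function.Injective f := by
    rintro ⟨i, z, hz⟩ ⟨j, z', hz'⟩ hij
    have h1 : x (U.get i) (List.get_mem ..) * z = x (U.get j) (List.get_mem ..) * z' :=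
      congrArg Subtype.val hij
    have h2 := congrArg (fun y => (φ y b : ℕ)) h1
    simp only [map_mul, Equiv.Perm.mul_apply, hfix hz, hfix hz', hxb] at h2
    obtain rfl : i = j := List.nodup_iff_injective_get.mp hU h2
    rw [mul_right_inj] at h1
    subst h1
    rfl
  have := Nat.card_le_card_of_injective f hf
  rwa [Nat.card_prod, Nat.card_fin] at this

theorem chainIndex_le_card_fixing [Finite G] {T : List (ℕ × ℕ)} (hT : T.all (permOk n) = true)
    {φ : G →* Equiv.Perm (Fin n)} {g : ℕ → G} (hφ : ∀ w, φ (ev g w) = ev (perms n T) w) :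
    ∀ {Os : List Orbit} {F : List ℕ}, chainOk n T F Os = true →
      chainIndex Os ≤ Nat.card (fixing φ F)
  | [], _, _ => Nat.card_pos
  | O :: Os, F, h => by
    simp only [chainOk, Bool.and_eq_true, List.all_eq_true] at h
    obtain ⟨⟨⟨hb, hw⟩, hp⟩, h⟩ := h
    have ih := chainIndex_le_card_fixing hT hφ h
    obtain ⟨U, hU, hU', hU''⟩ := exists_orbit hT hφ
      (List.all_eq_true.mpr fun w hmem => (hw w hmem).1) (H := fixing φ F)
      (fun w hmem i hi => by
        rw [hφ]
        refine Fin.ext ?_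
        rw [ev_perms hT (hw w hmem).1]
        exact Nat.eq_of_beq_eq_true ((hw w hmem).2 i hi))
      ⟨O.base, Nat.le_of_ble_eq_true hb⟩ hp (by simp)
      (by
        intro v hv
        rw [List.mem_singleton] at hv
        exact ⟨1, one_mem _, by simp [hv]⟩)
    have h1 := mul_card_fixing_le _ hU' hU''
    rw [hU, List.length_singleton] at h1
    calc chainIndex (O :: Os) = (O.path.length + 1) * chainIndex Os := by simp [chainIndex]
      _ ≤ _ := (Nat.mul_le_mul_left _ ih).trans h1

end Perm

/-! ### The groups of type `{3,4,4}` -/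

/-- The relators of the groups of type `{3,4,4}`. -/
def relators (a b : ℕ) : List (List ℕ) :=
  [[0, 0, 0], [2, 2, 2, 2], [4, 4, 4, 4], [0, 2, 0, 2], [2, 4, 2, 4], [0, 2, 4, 0, 2, 4],
    (List.replicate a [2, 4, 4, 4]).flatten ++ (List.replicate b [4, 2, 4, 4]).flatten]

theorem ev_flatten_replicate {G : Type*} [Group G] (g : ℕ → G) (a : ℕ) (w : List ℕ) :
    ev g (List.replicate a w).flatten = ev g w ^ a := by
  induction a with
  | zero => simp
  | succ a ih => rw [List.replicate_succ, List.flatten_cons, ev_append, ih, pow_succ']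

theorem forall_relators_iff {G : Type*} [Group G] (g : ℕ → G) (a b : ℕ) :
    (∀ r ∈ relators a b, ev g r = 1) ↔
      ∀ r ∈ tessRels 3 4 4 a b, FreeGroup.lift (fun i : Fin 3 => g i) r = 1 := by
  have h0 : letter g 0 = g 0 := rfl
  have h2 : letter g 2 = g 1 := rfl
  have h4 : letter g 4 = g 2 := rfl
  simp only [relators, tessRels, List.forall_mem_cons, Set.mem_insert_iff, Set.mem_singleton_iff,
    forall_eq_or_imp, forall_eq, map_mul, map_pow, FreeGroup.lift_apply_of, ev_append,
    ev_flatten_replicate, ev_cons, ev_nil, h0, h2, h4]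
  simp [pow_succ, mul_assoc]

/-- The generators of the group, followed by trivial elements. -/
def tessGen (a b k : ℕ) : tessGroup 3 4 4 a b :=
  if h : k < 3 then (PresentedGroup.of ⟨k, h⟩ : PresentedGroup (tessRels 3 4 4 a b)) else 1

theorem tessGen_val (a b : ℕ) (i : Fin 3) :
    tessGen a b i = (PresentedGroup.of i : PresentedGroup (tessRels 3 4 4 a b)) :=
  dif_pos i.2

theorem tessGen_of_le (a b : ℕ) {k : ℕ} (h : 3 ≤ k) : tessGen a b k = 1 :=
  dif_neg (not_lt.mpr h)

theorem lift_tessGen (a b : ℕ) (r : FreeGroup (Fin 3)) :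
    FreeGroup.lift (fun i : Fin 3 => tessGen a b i) r =
      PresentedGroup.mk (tessRels 3 4 4 a b) r :=
  DFunLike.congr_fun (f := FreeGroup.lift fun i : Fin 3 => tessGen a b i)
    (g := PresentedGroup.mk (tessRels 3 4 4 a b))
    (FreeGroup.ext_hom _ _ fun i => FreeGroup.lift_apply_of.trans (tessGen_val a b i)) r

theorem ev_tessGen_relators (a b : ℕ) : ∀ r ∈ relators a b, ev (tessGen a b) r = 1 :=
  (forall_relators_iff _ a b).mpr fun r hr => by
    rw [lift_tessGen]
    exact PresentedGroup.one_of_mem hr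

theorem closure_tessGen (a b : ℕ) : Subgroup.closure (Set.range (tessGen a b)) = ⊤ := by
  rw [eq_top_iff]
  have := PresentedGroup.closure_range_of (tessRels 3 4 4 a b)
  change (⊤ : Subgroup (PresentedGroup (tessRels 3 4 4 a b))) ≤ _
  rw [← this]
  refine Subgroup.closure_mono ?_
  rintro _ ⟨i, rfl⟩
  exact ⟨i, tessGen_val a b i⟩

theorem finite_and_card {a b N n : ℕ} {Ls : List Level} {T : List (ℕ × ℕ)} {Os : List Orbit}
    (hLs : checkTower 3 (relators a b) Ls = true) (hT : T.all (permOk n) = true)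
    (hT3 : T.length = 3) (hrel : (relators a b).all (trivialOk n T) = true)
    (hOs : chainOk n T [] Os = true) (hup : towerIndex Ls = N) (hlow : chainIndex Os = N) :
    Finite (tessGroup 3 4 4 a b) ∧ Nat.card (tessGroup 3 4 4 a b) = N := by
  obtain ⟨s, hs, hmem⟩ := exists_finset_of_checkTower hLs (ev_tessGen_relators a b)
    (fun k hk => tessGen_of_le a b hk)
  rw [closure_tessGen] at hmem
  have hfin : Finite (tessGroup 3 4 4 a b) :=
    Finite.of_surjective (fun x : s => (x : tessGroup 3 4 4 a b))
      fun x => ⟨⟨x, hmem x trivial⟩, rfl⟩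
  refine ⟨hfin, le_antisymm ?_ ?_⟩
  · rw [← hup]
    refine le_trans ?_ hs
    rw [← Nat.card_eq_finsetCard s]
    exact Nat.card_le_card_of_injective (fun x => (⟨x, hmem x trivial⟩ : s))
      fun x y h => congrArg Subtype.val h
  · have hφ := (forall_relators_iff (perms n T) a b).mp fun r hr =>
      ev_perms_eq_one hT (List.all_eq_true.mp hrel r hr)
    let φ : tessGroup 3 4 4 a b →* Equiv.Perm (Fin n) := PresentedGroup.toGroup hφ
    have h1 : ∀ k, φ (tessGen a b k) = perms n T k := fun k => by
      rcases lt_or_ge k 3 with hk | hk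
      · exact (congrArg φ (tessGen_val a b ⟨k, hk⟩)).trans (PresentedGroup.toGroup.of hφ)
      · rw [tessGen_of_le a b hk, map_one, perms, dif_neg (by omega)]
    rw [← hlow]
    refine (chainIndex_le_card_fixing (φ := φ) (g := tessGen a b) hT (fun w => ?_) hOs).trans
      (Nat.card_le_card_of_injective _ Subtype.val_injective)
    induction w with
    | nil => simp
    | cons x w ih =>
      rw [ev_cons, map_mul, ih, ev_cons]
      congr 1
      unfold letter
      split_ifs
      · exact h1 _
      · rw [map_inv, h1]

/-- A chain of subgroups of the group with cusp modulus `(2, 0)`. -/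
def tower20 : List Level := [
  ⟨[[], [3], [2], [2, 2], [4], [5, 5], [5], [2, 4], [2, 4, 4], [2, 5], [3, 4], [3, 5, 5], [3, 5],
     [4, 1], [5, 1, 5], [5, 1]],
    [[3, 0, 3], [4, 0, 5, 3]],
    [[⟨1, 2, 33, 10, 3, [3]⟩, ⟨2, 1, 0, 0, 0, []⟩, ⟨4, 6, 0, 0, 0, []⟩], [⟨2, 0, 0, 0, 0, [0]⟩, ⟨0,
     3, 0, 0, 0, []⟩, ⟨10, 12, 0, 0, 0, []⟩], [⟨0, 1, 38, 0, 1, [1, 2]⟩, ⟨3, 0, 0, 0, 0, []⟩,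
     ⟨7, 9, 0, 0, 0, []⟩], [⟨3, 3, 28, 6, 0, [1]⟩, ⟨1, 2, 18, 2, 2, []⟩, ⟨13, 15, 27, 10, 2,
     [1]⟩], [⟨7, 13, 0, 0, 0, [2]⟩, ⟨12, 9, 23, 12, 4, []⟩, ⟨5, 0, 16, 4, 2, []⟩], [⟨11, 8, 37,
     10, 0, [2]⟩, ⟨8, 11, 25, 8, 0, []⟩, ⟨6, 4, 0, 0, 0, []⟩], [⟨9, 15, 35, 6, 0, [3]⟩, ⟨10, 7,
     21, 12, 4, []⟩, ⟨0, 5, 0, 0, 0, []⟩], [⟨13, 4, 34, 0, 1, [3]⟩, ⟨6, 15, 17, 8, 2, []⟩, ⟨8,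
     2, 0, 0, 0, []⟩], [⟨5, 11, 40, 10, 0, [3, 0]⟩, ⟨14, 5, 45, 12, 0, [3, 0, 2]⟩, ⟨9, 7, 19, 4,
     0, []⟩], [⟨15, 6, 36, 0, 1, [2]⟩, ⟨4, 13, 24, 12, 0, []⟩, ⟨2, 8, 0, 0, 0, []⟩], [⟨10, 10,
     44, 10, 0, [0]⟩, ⟨15, 6, 41, 2, 1, [3, 0, 2]⟩, ⟨11, 1, 20, 4, 1, []⟩], [⟨8, 5, 42, 0, 1,
     [3, 1, 2]⟩, ⟨5, 14, 22, 8, 2, []⟩, ⟨12, 10, 0, 0, 0, []⟩], [⟨12, 12, 31, 6, 2, [0]⟩, ⟨13,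
     4, 30, 2, 0, [1]⟩, ⟨1, 11, 0, 0, 0, []⟩], [⟨4, 7, 0, 0, 0, []⟩, ⟨9, 12, 29, 8, 0, [0]⟩,
     ⟨14, 3, 48, 10, 5, []⟩], [⟨14, 14, 47, 6, 0, [3, 0, 2]⟩, ⟨11, 8, 46, 2, 0, [3, 1, 2]⟩, ⟨15,
     13, 0, 0, 0, []⟩], [⟨6, 9, 0, 0, 0, []⟩, ⟨7, 10, 39, 6, 3, [3, 1, 2]⟩, ⟨3, 14, 43, 8, 3,
     [3, 1, 2]⟩]],
    [⟨[3, 3], 0, 6, []⟩, ⟨[1, 1, 1], 3, 0, []⟩, ⟨[1, 3, 1, 2], 3, 4, []⟩]⟩,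
  ⟨[[], [0], [2]],
    [[0, 2, 1]],
    [[⟨1, 2, 0, 0, 0, []⟩, ⟨2, 2, 0, 0, 0, []⟩], [⟨2, 0, 5, 5, 1, [0]⟩, ⟨1, 1, 0, 0, 0, [0]⟩], [⟨0,
     1, 6, 3, 1, [1]⟩, ⟨0, 0, 3, 1, 1, []⟩]],
    [⟨[1, 1], 1, 0, []⟩]⟩,
  ⟨[[], [0]],
    [],
    [[⟨1, 1, 0, 0, 0, []⟩], [⟨0, 0, 2, 1, 1, []⟩]],
    []⟩]

/-- Permutations of degree 12 satisfying the relations for `(2, 0)`. -/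
def perms20 : List (ℕ × ℕ) :=
   [(627470353170896023619570181,
     929683011492261326972716806),
    (3108176708880542956798410756,
     3108176672131171088360276481),
    (3102155636058472571656930056,
     2798691606753698106107757831)]

/-- A stabilizer chain for `perms20`. -/
def chain20 : List Orbit := [
  ⟨0,
    [[4], [0]],
    [(8, 0, 0), (5, 1, 0), (2, 0, 8), (4, 1, 8), (1, 0, 5), (6, 1, 5), (7, 0, 2), (3, 1, 2), (9, 1,
     4), (10, 1, 1), (11, 1, 3)]⟩,
  ⟨1,
    [[4, 2, 0]],
    [(10, 0, 1), (4, 0, 10), (9, 0, 4)]⟩,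
  ⟨6,
    [[3, 4, 4, 3]],
    [(11, 0, 6)]⟩]

theorem finite_and_card20 :
    Finite (tessGroup 3 4 4 2 0) ∧ Nat.card (tessGroup 3 4 4 2 0) = 96 :=
  finite_and_card (n := 12) (Ls := tower20) (T := perms20) (Os := chain20)
    (by decide +kernel) (by decide +kernel) rfl (by decide +kernel) (by decide +kernel)
    (by decide +kernel) (by decide +kernel)

/-- A chain of subgroups of the group with cusp modulus `(2, 1)`. -/
def tower21 : List Level := [
  ⟨[[], [2], [0], [1], [2, 1], [2, 0], [2, 0, 5], [0, 3], [0, 4], [2, 0, 3], [0, 5], [2, 0, 4]],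
    [[0, 5, 2, 2, 1, 3], [2, 0, 3, 4, 4, 1]],
    [[⟨2, 3, 0, 0, 0, []⟩, ⟨1, 1, 0, 0, 0, []⟩, ⟨1, 1, 36, 10, 2, [0, 2, 0]⟩], [⟨5, 4, 0, 0, 0, []⟩,
     ⟨0, 0, 35, 6, 1, [1, 1, 3, 3, 1]⟩, ⟨0, 0, 34, 10, 5, [1]⟩], [⟨3, 0, 12, 0, 0, []⟩, ⟨4, 7,
     33, 12, 9, [0, 2, 2, 0, 0]⟩, ⟨8, 10, 0, 0, 0, []⟩], [⟨0, 2, 0, 0, 0, []⟩, ⟨10, 5, 16, 2, 2,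
     [1]⟩, ⟨4, 4, 31, 8, 1, [1, 2, 0, 0]⟩], [⟨1, 5, 0, 0, 0, []⟩, ⟨6, 2, 30, 6, 1, [1, 1, 3,
     0]⟩, ⟨3, 3, 32, 12, 2, [1, 1, 3, 3]⟩], [⟨4, 1, 13, 0, 1, []⟩, ⟨3, 9, 14, 6, 3, []⟩, ⟨11, 6,
     0, 0, 0, []⟩], [⟨9, 11, 29, 10, 3, [1, 2, 0, 0]⟩, ⟨7, 4, 24, 12, 4, [2]⟩, ⟨5, 7, 0, 0, 0,
     []⟩], [⟨8, 10, 26, 0, 2, [2, 0]⟩, ⟨2, 6, 0, 0, 0, []⟩, ⟨6, 11, 22, 4, 0, [0]⟩], [⟨10, 7,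
     25, 10, 3, [1, 3, 1]⟩, ⟨11, 11, 23, 8, 2, [0]⟩, ⟨9, 2, 19, 4, 3, [3]⟩], [⟨11, 6, 27, 6, 0,
     [2, 0, 3]⟩, ⟨5, 10, 0, 0, 0, []⟩, ⟨10, 8, 0, 0, 0, [2]⟩], [⟨7, 8, 17, 6, 0, [0]⟩, ⟨9, 3, 0,
     0, 0, [0]⟩, ⟨2, 9, 0, 0, 0, []⟩], [⟨6, 9, 28, 6, 0, [1, 1, 3, 3]⟩, ⟨8, 8, 20, 8, 2, [2]⟩,
     ⟨7, 5, 21, 12, 11, [1]⟩]],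
    [⟨[1, 1], 0, 8, []⟩, ⟨[0, 2, 0, 2], 2, 2, []⟩, ⟨[2, 0, 3, 3, 3, 1, 2], 6, 0, [(7, 1, 0), (4, 0,
     0)]⟩]⟩,
  ⟨[[], [0], [0, 2], [3], [2], [2, 0], [2, 0, 3], [0, 2, 2], [3, 3], [2, 2]],
    [],
    [[⟨1, 1, 0, 0, 0, []⟩, ⟨4, 3, 0, 0, 0, []⟩], [⟨0, 0, 20, 4, 1, []⟩, ⟨2, 5, 0, 0, 0, []⟩], [⟨3,
     3, 11, 2, 0, []⟩, ⟨7, 1, 0, 0, 0, []⟩], [⟨2, 2, 12, 1, 1, []⟩, ⟨0, 8, 0, 0, 0, []⟩], [⟨5,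
     5, 0, 0, 0, []⟩, ⟨9, 0, 0, 0, 0, []⟩], [⟨4, 4, 10, 1, 0, []⟩, ⟨1, 6, 19, 5, 3, []⟩], [⟨9,
     9, 16, 1, 0, []⟩, ⟨5, 7, 0, 0, 0, []⟩], [⟨8, 8, 13, 2, 2, []⟩, ⟨6, 2, 17, 4, 0, []⟩], [⟨7,
     7, 14, 1, 1, []⟩, ⟨3, 9, 0, 0, 0, []⟩], [⟨6, 6, 15, 2, 0, []⟩, ⟨8, 4, 18, 2, 3, []⟩]],
    []⟩]

/-- Permutations of degree 5 satisfying the relations for `(2, 1)`. -/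
def perms21 : List (ℕ × ℕ) :=
   [(8657240320,
     12918718720),
    (12901941760,
     8657109760),
    (17213489155,
     17180066305)]

/-- A stabilizer chain for `perms21`. -/
def chain21 : List Orbit := [
  ⟨0,
    [[4], [2]],
    [(3, 0, 0), (2, 0, 3), (1, 1, 3), (4, 1, 2)]⟩,
  ⟨1,
    [[3]],
    [(3, 0, 1), (4, 0, 3), (2, 0, 4)]⟩,
  ⟨2,
    [[1]],
    [(4, 0, 2), (3, 0, 4)]⟩,
  ⟨3,
    [[3, 0, 2, 2]],
    [(4, 0, 3)]⟩]

theorem finite_and_card21 :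
    Finite (tessGroup 3 4 4 2 1) ∧ Nat.card (tessGroup 3 4 4 2 1) = 120 :=
  finite_and_card (n := 5) (Ls := tower21) (T := perms21) (Os := chain21)
    (by decide +kernel) (by decide +kernel) rfl (by decide +kernel) (by decide +kernel)
    (by decide +kernel) (by decide +kernel)

/-- A chain of subgroups of the group with cusp modulus `(2, 2)`. -/
def tower22 : List Level := [
  ⟨[[], [5], [0], [2], [2, 2], [3], [2, 0], [3, 5]],
    [[2, 2, 0, 3, 3], [2, 2, 4, 1]],
    [[⟨2, 1, 0, 0, 0, []⟩, ⟨3, 5, 0, 0, 0, []⟩, ⟨1, 1, 19, 10, 5, [1, 2, 2]⟩], [⟨0, 2, 17, 6, 2,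
     [3]⟩, ⟨7, 6, 20, 8, 0, [3, 3, 0]⟩, ⟨0, 0, 0, 0, 0, []⟩], [⟨1, 0, 18, 0, 0, [2]⟩, ⟨6, 7, 12,
     6, 3, [1]⟩, ⟨4, 4, 23, 12, 2, [1, 3, 0, 2, 1, 2]⟩], [⟨6, 5, 0, 0, 0, []⟩, ⟨4, 0, 0, 0, 0,
     []⟩, ⟨6, 6, 16, 8, 1, [3]⟩], [⟨4, 4, 0, 0, 0, [0]⟩, ⟨5, 3, 8, 2, 3, []⟩, ⟨2, 2, 0, 0, 0,
     [2]⟩], [⟨3, 6, 10, 6, 0, [1]⟩, ⟨0, 4, 0, 0, 0, []⟩, ⟨7, 7, 24, 8, 1, [3, 0, 3]⟩], [⟨5, 3,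
     11, 0, 2, [0]⟩, ⟨1, 2, 15, 10, 1, [2]⟩, ⟨3, 3, 14, 8, 1, [0, 3]⟩], [⟨7, 7, 22, 6, 0, [1, 2,
     1, 3, 0]⟩, ⟨2, 1, 21, 2, 0, [1, 2, 0]⟩, ⟨5, 5, 0, 0, 0, []⟩]],
    [⟨[0, 0, 0], 4, 0, []⟩, ⟨[1, 2, 2, 1, 2, 2], 0, 4, []⟩, ⟨[0, 3, 1, 2, 0, 3, 1, 2], 0, 12, [(1,
     4, 0)]⟩, ⟨[0, 2, 2, 0, 3, 0, 3], 4, 10, [(5, 4, 6), (7, 0, 0)]⟩]⟩,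
  ⟨[[], [0], [1], [2], [3, 0], [3, 3], [3], [3, 1]],
    [[2, 2, 0]],
    [[⟨1, 2, 0, 0, 0, []⟩, ⟨3, 6, 0, 0, 0, []⟩], [⟨2, 0, 8, 0, 2, []⟩, ⟨7, 7, 16, 7, 0, [0, 0, 0]⟩],
     [⟨0, 1, 0, 0, 0, []⟩, ⟨4, 3, 11, 7, 0, [0]⟩], [⟨3, 3, 13, 3, 5, [0, 0]⟩, ⟨2, 0, 0, 0, 0,
     [0]⟩], [⟨7, 6, 9, 0, 1, []⟩, ⟨5, 2, 12, 6, 1, [0]⟩], [⟨5, 5, 15, 4, 4, [0, 0]⟩, ⟨6, 4, 0,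
     0, 0, []⟩], [⟨4, 7, 0, 0, 0, []⟩, ⟨0, 5, 0, 0, 0, []⟩], [⟨6, 4, 0, 0, 0, []⟩, ⟨1, 1, 14, 4,
     3, [0, 0]⟩]],
    [⟨[0, 0, 0, 0, 0, 0], 3, 0, []⟩]⟩,
  ⟨[[], [0], [0, 0], [0, 0, 0], [1, 1], [1]],
    [],
    [[⟨1, 5, 0, 0, 0, []⟩], [⟨2, 0, 0, 0, 0, []⟩], [⟨3, 1, 0, 0, 0, []⟩], [⟨4, 2, 6, 0, 4, []⟩],
     [⟨5, 3, 0, 0, 0, []⟩], [⟨0, 4, 0, 0, 0, []⟩]],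
    []⟩]

/-- Permutations of degree 12 satisfying the relations for `(2, 2)`. -/
def perms22 : List (ℕ × ℕ) :=
   [(2793855977334559360048758786,
     1860588875375059882211279361),
    (3108162615783110919148013316,
     3108186098128597228846253316),
    (3108181394785599577724683776,
     3108181450123861474133803776)]

/-- A stabilizer chain for `perms22`. -/
def chain22 : List Orbit := [
  ⟨0,
    [[0], [4]],
    [(2, 0, 0), (1, 0, 2), (6, 1, 1), (11, 0, 6), (8, 1, 6), (9, 0, 11), (10, 1, 11), (4, 0, 8), (3,
     1, 8), (7, 1, 9), (5, 0, 4)]⟩,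
  ⟨1,
    [[5], [1, 2, 5, 1]],
    [(3, 0, 1), (5, 1, 1), (8, 0, 3), (7, 1, 3), (6, 0, 8), (2, 1, 8), (9, 0, 7)]⟩,
  ⟨2,
    [[1, 5, 0]],
    [(7, 0, 2), (5, 0, 7), (9, 0, 5)]⟩]

theorem finite_and_card22 :
    Finite (tessGroup 3 4 4 2 2) ∧ Nat.card (tessGroup 3 4 4 2 2) = 384 :=
  finite_and_card (n := 12) (Ls := tower22) (T := perms22) (Os := chain22)
    (by decide +kernel) (by decide +kernel) rfl (by decide +kernel) (by decide +kernel)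
    (by decide +kernel) (by decide +kernel)

/-- A chain of subgroups of the group with cusp modulus `(3, 0)`. -/
def tower30 : List Level := [
  ⟨[[], [0], [1], [1, 2], [0, 3], [0, 4], [1, 2, 5], [1, 2, 1], [0, 3, 4], [0, 3, 5, 5], [0, 3, 5],
     [0, 4, 1], [0, 4, 1, 4], [1, 2, 1, 5], [1, 2, 1, 5, 2], [0, 3, 5, 5, 0], [0, 3, 5, 0, 5],
     [0, 3, 5, 0], [0, 3, 5, 0, 5, 0], [0, 3, 5, 0, 5, 1]],
    [[1, 2, 2, 2, 1], [0, 3, 5, 2, 5, 2, 1]],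
    [[⟨1, 2, 0, 0, 0, []⟩, ⟨0, 0, 37, 6, 1, [0]⟩, ⟨0, 0, 58, 10, 2, [2]⟩], [⟨2, 0, 23, 0, 2, []⟩,
     ⟨2, 4, 36, 2, 2, [1]⟩, ⟨5, 3, 0, 0, 0, []⟩], [⟨0, 1, 0, 0, 0, []⟩, ⟨3, 1, 0, 0, 0, []⟩, ⟨2,
     2, 57, 8, 1, [0, 3, 1]⟩], [⟨4, 7, 24, 6, 2, []⟩, ⟨4, 2, 0, 0, 0, [0]⟩, ⟨1, 6, 50, 12, 6,
     [0, 2]⟩], [⟨7, 3, 25, 0, 2, []⟩, ⟨1, 3, 0, 0, 0, []⟩, ⟨8, 10, 0, 0, 0, []⟩], [⟨8, 11, 34,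
     0, 1, [0]⟩, ⟨10, 6, 20, 8, 0, []⟩, ⟨6, 1, 51, 4, 0, [3, 1]⟩], [⟨6, 6, 54, 6, 2, [2, 1]⟩,
     ⟨5, 8, 53, 2, 3, [0, 3]⟩, ⟨3, 5, 0, 0, 0, []⟩], [⟨3, 4, 0, 0, 0, []⟩, ⟨7, 7, 29, 6, 3,
     [1]⟩, ⟨11, 13, 30, 10, 2, [0]⟩], [⟨11, 5, 33, 10, 0, [1]⟩, ⟨6, 10, 35, 10, 4, [1]⟩, ⟨9, 4,
     22, 4, 3, []⟩], [⟨15, 12, 0, 0, 0, []⟩, ⟨9, 9, 40, 8, 0, [3]⟩, ⟨10, 8, 0, 0, 0, []⟩], [⟨17,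
     13, 0, 0, 0, []⟩, ⟨8, 5, 0, 0, 0, [2]⟩, ⟨4, 9, 0, 0, 0, []⟩], [⟨5, 8, 0, 0, 0, []⟩, ⟨13,
     17, 31, 8, 0, []⟩, ⟨12, 7, 0, 0, 0, []⟩], [⟨9, 15, 41, 10, 0, [2]⟩, ⟨16, 15, 27, 8, 0, []⟩,
     ⟨13, 11, 38, 4, 2, [1]⟩], [⟨10, 17, 52, 6, 0, [0, 3]⟩, ⟨14, 11, 0, 0, 0, []⟩, ⟨7, 12, 0, 0,
     0, []⟩], [⟨14, 14, 56, 6, 2, [0, 3]⟩, ⟨17, 13, 32, 2, 2, []⟩, ⟨15, 17, 47, 8, 3, [0]⟩],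
     [⟨12, 9, 43, 0, 1, [3]⟩, ⟨12, 18, 42, 6, 1, []⟩, ⟨16, 14, 48, 12, 6, [0]⟩], [⟨18, 19, 0, 0,
     0, []⟩, ⟨18, 12, 45, 2, 1, [3]⟩, ⟨17, 15, 0, 0, 0, []⟩], [⟨13, 10, 55, 10, 3, [2, 1]⟩, ⟨11,
     14, 26, 6, 3, []⟩, ⟨14, 16, 49, 12, 2, [1, 1]⟩], [⟨19, 16, 21, 0, 2, []⟩, ⟨15, 16, 44, 6,
     3, [2]⟩, ⟨18, 18, 59, 8, 1, [2, 1, 3]⟩], [⟨16, 18, 0, 0, 0, []⟩, ⟨19, 19, 46, 6, 1, [2]⟩,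
     ⟨19, 19, 60, 10, 2, [0]⟩]],
    [⟨[0, 0, 0, 0], 0, 2, []⟩, ⟨[3, 3, 3, 3], 9, 2, []⟩, ⟨[0, 2, 0, 2], 0, 8, []⟩, ⟨[2, 1, 2, 1, 2,
     1], 6, 0, []⟩]⟩,
  ⟨[[], [2], [3], [2, 2], [2, 1], [3, 0], [2, 2, 1], [2, 1, 3], [2, 1, 3, 0]],
    [[2, 1, 2, 1, 2]],
    [[⟨0, 0, 16, 7, 2, [0]⟩, ⟨1, 2, 0, 0, 0, []⟩], [⟨2, 4, 17, 4, 2, [1]⟩, ⟨3, 0, 0, 0, 0, []⟩],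
     [⟨5, 1, 0, 0, 0, []⟩, ⟨0, 3, 0, 0, 0, []⟩], [⟨7, 6, 11, 4, 2, []⟩, ⟨2, 1, 9, 3, 0, []⟩],
     [⟨1, 5, 0, 0, 0, []⟩, ⟨5, 7, 0, 0, 0, [0]⟩], [⟨4, 2, 18, 0, 1, [0]⟩, ⟨6, 4, 10, 4, 3, []⟩],
     [⟨3, 8, 0, 0, 0, []⟩, ⟨7, 5, 14, 3, 0, [1]⟩], [⟨8, 3, 0, 0, 0, []⟩, ⟨4, 6, 0, 0, 0, []⟩],
     [⟨6, 7, 12, 0, 1, []⟩, ⟨8, 8, 15, 4, 3, [0]⟩]],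
    [⟨[0, 0, 0, 0], 0, 0, []⟩]⟩,
  ⟨[[], [0], [0, 0], [1]],
    [],
    [[⟨1, 3, 0, 0, 0, []⟩], [⟨2, 0, 0, 0, 0, []⟩], [⟨3, 1, 4, 0, 1, []⟩], [⟨0, 2, 0, 0, 0, []⟩]],
    []⟩]

/-- Permutations of degree 12 satisfying the relations for `(3, 0)`. -/
def perms30 : List (ℕ × ℕ) :=
   [(3416466996946137474524119296,
     3416466941893575973816893696),
    (3108186172492032089732218881,
     3108181505249887943678689281),
    (3103364636313303665535353601,
     2798696440376543228949889026)]

/-- A stabilizer chain for `perms30`. -/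
def chain30 : List Orbit := [
  ⟨0,
    [[4], [0]],
    [(1, 0, 0), (3, 0, 1), (2, 0, 3), (6, 1, 3), (8, 0, 6), (5, 1, 6), (7, 1, 8), (4, 0, 5), (9, 0,
     7), (11, 0, 9), (10, 0, 11)]⟩,
  ⟨1,
    [[5, 2], [1]],
    [(2, 0, 1), (4, 0, 2), (7, 1, 4), (8, 1, 7)]⟩,
  ⟨2,
    [[3, 1, 2], [1]],
    [(8, 0, 2), (4, 0, 8), (7, 1, 4)]⟩,
  ⟨3,
    [[1]],
    [(5, 0, 3), (6, 0, 5)]⟩]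

theorem finite_and_card30 :
    Finite (tessGroup 3 4 4 3 0) ∧ Nat.card (tessGroup 3 4 4 3 0) = 720 :=
  finite_and_card (n := 12) (Ls := tower30) (T := perms30) (Os := chain30)
    (by decide +kernel) (by decide +kernel) rfl (by decide +kernel) (by decide +kernel)
    (by decide +kernel) (by decide +kernel)

/-- A chain of subgroups of the group with cusp modulus `(3, 1)`. -/
def tower31 : List Level := [
  ⟨[[], [4], [1], [2], [1, 5], [2, 1], [2, 0], [1, 2], [4, 3], [2, 0, 3], [1, 5, 1], [1, 2, 1]],
    [[1, 2, 4, 0, 3], [1, 2, 0, 2, 5]],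
    [[⟨1, 2, 26, 0, 1, [2]⟩, ⟨3, 3, 0, 0, 0, []⟩, ⟨1, 2, 0, 0, 0, []⟩], [⟨2, 0, 25, 6, 0, [3]⟩, ⟨5,
     8, 28, 6, 1, [3, 3, 0]⟩, ⟨4, 0, 22, 4, 1, [0]⟩], [⟨0, 1, 0, 0, 0, []⟩, ⟨7, 6, 0, 0, 0, []⟩,
     ⟨0, 4, 21, 8, 3, [1]⟩], [⟨6, 5, 0, 0, 0, []⟩, ⟨0, 0, 27, 10, 1, [1, 2]⟩, ⟨6, 5, 20, 10, 2,
     [0]⟩], [⟨9, 10, 17, 6, 0, [0]⟩, ⟨8, 5, 29, 2, 1, [2, 2]⟩, ⟨2, 1, 0, 0, 0, []⟩], [⟨3, 6, 0,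
     0, 0, []⟩, ⟨4, 1, 16, 8, 0, [1]⟩, ⟨3, 7, 31, 8, 1, [1, 2, 0]⟩], [⟨5, 3, 12, 0, 2, []⟩, ⟨2,
     9, 13, 6, 1, []⟩, ⟨7, 3, 32, 10, 2, [1, 1, 3]⟩], [⟨8, 11, 0, 0, 0, [2]⟩, ⟨9, 2, 14, 2, 2,
     []⟩, ⟨5, 6, 0, 0, 0, [0]⟩], [⟨11, 7, 24, 0, 2, [3]⟩, ⟨1, 4, 0, 0, 0, []⟩, ⟨8, 8, 36, 10, 2,
     [3, 3, 1]⟩], [⟨10, 4, 18, 0, 2, [1]⟩, ⟨6, 7, 0, 0, 0, []⟩, ⟨9, 9, 33, 8, 1, [2, 0, 0]⟩],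
     [⟨4, 9, 0, 0, 0, []⟩, ⟨11, 11, 19, 6, 3, [0]⟩, ⟨10, 10, 35, 8, 1, [2, 2, 0]⟩], [⟨7, 8, 0,
     0, 0, []⟩, ⟨10, 10, 30, 6, 3, [3]⟩, ⟨11, 11, 34, 10, 5, [1, 1, 3]⟩]],
    [⟨[1, 2, 1, 2], 0, 2, []⟩, ⟨[1, 3, 1, 3, 3, 1], 0, 12, []⟩, ⟨[1, 3, 0, 2, 0, 2, 2, 2, 2, 2], 11,
     12, [(2, 4, 0), (14, 1, 3), (4, 3, 1), (4, 2, 0)]⟩]⟩,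
  ⟨[[], [1], [3], [2], [0]],
    [[3, 0, 2]],
    [[⟨4, 1, 0, 0, 0, []⟩, ⟨3, 2, 0, 0, 0, []⟩], [⟨0, 3, 0, 0, 0, []⟩, ⟨2, 3, 6, 0, 1, [0]⟩], [⟨2,
     2, 0, 0, 0, [0]⟩, ⟨0, 1, 0, 0, 0, []⟩], [⟨1, 4, 7, 3, 3, [1, 1, 1]⟩, ⟨1, 0, 8, 4, 8, [0, 0,
     0]⟩], [⟨3, 0, 9, 3, 0, [1, 1, 1, 1, 1]⟩, ⟨4, 4, 10, 0, 1, [1, 1, 1, 1, 1]⟩]],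
    [⟨[0, 0, 0, 0, 0, 0, 0, 0, 0, 0, 0, 0], 1, 0, []⟩]⟩,
  ⟨[[], [0], [0, 0], [0, 0, 0], [0, 0, 0, 0], [0, 0, 0, 0, 0], [0, 0, 0, 0, 0, 0], [1, 1, 1, 1, 1],
     [1, 1, 1, 1], [1, 1, 1], [1, 1], [1]],
    [],
    [[⟨1, 11, 0, 0, 0, []⟩], [⟨2, 0, 0, 0, 0, []⟩], [⟨3, 1, 0, 0, 0, []⟩], [⟨4, 2, 0, 0, 0, []⟩],
     [⟨5, 3, 0, 0, 0, []⟩], [⟨6, 4, 0, 0, 0, []⟩], [⟨7, 5, 12, 0, 9, []⟩], [⟨8, 6, 0, 0, 0,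
     []⟩], [⟨9, 7, 0, 0, 0, []⟩], [⟨10, 8, 0, 0, 0, []⟩], [⟨11, 9, 0, 0, 0, []⟩], [⟨0, 10, 0, 0,
     0, []⟩]],
    []⟩]

/-- Permutations of degree 15 satisfying the relations for `(3, 1)`. -/
def perms31 : List (ℕ × ℕ) :=
   [(10527287352839019939579483012663300,
     15699459338107232548133308262648325),
    (31215581909431773925570545258333960,
     26043567461709505413513600483657735),
    (72956621799618417349929181852532745,
     72956224737594927326789539524575745)]

/-- A stabilizer chain for `perms31`. -/
def chain31 : List Orbit := [
  ⟨0,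
    [[4], [0]],
    [(9, 0, 0), (4, 1, 0), (2, 0, 9), (11, 1, 9), (5, 1, 4), (1, 0, 2), (3, 1, 2), (7, 0, 11), (12,
     1, 11), (8, 1, 1), (14, 1, 3), (6, 1, 7), (10, 0, 12), (13, 1, 6)]⟩,
  ⟨3,
    [[0, 4, 0, 3], [4, 2, 2]],
    [(14, 0, 3), (11, 1, 3), (6, 1, 14), (7, 1, 11), (8, 0, 6), (12, 1, 6), (10, 0, 7)]⟩,
  ⟨2,
    [[2, 1, 5, 2, 1, 5]],
    [(13, 0, 2), (9, 0, 13)]⟩,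
  ⟨8,
    [[4, 3, 4, 2, 0, 4, 1]],
    [(11, 0, 8)]⟩]

theorem finite_and_card31 :
    Finite (tessGroup 3 4 4 3 1) ∧ Nat.card (tessGroup 3 4 4 3 1) = 720 :=
  finite_and_card (n := 15) (Ls := tower31) (T := perms31) (Os := chain31)
    (by decide +kernel) (by decide +kernel) rfl (by decide +kernel) (by decide +kernel)
    (by decide +kernel) (by decide +kernel)

/-- A chain of subgroups of the group with cusp modulus `(3, 2)`. -/
def tower32 : List Level := [
  ⟨[[], [2]],
    [[2, 0, 3], [2, 2], [2, 4], [4, 3]],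
    [[⟨0, 0, 4, 6, 2, [3, 1]⟩, ⟨1, 1, 0, 0, 0, []⟩, ⟨1, 1, 0, 0, 0, [6]⟩], [⟨1, 1, 0, 0, 0, [0]⟩,
     ⟨0, 0, 0, 0, 0, [2]⟩, ⟨0, 0, 0, 0, 0, [4]⟩]],
    [⟨[2, 2], 0, 2, []⟩, ⟨[4, 4], 0, 8, []⟩, ⟨[0, 0, 0], 1, 0, []⟩, ⟨[6, 4, 6, 4], 0, 4, []⟩, ⟨[2,
     6, 2, 6], 1, 8, []⟩, ⟨[3, 1, 3, 1, 3, 1], 0, 0, []⟩, ⟨[3, 1, 4, 3, 1, 4], 0, 10, []⟩, ⟨[0,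
     2, 6, 0, 2, 6], 1, 10, []⟩, ⟨[5, 2, 6, 6, 6, 5, 2], 0, 12, [(2, 3, 0), (1, 3, 0), (9, 3,
     0), (2, 7, 0), (2, 7, 0)]⟩, ⟨[7, 7, 7, 5, 6, 6, 2], 1, 12, [(12, 3, 0), (1, 3, 0), (2, 7,
     0), (2, 7, 0), (2, 7, 0), (4, 17, 2)]⟩]⟩,
  ⟨[[], [2], [4], [1], [4, 7], [4, 0], [4, 6], [1, 3], [4, 1], [4, 0, 7], [4, 1, 7], [1, 6], [4, 7,
     0], [4, 1, 7, 1]],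
    [[1, 3, 6, 3], [4, 2, 1, 5]],
    [[⟨1, 3, 26, 13, 4, [2]⟩, ⟨1, 1, 0, 0, 0, []⟩, ⟨2, 2, 0, 0, 0, []⟩, ⟨3, 1, 19, 8, 1, [1]⟩], [⟨3,
     0, 27, 4, 0, [3]⟩, ⟨0, 0, 17, 0, 1, []⟩, ⟨6, 6, 35, 2, 0, [0, 3]⟩, ⟨0, 7, 29, 14, 2, [0,
     3]⟩], [⟨5, 8, 0, 0, 0, []⟩, ⟨5, 5, 0, 0, 0, [2]⟩, ⟨0, 0, 15, 2, 1, []⟩, ⟨6, 4, 0, 0, 0,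
     []⟩], [⟨0, 1, 0, 0, 0, []⟩, ⟨7, 7, 14, 0, 1, []⟩, ⟨4, 4, 20, 6, 3, [0]⟩, ⟨11, 0, 0, 0, 0,
     []⟩], [⟨12, 6, 0, 0, 0, []⟩, ⟨4, 4, 36, 16, 6, [2, 1]⟩, ⟨3, 3, 21, 2, 0, [1]⟩, ⟨2, 5, 0, 0,
     0, []⟩], [⟨8, 2, 16, 4, 1, []⟩, ⟨2, 2, 23, 0, 0, [3]⟩, ⟨11, 11, 37, 2, 0, [1, 1]⟩, ⟨4, 9,
     31, 16, 3, [1]⟩], [⟨4, 12, 38, 13, 1, [2, 0, 3]⟩, ⟨9, 9, 24, 8, 2, [2]⟩, ⟨1, 1, 30, 6, 1,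
     [2, 1]⟩, ⟨10, 2, 49, 19, 6, [2, 1, 1, 2, 0, 0, 3]⟩], [⟨7, 7, 28, 11, 0, [2]⟩, ⟨3, 3, 0, 0,
     0, []⟩, ⟨10, 10, 44, 2, 1, [2, 0, 0, 3]⟩, ⟨1, 8, 0, 0, 0, [0]⟩], [⟨2, 5, 0, 0, 0, []⟩, ⟨11,
     11, 53, 14, 1, [0, 3, 1, 3, 0, 0, 3, 1]⟩, ⟨8, 8, 56, 6, 3, [2, 1, 1, 3, 0, 2, 1, 1, 2, 0,
     0, 3]⟩, ⟨7, 10, 50, 19, 5, [2, 1, 1, 3, 0, 0, 3, 1]⟩], [⟨13, 10, 40, 4, 2, [0, 3]⟩, ⟨6, 6,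
     25, 0, 0, [3]⟩, ⟨12, 12, 48, 2, 1, [3, 1, 2, 0]⟩, ⟨5, 12, 0, 0, 0, []⟩], [⟨9, 13, 39, 11,
     4, [2, 1]⟩, ⟨12, 12, 34, 0, 0, [2, 1]⟩, ⟨7, 7, 43, 12, 2, [2, 1, 1, 3]⟩, ⟨8, 6, 0, 0, 0,
     []⟩], [⟨11, 11, 52, 14, 0, [3]⟩, ⟨8, 8, 51, 18, 6, [0, 2, 1, 1, 2, 0, 0, 3]⟩, ⟨5, 5, 33, 6,
     1, [0, 0]⟩, ⟨12, 3, 46, 19, 5, [0, 2, 1, 1, 2, 0]⟩], [⟨6, 4, 41, 4, 0, [2, 1, 3]⟩, ⟨10, 10,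
     32, 14, 1, [0, 3]⟩, ⟨9, 9, 47, 17, 1, [1, 3, 0, 2]⟩, ⟨9, 11, 45, 16, 2, [1, 3, 0, 0]⟩],
     [⟨10, 9, 0, 0, 0, []⟩, ⟨13, 13, 42, 11, 3, [0, 3]⟩, ⟨13, 13, 55, 12, 2, [2, 1, 1, 3, 0, 2,
     0, 3, 0, 3]⟩, ⟨13, 13, 54, 14, 2, [2, 1, 2, 1, 1, 1, 2, 0, 0, 3]⟩]],
    [⟨[2, 2, 2], 7, 4, []⟩, ⟨[2, 1, 2, 1], 4, 0, []⟩, ⟨[1, 3, 0, 2, 0, 3, 1, 3, 0, 2, 0, 3], 13, 2,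
     [(2, 4, 0)]⟩, ⟨[1, 1, 3, 0, 0, 3, 1, 2, 0, 2, 1, 1, 2, 0, 2, 1], 5, 10, []⟩, ⟨[2, 0, 3, 1,
     3, 1, 1, 1, 2, 0, 2, 1, 1], 13, 16, [(4, 8, 0), (2, 3, 0), (1, 8, 0), (18, 2, 0), (0, 1,
     0), (1, 8, 0), (8, 4, 9)]⟩, ⟨[0, 2, 0, 2, 1, 3, 1, 3, 0, 0, 3, 1, 2, 0, 2], 0, 20, [(0, 6,
     0), (10, 9, 7)]⟩]⟩,
  ⟨[[], [1], [3], [2], [2, 1], [0], [2, 0], [3, 1], [0, 0], [0, 0, 3], [0, 2], [0, 0, 3, 1], [0, 0,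
     3, 1, 1], [0, 2, 0, 0], [0, 2, 0], [2, 1, 1, 3], [0, 0, 2, 0], [0, 0, 2], [2, 0, 2], [2, 0,
     0, 3], [2, 1, 1, 1, 2], [2, 1, 1], [2, 0, 0, 2], [2, 1, 1, 1, 3], [2, 1, 1, 1], [2, 0, 0]],
    [[0, 2, 0, 0, 2, 0, 2, 1, 1]],
    [[⟨5, 1, 0, 0, 0, []⟩, ⟨3, 2, 0, 0, 0, []⟩], [⟨0, 2, 0, 0, 0, []⟩, ⟨1, 1, 50, 2, 0, [1]⟩], [⟨1,
     7, 45, 9, 5, [1]⟩, ⟨0, 3, 0, 0, 0, []⟩], [⟨6, 4, 0, 0, 0, []⟩, ⟨2, 0, 33, 0, 2, []⟩], [⟨3,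
     21, 0, 0, 0, []⟩, ⟨5, 10, 27, 2, 2, []⟩], [⟨8, 0, 0, 0, 0, []⟩, ⟨10, 4, 0, 0, 0, []⟩],
     [⟨25, 3, 0, 0, 0, []⟩, ⟨18, 7, 0, 0, 0, []⟩], [⟨2, 8, 0, 0, 0, []⟩, ⟨6, 18, 34, 2, 2, []⟩],
     [⟨7, 5, 51, 5, 5, [0]⟩, ⟨17, 9, 0, 0, 0, []⟩], [⟨10, 11, 30, 3, 2, []⟩, ⟨8, 17, 0, 0, 0,
     []⟩], [⟨14, 9, 0, 0, 0, []⟩, ⟨4, 5, 28, 0, 0, []⟩], [⟨9, 12, 0, 0, 0, []⟩, ⟨16, 13, 41, 2,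
     0, []⟩], [⟨11, 13, 0, 0, 0, []⟩, ⟨12, 12, 49, 5, 6, [1]⟩], [⟨12, 14, 48, 9, 6, []⟩, ⟨11,
     16, 0, 0, 0, [0]⟩], [⟨13, 10, 0, 0, 0, []⟩, ⟨15, 21, 31, 0, 1, []⟩], [⟨20, 16, 26, 3, 2,
     []⟩, ⟨21, 14, 0, 0, 0, []⟩], [⟨15, 17, 44, 3, 0, [1]⟩, ⟨13, 11, 43, 0, 0, [1]⟩], [⟨16, 18,
     0, 0, 0, []⟩, ⟨9, 8, 40, 0, 2, []⟩], [⟨17, 19, 46, 10, 0, [1]⟩, ⟨7, 6, 35, 0, 2, []⟩],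
     [⟨18, 20, 38, 4, 4, []⟩, ⟨25, 22, 0, 0, 0, []⟩], [⟨19, 15, 52, 9, 6, [1]⟩, ⟨23, 24, 36, 0,
     0, []⟩], [⟨4, 24, 0, 0, 0, []⟩, ⟨14, 15, 29, 2, 0, []⟩], [⟨23, 23, 47, 8, 1, [0]⟩, ⟨19, 25,
     32, 0, 0, []⟩], [⟨22, 22, 37, 4, 10, []⟩, ⟨24, 20, 0, 0, 0, []⟩], [⟨21, 25, 0, 0, 0, []⟩,
     ⟨20, 23, 0, 0, 0, []⟩], [⟨24, 6, 39, 5, 11, []⟩, ⟨22, 19, 0, 0, 0, []⟩]],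
    [⟨[1, 1, 1], 1, 0, []⟩]⟩,
  ⟨[[], [0], [1]],
    [],
    [[⟨1, 2, 0, 0, 0, []⟩], [⟨2, 0, 3, 1, 1, []⟩], [⟨0, 1, 0, 0, 0, []⟩]],
    []⟩]

/-- Permutations of degree 14 satisfying the relations for `(3, 2)`. -/
def perms32 : List (ℕ × ℕ) :=
   [(244264459226529746087855648277511,
     224140188038194547179331768615686),
    (264544081075612694299123080233221,
     263912732859762229642066471026946),
    (264622998539284126002023676510721,
     264623923358128651716756716453896)]

/-- A stabilizer chain for `perms32`. -/
def chain32 : List Orbit := [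
  ⟨0,
    [[4], [0]],
    [(1, 0, 0), (7, 1, 0), (2, 0, 1), (4, 1, 1), (6, 1, 7), (8, 0, 2), (10, 1, 2), (5, 0, 4), (3, 1,
     4), (11, 0, 6), (9, 1, 10), (13, 1, 11), (12, 1, 13)]⟩,
  ⟨1,
    [[4, 2, 2, 0], [5, 3, 4]],
    [(12, 0, 1), (10, 1, 1), (11, 1, 12), (6, 0, 10), (4, 1, 10), (13, 0, 11), (7, 1, 11), (3, 0,
     4), (8, 1, 4), (5, 0, 13), (2, 0, 3), (9, 1, 5)]⟩,
  ⟨2,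
    [[5, 5, 2, 0, 4, 2, 0]],
    [(12, 0, 2), (3, 0, 12), (5, 0, 3), (13, 0, 5), (8, 0, 13), (7, 0, 8), (11, 0, 7), (10, 0, 11),
     (4, 0, 10), (9, 0, 4), (6, 0, 9)]⟩]

theorem finite_and_card32 :
    Finite (tessGroup 3 4 4 3 2) ∧ Nat.card (tessGroup 3 4 4 3 2) = 2184 :=
  finite_and_card (n := 14) (Ls := tower32) (T := perms32) (Os := chain32)
    (by decide +kernel) (by decide +kernel) rfl (by decide +kernel) (by decide +kernel)
    (by decide +kernel) (by decide +kernel)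

/-- A chain of subgroups of the group with cusp modulus `(4, 1)`. -/
def tower41 : List Level := [
  ⟨[[], [4], [2], [2, 2], [3], [4, 4], [5], [3, 5], [2, 4], [2, 4, 4], [2, 5], [4, 3], [5, 2], [3,
     4, 0], [4, 3, 5], [3, 4, 0, 3], [3, 4], [4, 3, 5, 1]],
    [[2, 5, 2, 2, 5], [3, 4, 0, 0, 5, 5]],
    [[⟨1, 2, 41, 6, 0, [3, 0]⟩, ⟨2, 4, 0, 0, 0, []⟩, ⟨1, 6, 0, 0, 0, []⟩], [⟨2, 0, 37, 6, 0, [3]⟩,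
     ⟨7, 11, 23, 8, 2, []⟩, ⟨5, 0, 0, 0, 0, []⟩], [⟨0, 1, 45, 0, 1, [2, 1, 2]⟩, ⟨3, 0, 0, 0, 0,
     []⟩, ⟨8, 10, 0, 0, 0, []⟩], [⟨11, 6, 36, 10, 3, [2]⟩, ⟨4, 2, 19, 2, 2, []⟩, ⟨7, 16, 26, 8,
     3, [0]⟩], [⟨8, 7, 42, 10, 3, [1, 2]⟩, ⟨0, 3, 0, 0, 0, []⟩, ⟨16, 7, 0, 0, 0, []⟩], [⟨16, 13,
     35, 0, 0, [3]⟩, ⟨14, 13, 20, 8, 2, []⟩, ⟨6, 1, 21, 4, 1, []⟩], [⟨3, 11, 44, 6, 0, [3, 0]⟩,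
     ⟨12, 8, 0, 0, 0, []⟩, ⟨0, 5, 0, 0, 0, []⟩], [⟨4, 8, 40, 10, 0, [1, 2]⟩, ⟨10, 1, 25, 2, 2,
     [1]⟩, ⟨4, 3, 0, 0, 0, []⟩], [⟨7, 4, 49, 0, 0, [3, 0, 3, 0]⟩, ⟨6, 9, 22, 8, 0, []⟩, ⟨9, 2,
     0, 0, 0, []⟩], [⟨12, 10, 54, 10, 3, [3, 0, 3, 1, 1]⟩, ⟨8, 12, 29, 12, 0, [1, 1]⟩, ⟨10, 8,
     18, 4, 1, []⟩], [⟨9, 12, 53, 6, 2, [2, 1, 2, 0, 0]⟩, ⟨11, 7, 0, 0, 0, [0]⟩, ⟨2, 9, 0, 0, 0,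
     []⟩], [⟨6, 3, 46, 0, 2, [3, 1, 2]⟩, ⟨1, 10, 0, 0, 0, []⟩, ⟨12, 14, 31, 8, 1, [1, 1, 1]⟩],
     [⟨10, 9, 50, 6, 2, [3, 0, 2, 1]⟩, ⟨9, 6, 30, 2, 2, [0, 0]⟩, ⟨13, 11, 39, 8, 1, [3, 0]⟩],
     [⟨5, 16, 0, 0, 0, [2]⟩, ⟨5, 15, 38, 6, 1, [1, 2]⟩, ⟨14, 12, 48, 12, 14, [1, 2, 1]⟩], [⟨15,
     17, 33, 6, 2, [3]⟩, ⟨15, 5, 43, 2, 0, [3, 0]⟩, ⟨11, 13, 0, 0, 0, []⟩], [⟨17, 14, 34, 0, 0,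
     [2]⟩, ⟨13, 14, 0, 0, 0, []⟩, ⟨15, 15, 51, 8, 1, [1, 2, 0, 3, 0]⟩], [⟨13, 5, 0, 0, 0, []⟩,
     ⟨16, 16, 28, 8, 0, [0]⟩, ⟨3, 4, 27, 4, 2, [1]⟩], [⟨14, 15, 0, 0, 0, []⟩, ⟨17, 17, 47, 6, 3,
     [3, 1, 2]⟩, ⟨17, 17, 52, 10, 5, [1]⟩]],
    [⟨[0, 0, 0, 0], 16, 2, []⟩, ⟨[2, 1, 2, 2, 1, 2], 2, 6, []⟩, ⟨[3, 1, 2, 1, 3, 1, 2, 1], 17, 8,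
     []⟩, ⟨[3, 0, 3, 1, 1, 3, 0, 2, 1, 2, 1, 2, 0, 0], 9, 0, []⟩, ⟨[1, 2, 1, 1, 3, 1, 2, 0, 3,
     1, 2, 0, 3, 1, 2, 0, 3, 1], 17, 12, [(3, 0, 0), (4, 0, 0), (4, 0, 0), (4, 0, 0), (1, 8,
     0)]⟩]⟩,
  ⟨[[], [0]],
    [[2], [0, 2, 1]],
    [[⟨1, 1, 0, 0, 0, []⟩, ⟨0, 0, 0, 0, 0, [0]⟩], [⟨0, 0, 4, 3, 4, [2, 2, 0, 0]⟩, ⟨1, 1, 0, 0, 0,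
     [2]⟩]],
    [⟨[2, 2, 0, 0, 2, 2, 0, 0], 0, 0, []⟩, ⟨[1, 1, 1, 3, 1, 1, 1, 3], 0, 4, []⟩, ⟨[3, 1, 3, 3, 3, 1,
     3, 3], 1, 4, []⟩, ⟨[3, 1, 1, 3, 0, 3, 0, 2, 2, 0], 0, 6, [(1, 6, 0)]⟩, ⟨[2, 0, 0, 3, 0, 3,
     0, 3, 0, 3, 1, 1], 0, 8, [(2, 0, 5)]⟩, ⟨[1, 1, 2, 0, 3, 3, 0, 2], 1, 8, [(0, 0, 7), (2, 8,
     10)]⟩]⟩,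
  ⟨[[], [0], [0, 0], [0, 0, 2], [1, 1], [1], [1, 1, 1], [0, 0, 0], [1, 3], [0, 2], [0, 3], [0, 0,
     2, 0], [0, 2, 1], [0, 3, 1], [0, 3, 1, 3], [1, 3, 1], [0, 0, 0, 0]],
    [[1, 3, 1, 2, 1, 1, 1]],
    [[⟨1, 5, 0, 0, 0, []⟩, ⟨0, 0, 23, 3, 4, [0, 0, 0]⟩], [⟨2, 0, 0, 0, 0, []⟩, ⟨9, 10, 0, 0, 0,
     []⟩], [⟨7, 1, 0, 0, 0, []⟩, ⟨3, 5, 0, 0, 0, []⟩], [⟨11, 10, 0, 0, 0, []⟩, ⟨4, 2, 26, 8, 0,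
     [0, 0]⟩], [⟨5, 6, 0, 0, 0, []⟩, ⟨10, 3, 31, 6, 8, [1, 1, 1]⟩], [⟨0, 4, 0, 0, 0, []⟩, ⟨2, 8,
     19, 6, 8, [0, 0]⟩], [⟨4, 16, 0, 0, 0, []⟩, ⟨16, 7, 29, 9, 8, [1, 1]⟩], [⟨16, 2, 0, 0, 0,
     []⟩, ⟨6, 15, 22, 0, 1, [1, 1, 1]⟩], [⟨12, 15, 27, 0, 2, [0, 0]⟩, ⟨5, 9, 0, 0, 0, []⟩],
     [⟨13, 12, 33, 10, 3, [1, 1, 1, 1]⟩, ⟨8, 1, 25, 11, 3, [1]⟩], [⟨3, 13, 24, 8, 8, [0, 0]⟩,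
     ⟨1, 4, 0, 0, 0, []⟩], [⟨15, 3, 17, 3, 2, []⟩, ⟨14, 12, 21, 5, 3, [1, 1, 1]⟩], [⟨9, 8, 0, 0,
     0, []⟩, ⟨11, 16, 28, 10, 7, [0, 0]⟩], [⟨10, 9, 0, 0, 0, []⟩, ⟨15, 14, 20, 11, 2, [0]⟩],
     [⟨14, 14, 32, 10, 3, [0, 0, 0]⟩, ⟨13, 11, 0, 0, 0, []⟩], [⟨8, 11, 0, 0, 0, []⟩, ⟨7, 13, 0,
     0, 0, [0]⟩], [⟨6, 7, 30, 8, 2, []⟩, ⟨12, 6, 34, 0, 5, [0, 0, 0, 0]⟩]],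
    [⟨[0, 0, 0, 0, 0, 0, 0, 0], 0, 0, []⟩]⟩,
  ⟨[[], [0], [0, 0], [0, 0, 0], [0, 0, 0, 0], [1, 1, 1], [1, 1], [1]],
    [],
    [[⟨1, 7, 0, 0, 0, []⟩], [⟨2, 0, 0, 0, 0, []⟩], [⟨3, 1, 0, 0, 0, []⟩], [⟨4, 2, 0, 0, 0, []⟩],
     [⟨5, 3, 8, 0, 7, []⟩], [⟨6, 4, 0, 0, 0, []⟩], [⟨7, 5, 0, 0, 0, []⟩], [⟨0, 6, 0, 0, 0, []⟩]],
    []⟩]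

/-- Permutations of degree 72 satisfying the relations for `(4, 1)`. -/
def perms41 : List (ℕ × ℕ) :=
   [(64950897993128457737626290409920809695074169134752031002243140370145858837902941000240293089782374327438883726012415696275768874277664846470068422875673394756863416575524866,
     63976775212593089695006924374755467366558827918117951322841313246142627694650435768059992611029112463766156737123770375745480531221613462812198338310469801516195410322915841),
    (68860737807260551456239417587005894348196608583845168710447386956964117894897704396065777708925220503110046395942917212025997653700076828060123848412262493023190570464510976,
     68860737744520989179226645629397900678905146036590664989306532267961248796958932332910442962676321460119471078309282231625062470839421187268856957341632357576360517389451776),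
    (68860739535067525533328644616693245233002289913143626295249204072602872333679201821122032300658668460575915694030245141822224072024199870070925582082479187352545191868367616,
     68860739535069276310484826250751301415782280823778866646712050984656018026102402293292620430203424234075451477102087949621108524471237355422825973836186496277176569733186816)]

/-- A stabilizer chain for `perms41`. -/
def chain41 : List Orbit := [
  ⟨0,
    [[0], [4]],
    [(2, 0, 0), (1, 0, 2), (3, 1, 1), (14, 0, 3), (6, 1, 3), (4, 0, 14), (28, 1, 14), (20, 0, 6),
     (5, 1, 6), (13, 1, 4), (27, 0, 28), (30, 1, 28), (8, 0, 20), (23, 1, 20), (19, 0, 5), (32,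
     0, 13), (12, 1, 13), (10, 0, 27), (50, 1, 27), (41, 0, 30), (7, 1, 8), (40, 0, 23), (26, 1,
     23), (11, 0, 19), (31, 0, 32), (42, 1, 32), (9, 1, 10), (35, 0, 50), (52, 1, 50), (16, 0,
     41), (63, 1, 41), (22, 0, 7), (15, 0, 40), (59, 1, 40), (29, 0, 26), (46, 1, 31), (45, 0,
     42), (44, 1, 42), (25, 0, 9), (39, 0, 35), (34, 1, 35), (51, 1, 52), (53, 0, 63), (60, 1,
     63), (21, 0, 22), (18, 1, 15), (47, 0, 59), (62, 1, 59), (33, 1, 29), (36, 0, 46), (48, 1,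
     46), (66, 1, 45), (43, 0, 44), (24, 0, 25), (38, 1, 39), (37, 0, 34), (65, 0, 60), (64, 1,
     60), (57, 1, 21), (17, 1, 18), (49, 0, 62), (61, 1, 62), (71, 0, 66), (69, 0, 38), (56, 1,
     57), (54, 1, 49), (67, 0, 71), (68, 0, 69), (70, 0, 56), (55, 1, 56), (58, 0, 70)]⟩,
  ⟨1,
    [[0, 3, 5, 1, 2, 5, 2, 0, 4, 0, 4, 2, 1]],
    [(7, 0, 1), (2, 0, 7), (9, 0, 2), (6, 0, 9), (17, 0, 6), (10, 0, 17), (16, 0, 10), (4, 0, 16),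
     (11, 0, 4), (3, 0, 11), (5, 0, 3), (13, 0, 5), (12, 0, 13), (18, 0, 12), (8, 0, 18), (15,
     0, 8)]⟩,
  ⟨2,
    [[1, 5, 0]],
    [(11, 0, 2), (8, 0, 11), (4, 0, 8)]⟩]

theorem finite_and_card41 :
    Finite (tessGroup 3 4 4 4 1) ∧ Nat.card (tessGroup 3 4 4 4 1) = 4896 :=
  finite_and_card (n := 72) (Ls := tower41) (T := perms41) (Os := chain41)
    (by decide +kernel) (by decide +kernel) rfl (by decide +kernel) (by decide +kernel)
    (by decide +kernel) (by decide +kernel)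

/-- A chain of subgroups of the group with cusp modulus `(4, 2)`. -/
def tower42 : List Level := [
  ⟨[[], [4], [0], [2], [4, 3], [2, 1]],
    [[0, 0, 5], [4, 2]],
    [[⟨2, 1, 0, 0, 0, []⟩, ⟨3, 1, 0, 0, 0, []⟩, ⟨1, 2, 0, 0, 0, []⟩], [⟨0, 2, 7, 0, 1, [1]⟩, ⟨0, 4,
     0, 0, 0, [2]⟩, ⟨3, 0, 16, 4, 2, [0, 3, 1, 1]⟩], [⟨1, 0, 0, 0, 0, [0]⟩, ⟨2, 2, 12, 6, 3, [3,
     1]⟩, ⟨0, 3, 15, 8, 3, [0, 2, 0, 2, 1]⟩], [⟨4, 5, 8, 6, 2, [0]⟩, ⟨4, 0, 11, 2, 1, [3]⟩, ⟨2,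
     1, 14, 10, 5, [0, 3, 1]⟩], [⟨5, 3, 9, 0, 1, [1]⟩, ⟨1, 3, 0, 0, 0, []⟩, ⟨4, 4, 17, 8, 3, [2,
     0, 0, 2, 1]⟩], [⟨3, 4, 0, 0, 0, []⟩, ⟨5, 5, 13, 6, 1, [0, 2]⟩, ⟨5, 5, 18, 10, 2, [3, 0, 3,
     1, 1]⟩]],
    [⟨[2, 2], 1, 8, []⟩, ⟨[3, 1, 3, 1, 3, 1, 3, 1], 2, 2, []⟩, ⟨[0, 2, 1, 2, 0, 3, 1, 3, 1, 1, 2, 0,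
     0, 2], 4, 12, [(1, 4, 0)]⟩, ⟨[2, 0, 0, 2, 1, 2, 0, 0, 2, 1, 2, 0, 0, 2, 1, 2, 0, 0, 2, 1],
     4, 4, []⟩, ⟨[0, 2, 1, 2, 0, 0, 2, 1, 1, 3, 0, 3, 1, 2, 0, 0, 3, 1, 1, 3, 1, 3, 0, 3, 1, 1,
     3, 1, 3, 0, 3, 1, 1, 3], 5, 12, [(2, 8, 0), (10, 0, 0), (1, 8, 0), (8, 0, 0), (1, 8, 0),
     (8, 0, 0), (1, 8, 0), (13, 0, 0), (1, 8, 0), (8, 0, 0), (1, 8, 0), (3, 0, 0), (1, 8, 0),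
     (38, 3, 7), (21, 6, 17)]⟩]⟩,
  ⟨[[], [2]],
    [[0], [2, 0, 3]],
    [[⟨0, 0, 0, 0, 0, [0]⟩, ⟨1, 1, 0, 0, 0, []⟩], [⟨1, 1, 0, 0, 0, [2]⟩, ⟨0, 0, 2, 0, 1, []⟩]],
    [⟨[3, 1, 3, 1], 0, 2, []⟩, ⟨[0, 3, 0, 3, 1, 1, 2, 2], 0, 4, []⟩, ⟨[2, 2, 1, 2, 2, 1, 2, 2, 1, 2,
     2, 1], 0, 6, []⟩, ⟨[0, 0, 3, 0, 0, 3, 0, 0, 3, 0, 0, 3], 1, 6, []⟩, ⟨[0, 3, 0, 0, 3, 3, 0,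
     3, 0, 0, 3, 3, 1, 2, 1, 1, 3, 0, 3, 3], 0, 8, []⟩]⟩,
  ⟨[[], [0], [2], [3], [1], [0, 2], [2, 0], [2, 1], [2, 1, 1], [3, 3], [0, 0], [1, 2]],
    [[2, 1, 2, 1, 3], [0, 0, 2, 0, 3], [1, 2, 2, 0, 0, 3]],
    [[⟨1, 4, 0, 0, 0, []⟩, ⟨2, 3, 0, 0, 0, []⟩], [⟨10, 0, 0, 0, 0, []⟩, ⟨5, 2, 0, 0, 0, []⟩], [⟨6,
     7, 0, 0, 0, []⟩, ⟨1, 0, 18, 1, 1, [3]⟩], [⟨4, 5, 15, 3, 2, [1]⟩, ⟨0, 9, 0, 0, 0, []⟩], [⟨0,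
     3, 0, 0, 0, []⟩, ⟨11, 6, 0, 0, 0, []⟩], [⟨3, 10, 12, 1, 2, []⟩, ⟨9, 1, 24, 1, 3, [4, 2, 0,
     3]⟩], [⟨11, 2, 23, 1, 2, [1, 5]⟩, ⟨4, 7, 13, 1, 3, []⟩], [⟨2, 8, 0, 0, 0, []⟩, ⟨6, 10, 0,
     0, 0, [0]⟩], [⟨7, 9, 0, 0, 0, []⟩, ⟨10, 11, 19, 3, 6, [3, 3]⟩], [⟨8, 11, 20, 3, 2, [2, 1]⟩,
     ⟨3, 5, 0, 0, 0, []⟩], [⟨5, 1, 22, 2, 2, [2, 5]⟩, ⟨7, 8, 0, 0, 0, [2]⟩], [⟨9, 6, 16, 1, 0,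
     [0]⟩, ⟨8, 4, 0, 0, 0, [4]⟩]],
    [⟨[3, 3, 3, 3], 0, 4, []⟩, ⟨[0, 0, 0, 0], 3, 4, []⟩, ⟨[3, 4, 0, 3, 4, 0], 2, 4, []⟩, ⟨[1, 1, 5,
     0, 4, 2, 0, 3], 3, 2, []⟩, ⟨[5, 0, 2, 1, 3, 3, 4, 2], 9, 2, [(2, 8, 0)]⟩, ⟨[4, 0, 4, 0, 4,
     0, 4, 0], 6, 4, []⟩, ⟨[2, 5, 2, 5, 2, 5, 2, 5], 1, 6, []⟩, ⟨[2, 1, 5, 1, 5, 2, 4, 0, 2], 0,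
     8, []⟩, ⟨[1, 1, 5, 2, 5, 2, 0, 5, 2], 2, 8, []⟩, ⟨[1, 2, 1, 5, 0, 2, 1, 5, 0, 0, 2, 1, 5],
     4, 8, []⟩, ⟨[2, 1, 2, 5, 2, 1, 3, 3, 5, 2, 1, 3, 5], 5, 8, []⟩, ⟨[1, 5, 1, 2, 2, 0, 0, 2,
     2, 5], 11, 8, [(0, 6, 1)]⟩, ⟨[3, 5, 2, 5, 2, 2, 1, 1, 3, 5, 2, 5], 1, 8, [(4, 9, 0), (4, 9,
     0)]⟩]⟩,
  ⟨[[], [0], [3], [0, 2], [0, 0], [4], [0, 0, 5], [3, 5], [3, 0], [0, 2, 4], [0, 5], [3, 1], [0,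
     4], [3, 0, 0], [4, 2], [3, 1, 3]],
    [[3, 1, 2, 5], [3, 4], [0, 0, 0, 5]],
    [[⟨1, 5, 0, 0, 0, []⟩, ⟨1, 2, 23, 5, 2, [5, 2]⟩, ⟨5, 2, 0, 0, 0, []⟩], [⟨4, 0, 0, 0, 0, []⟩, ⟨3,
     0, 0, 0, 0, []⟩, ⟨12, 10, 0, 0, 0, []⟩], [⟨8, 11, 0, 0, 0, []⟩, ⟨0, 3, 0, 0, 0, []⟩, ⟨0, 7,
     0, 0, 0, [2]⟩], [⟨14, 12, 29, 6, 6, [2, 4, 2, 5, 2, 4]⟩, ⟨2, 1, 25, 1, 1, [3, 4]⟩, ⟨9, 8,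
     0, 0, 0, []⟩], [⟨5, 1, 0, 0, 0, [4]⟩, ⟨8, 10, 33, 8, 2, [3, 5, 5, 2, 4, 3, 4]⟩, ⟨14, 6, 32,
     9, 7, [3, 4, 3, 5, 3, 3, 4]⟩], [⟨0, 4, 22, 2, 0, [5]⟩, ⟨14, 11, 0, 0, 0, []⟩, ⟨7, 0, 48, 8,
     6, [5, 2, 2, 4, 2, 5, 5, 0, 4, 3, 4, 4, 2, 5, 1]⟩], [⟨7, 7, 24, 6, 3, [5, 2]⟩, ⟨10, 8, 37,
     5, 2, [4, 1, 2, 2, 5, 2]⟩, ⟨4, 15, 0, 0, 0, []⟩], [⟨6, 6, 41, 6, 3, [5, 5, 2, 4, 2, 2]⟩,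
     ⟨9, 9, 38, 16, 5, [0, 4, 3, 5, 5, 2, 5, 1, 5, 2]⟩, ⟨2, 5, 0, 0, 0, []⟩], [⟨13, 2, 0, 0, 0,
     []⟩, ⟨6, 4, 45, 12, 4, [5, 5, 2, 5, 2, 2, 5, 2, 2, 4, 3, 0, 5]⟩, ⟨3, 13, 34, 6, 4, [5, 5,
     2, 4]⟩], [⟨12, 14, 31, 4, 5, [3, 4, 0, 4]⟩, ⟨7, 7, 46, 22, 3, [3, 4, 0, 3, 4, 4, 2, 5, 1,
     2, 4, 4, 4, 2, 5, 1]⟩, ⟨13, 3, 35, 7, 5, [3, 4, 0, 3, 4, 4, 2, 5, 5]⟩], [⟨10, 10, 28, 8, 1,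
     [3, 4, 3, 5, 3]⟩, ⟨4, 6, 20, 16, 8, [2, 2]⟩, ⟨1, 11, 0, 0, 0, []⟩], [⟨2, 13, 0, 0, 0, []⟩,
     ⟨5, 15, 0, 0, 0, [0]⟩, ⟨10, 12, 36, 7, 5, [2, 2, 5, 2, 2, 4, 2, 5, 2]⟩], [⟨3, 9, 26, 14, 7,
     [3, 5, 5, 2]⟩, ⟨12, 12, 27, 6, 5, [5, 3, 4, 4, 2]⟩, ⟨11, 1, 30, 8, 6, [5, 3, 4, 4, 2, 5,
     1]⟩], [⟨11, 8, 16, 2, 3, []⟩, ⟨13, 13, 40, 8, 2, [5, 5, 2, 4, 2, 5, 5, 2, 4, 3, 4]⟩, ⟨8, 9,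
     42, 19, 5, [4, 3, 4, 3, 5, 5, 5, 2, 4, 3, 4]⟩], [⟨9, 3, 44, 22, 5, [1, 5, 5, 2, 4, 3, 5, 5,
     2, 1, 5, 2]⟩, ⟨15, 5, 18, 1, 3, [1]⟩, ⟨15, 4, 39, 8, 6, [1, 4, 2, 5, 3, 4, 4, 2, 5, 1]⟩],
     [⟨15, 15, 47, 6, 6, [0, 5, 2, 2, 4, 2, 5, 5, 5, 2, 2, 4, 2, 5, 2, 4, 1]⟩, ⟨11, 14, 0, 0, 0,
     []⟩, ⟨6, 14, 43, 8, 6, [0, 5, 2, 2, 5, 2, 2, 4, 3, 0, 5]⟩]],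
    [⟨[5, 5, 5, 5], 3, 4, [(1, 0, 0)]⟩, ⟨[3, 3, 3, 3], 4, 4, []⟩, ⟨[5, 0, 3, 4, 4, 2, 5, 1], 1, 10,
     [(1, 4, 0)]⟩, ⟨[3, 4, 3, 3, 5, 2, 4, 4], 1, 24, []⟩, ⟨[5, 2, 4, 2, 2, 4, 1, 4, 4, 3], 2, 8,
     [(1, 8, 0)]⟩, ⟨[5, 3, 3, 4, 1, 5, 5, 2, 5, 2], 4, 10, [(3, 10, 0)]⟩, ⟨[4, 2, 4, 2, 4, 2, 4,
     2], 2, 20, [(1, 12, 0), (3, 1, 0)]⟩, ⟨[4, 1, 2, 5, 3, 3, 4, 3, 3, 0, 5, 3], 0, 16, []⟩,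
     ⟨[3, 3, 4, 1, 1, 1, 5, 0], 7, 18, [(4, 4, 7), (3, 10, 1)]⟩, ⟨[3, 4, 3, 0, 2, 5, 2, 5, 0,
     5], 8, 8, [(6, 18, 0), (7, 3, 0), (1, 15, 6), (11, 2, 0)]⟩, ⟨[1, 1, 4, 3, 3, 4, 3, 3], 4,
     24, [(1, 20, 0), (4, 15, 9), (4, 5, 5), (9, 16, 4)]⟩, ⟨[0, 4, 3, 0, 5, 2, 2, 4, 2, 5, 3, 4,
     2, 5], 12, 6, [(6, 22, 0), (10, 2, 0), (4, 5, 0)]⟩, ⟨[4, 2, 4, 0, 4, 2, 4, 2, 5, 5, 2, 4],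
     13, 8, [(6, 1, 0), (9, 0, 0), (13, 12, 0)]⟩, ⟨[1, 5, 0, 5, 2, 4, 2, 5, 1, 4], 7, 8, [(5,
     26, 0), (11, 5, 7), (10, 7, 6), (9, 4, 7)]⟩, ⟨[3, 4, 2, 1, 4, 2, 5, 1, 4, 0, 2, 4], 12, 22,
     [(1, 28, 0), (4, 5, 6), (6, 7, 4), (2, 1, 0), (11, 2, 0)]⟩, ⟨[3, 1, 1, 2, 5, 5, 2, 5, 3, 5,
     2, 5, 2, 4], 13, 22, [(4, 0, 0), (4, 1, 0), (1, 20, 7)]⟩, ⟨[3, 5, 3, 3, 4, 2, 5, 3, 4, 4,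
     2, 4], 14, 22, [(3, 12, 0), (6, 4, 7), (0, 28, 10), (11, 13, 0)]⟩, ⟨[5, 2, 5, 0, 4, 3, 0,
     2, 5, 3], 0, 26, [(0, 22, 0), (4, 32, 5), (3, 0, 0)]⟩, ⟨[1, 2, 5, 1, 2, 4, 3, 1, 1, 2, 5,
     5], 0, 26, [(0, 30, 0), (6, 35, 3)]⟩]⟩,
  ⟨[[], [4], [2], [4, 4]],
    [[4, 4, 4, 3], [4, 0, 5, 5]],
    [[⟨1, 2, 7, 26, 2, [2, 2, 0, 0]⟩, ⟨2, 1, 0, 0, 0, []⟩, ⟨1, 2, 0, 0, 0, []⟩], [⟨3, 0, 0, 0, 0,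
     [2]⟩, ⟨0, 3, 10, 3, 2, [1, 1, 1, 3, 0, 0]⟩, ⟨3, 0, 0, 0, 0, []⟩], [⟨0, 3, 12, 21, 6, [1, 1,
     1, 2, 0, 0, 3, 3]⟩, ⟨3, 0, 9, 7, 4, [1, 1, 2, 0, 3, 0]⟩, ⟨0, 3, 5, 1, 1, [1]⟩], [⟨2, 1, 11,
     11, 5, [1, 1, 2, 2, 0, 3, 0, 0]⟩, ⟨1, 2, 8, 5, 5, [1, 2, 0, 0]⟩, ⟨2, 1, 0, 0, 0, [0]⟩]],
    [⟨[1, 1, 1, 1], 2, 12, []⟩, ⟨[2, 1, 3, 3, 3, 1, 2], 2, 8, [(4, 2, 0)]⟩, ⟨[1, 3, 1, 3, 1, 3, 1,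
     3], 0, 12, [(2, 4, 0)]⟩, ⟨[1, 2, 1, 2, 1, 2, 1, 2], 3, 18, [(4, 6, 0), (2, 0, 0)]⟩, ⟨[1, 1,
     2, 0, 2, 0, 0, 3, 1, 3], 0, 32, []⟩, ⟨[2, 0, 3, 0, 2, 0, 0, 2, 2, 1, 1], 2, 4, [(4, 10,
     0)]⟩, ⟨[1, 2, 0, 0, 2, 1, 3, 0, 2, 0, 3], 0, 6, [(1, 12, 0)]⟩, ⟨[1, 3, 3, 0, 0, 3, 1, 2, 1,
     3, 1], 2, 20, [(3, 14, 0)]⟩, ⟨[2, 1, 2, 0, 2, 1, 2, 0], 0, 24, [(0, 1, 0), (8, 6, 7)]⟩,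
     ⟨[2, 0, 0, 3, 3, 1, 3, 3, 1, 1, 2, 2, 0, 2], 0, 4, [(3, 10, 0), (2, 2, 0), (1, 8, 4)]⟩,
     ⟨[0, 3, 3, 1, 3, 3, 0, 3, 3, 1, 3, 3], 1, 36, [(6, 1, 0), (9, 1, 0), (5, 2, 2), (1, 3,
     5)]⟩]⟩,
  ⟨[[], [3], [2], [1], [0, 0], [0], [2, 2], [3, 1, 3], [0, 2, 2], [2, 0, 2], [2, 0], [3, 1], [0,
     2], [0, 0, 2], [0, 0, 3], [0, 2, 0]],
    [[0, 2, 2, 0, 2, 1, 1], [3, 0, 3]],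
    [[⟨5, 3, 0, 0, 0, []⟩, ⟨2, 1, 0, 0, 0, []⟩], [⟨2, 11, 0, 0, 0, [2]⟩, ⟨0, 3, 0, 0, 0, []⟩], [⟨10,
     1, 0, 0, 0, []⟩, ⟨6, 0, 0, 0, 0, []⟩], [⟨0, 4, 0, 0, 0, []⟩, ⟨1, 6, 27, 5, 4, [0, 0, 3]⟩],
     [⟨3, 5, 16, 1, 2, []⟩, ⟨13, 14, 0, 0, 0, []⟩], [⟨4, 0, 0, 0, 0, []⟩, ⟨12, 11, 0, 0, 0,
     []⟩], [⟨12, 7, 22, 1, 0, [1, 1, 1]⟩, ⟨3, 2, 29, 18, 11, [3, 1, 1]⟩], [⟨6, 15, 21, 11, 1,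
     [0, 0]⟩, ⟨11, 8, 0, 0, 0, []⟩], [⟨14, 9, 0, 0, 0, [0]⟩, ⟨7, 12, 20, 2, 0, [1, 1]⟩], [⟨8,
     13, 30, 15, 2, [2, 1, 1]⟩, ⟨14, 10, 32, 2, 0, [3, 1, 1]⟩], [⟨11, 2, 26, 1, 3, [3]⟩, ⟨9, 13,
     0, 0, 0, []⟩], [⟨1, 10, 0, 0, 0, []⟩, ⟨5, 7, 23, 2, 6, [1, 1, 1]⟩], [⟨15, 6, 0, 0, 0, []⟩,
     ⟨8, 5, 0, 0, 0, []⟩], [⟨9, 14, 24, 12, 9, [0, 0, 0, 0]⟩, ⟨10, 4, 28, 2, 0, [0, 0, 3]⟩],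
     [⟨13, 8, 31, 11, 1, [1, 2, 1]⟩, ⟨4, 9, 0, 0, 0, []⟩], [⟨7, 12, 19, 5, 7, [0]⟩, ⟨15, 15, 18,
     16, 0, [1]⟩]],
    [⟨[3, 0, 2, 0], 2, 8, []⟩, ⟨[2, 2, 2, 2], 4, 20, [(2, 2, 0)]⟩, ⟨[0, 0, 3, 1, 1, 1, 3], 8, 0,
     []⟩, ⟨[3, 0, 0, 0, 0, 0, 3], 3, 2, [(2, 6, 0)]⟩]⟩,
  ⟨[[], [3], [1, 3], [1], [2], [2, 2], [0], [0, 0], [0, 0, 3], [2, 0, 0], [2, 0], [1, 1, 3], [2, 1,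
     1], [2, 1], [2, 1, 2], [0, 3], [0, 0, 0], [1, 1, 1], [1, 1], [2, 0, 2]],
    [],
    [[⟨6, 3, 0, 0, 0, []⟩, ⟨4, 1, 0, 0, 0, []⟩], [⟨2, 15, 28, 0, 1, []⟩, ⟨0, 5, 0, 0, 0, []⟩], [⟨11,
     1, 23, 0, 1, []⟩, ⟨3, 19, 0, 0, 0, []⟩], [⟨0, 18, 0, 0, 0, []⟩, ⟨10, 2, 37, 0, 2, []⟩],
     [⟨10, 13, 0, 0, 0, []⟩, ⟨5, 0, 0, 0, 0, []⟩], [⟨14, 19, 33, 6, 1, []⟩, ⟨1, 4, 27, 2, 1,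
     []⟩], [⟨7, 0, 0, 0, 0, []⟩, ⟨13, 15, 25, 0, 2, []⟩], [⟨16, 6, 0, 0, 0, []⟩, ⟨12, 8, 22, 2,
     1, []⟩], [⟨15, 9, 29, 5, 1, []⟩, ⟨7, 17, 0, 0, 0, []⟩], [⟨8, 10, 35, 5, 1, []⟩, ⟨16, 18,
     36, 7, 6, []⟩], [⟨9, 4, 0, 0, 0, []⟩, ⟨19, 3, 0, 0, 0, []⟩], [⟨12, 2, 30, 6, 5, []⟩, ⟨18,
     16, 0, 0, 0, []⟩], [⟨13, 11, 0, 0, 0, []⟩, ⟨17, 7, 21, 5, 0, []⟩], [⟨4, 12, 0, 0, 0, []⟩,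
     ⟨14, 6, 0, 0, 0, []⟩], [⟨17, 5, 32, 4, 0, []⟩, ⟨15, 13, 26, 2, 3, []⟩], [⟨1, 8, 24, 0, 1,
     []⟩, ⟨6, 14, 0, 0, 0, []⟩], [⟨19, 7, 38, 6, 5, []⟩, ⟨11, 9, 31, 0, 2, []⟩], [⟨18, 14, 0, 0,
     0, []⟩, ⟨8, 12, 20, 7, 6, []⟩], [⟨3, 17, 0, 0, 0, []⟩, ⟨9, 11, 34, 5, 4, []⟩], [⟨5, 16, 40,
     6, 3, []⟩, ⟨2, 10, 39, 0, 2, []⟩]],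
    []⟩]

/-- Permutations of degree 240 satisfying the relations for `(4, 2)`. -/
def perms42 : List (ℕ × ℕ) :=
   [(89010648541038643642413940134241774267752690757561129863659922631256805775676363688557254537614792264233459868574562656602135315237377426376703792100522361241362681426805103130458660809257542688324406173999142354200745054829993049156329366906626563377110996040251416241281368342452101403757691946854345947648781713406486547445162432262327000299511569980513387259596192927204705953322698850969230980668480878445924445823156376389212006179853824202454481823829497069905754311552404626091929159723521183397997861984611552625547127595442779736688224814297622286987411635906684194055,
     89010693408401772642527476047180744570180006831877293269210384432313280587917043676691061770157300676708520020420535770021442752625001248619500891904205708723261753887358431155078849634456939539012246605812329296335080581146975407869505726453196934735830980123751934548066951255510680596256643781914545566007153826289140726215941366973393985216621164813786687490414930489486340586986852034438871718441043829641343274584474413041448046877887582679706668803351797837605088086642068253913346277975318814418934348977165362626028005156864144689265820821183391918507500197372647768580),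
    (89004919826398694854826572005821418243452482705734079297956412083859591104437128067896872484434461290378402882927883211525456483841866118558632490908263045129761691147269717706764168689761543376943403129600032069724178798680727034333357082391029925018697748862609158337518689826610010112226741206914959305120386135249734119461407453745022961523860883589712291937050090768534418360929774059706302752246699160444310450280324779398568308080427545838169662263188698471986526155983768097551494363109445754680005807220329213388223639803458322800467196719275527525905397648006455165445,
     89009227701183787069339471587976075342013020807844023239913305213909669264172047778006166888344274814794578981243410034095880958894433425138443516032043600517561259689862885221347374367160741263963433605628706863227564227499447646887399084462557407502317830832515878810851472699123859610282622906400116770819729668954046480264736573177365918646519434726607827595681603335128217519677916798084645342523008750885324918861241622277693114912670464227643616284103748056561998478802152025973299627061478469335428299284895894213284836570056710336288509010826759375566115695983954299395),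
    (88270186473926571016347810179702060670669838353549914122390296173654813770209454983692677388963071495733650180965304346476584755299402462950327534789201683869885874049352268772047279389497279419696570456446841136074614094175892900187837193360939552942805080183713344343452540837981926660800284772507525509761212210795257001604795830751476222854007771950166861345759983517210822356677875072331095983724251125757680938283775376538070689936176163278774652013116167938817472871950803521462813437624071681203171450202742656742073717636467511278081035447043489662586715045980543321345,
     88635393573903463768253861661423820959921069334320205163371724175523093028368857248780020637270260796896009130689254540531145813980621620838365283182468663634704659262267702230338949905316653476879688452108714704519228784849112350532904494138740827261004146492744057053433136055241261409296141719466327368896386761816954141668388111056267388927109356111702817329027968013833981838211292103519526540225605921808498358506458035003853969706640536922816017103316193762860899755697804661982206655309205080066101268782936318497356051230304408632390695951625412977726543972985762676745)]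

/-- A stabilizer chain for `perms42`. -/
def chain42 : List Orbit := [
  ⟨0,
    [[4], [0]],
    [(1, 0, 0), (7, 1, 0), (5, 0, 1), (13, 1, 1), (8, 0, 7), (4, 1, 7), (9, 0, 5), (6, 0, 13), (2,
     1, 13), (18, 1, 8), (10, 0, 4), (17, 0, 6), (14, 1, 6), (3, 0, 2), (15, 0, 18), (11, 1,
     18), (12, 0, 10), (16, 0, 17), (38, 1, 17), (37, 0, 14), (20, 0, 15), (30, 1, 16), (44, 0,
     38), (36, 0, 37), (29, 1, 37), (19, 0, 20), (50, 1, 20), (43, 0, 44), (72, 1, 44), (35, 0,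
     36), (54, 1, 36), (28, 0, 29), (48, 1, 29), (49, 1, 19), (55, 0, 50), (31, 1, 50), (45, 0,
     43), (56, 1, 43), (68, 0, 72), (42, 1, 72), (52, 0, 54), (22, 1, 54), (27, 0, 28), (57, 0,
     55), (47, 1, 55), (34, 0, 31), (71, 0, 56), (23, 1, 56), (61, 0, 68), (67, 1, 68), (41, 0,
     42), (66, 0, 52), (51, 1, 52), (21, 0, 22), (64, 1, 27), (53, 0, 57), (63, 1, 57), (46, 0,
     47), (33, 0, 34), (70, 1, 71), (60, 1, 61), (77, 0, 67), (40, 0, 41), (62, 1, 41), (69, 0,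
     66), (73, 1, 66), (80, 0, 51), (24, 0, 21), (39, 1, 64), (65, 1, 53), (100, 0, 63), (26, 1,
     63), (32, 0, 33), (99, 0, 70), (118, 0, 60), (25, 1, 60), (127, 1, 77), (59, 0, 62), (74,
     1, 62), (75, 1, 69), (130, 0, 73), (79, 0, 80), (135, 1, 80), (76, 0, 65), (103, 0, 100),
     (115, 1, 100), (98, 0, 99), (126, 1, 99), (117, 0, 118), (94, 1, 118), (128, 1, 127), (58,
     1, 59), (119, 0, 74), (78, 0, 79), (134, 1, 79), (136, 0, 135), (93, 1, 135), (84, 0, 76),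
     (102, 0, 103), (141, 1, 103), (114, 0, 115), (81, 1, 115), (125, 0, 126), (95, 1, 126),
     (116, 0, 117), (101, 1, 117), (129, 0, 119), (139, 0, 134), (86, 1, 134), (133, 1, 136),
     (92, 0, 93), (83, 0, 84), (137, 1, 84), (91, 1, 102), (153, 0, 141), (87, 1, 141), (113, 0,
     114), (165, 1, 114), (82, 0, 81), (124, 0, 125), (145, 1, 125), (97, 0, 95), (112, 1, 116),
     (132, 0, 101), (144, 0, 139), (138, 1, 139), (85, 0, 86), (96, 1, 133), (140, 0, 137), (88,
     1, 137), (156, 0, 153), (170, 1, 153), (90, 0, 87), (159, 1, 113), (167, 0, 165), (148, 1,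
     165), (142, 1, 97), (131, 0, 132), (160, 1, 132), (120, 1, 144), (149, 0, 138), (143, 1,
     140), (152, 0, 156), (161, 1, 156), (184, 0, 170), (123, 1, 170), (89, 0, 90), (108, 1,
     159), (155, 0, 167), (188, 1, 167), (151, 0, 148), (105, 1, 142), (166, 1, 131), (158, 0,
     160), (111, 1, 160), (182, 0, 149), (104, 1, 149), (176, 0, 143), (174, 1, 152), (190, 0,
     161), (109, 1, 161), (183, 0, 184), (222, 1, 184), (122, 0, 123), (154, 1, 155), (212, 0,
     188), (146, 1, 188), (150, 0, 166), (121, 1, 166), (162, 0, 158), (157, 1, 158), (110, 0,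
     111), (181, 0, 182), (195, 1, 182), (107, 0, 104), (175, 0, 176), (194, 1, 190), (221, 1,
     183), (219, 0, 222), (179, 1, 222), (169, 1, 122), (106, 1, 154), (211, 0, 212), (198, 1,
     212), (147, 0, 146), (189, 1, 162), (187, 0, 157), (164, 1, 110), (220, 0, 195), (171, 1,
     195), (210, 1, 175), (197, 0, 194), (180, 1, 194), (223, 0, 221), (185, 1, 221), (218, 1,
     219), (178, 0, 179), (168, 1, 169), (202, 1, 211), (201, 0, 198), (186, 1, 198), (163, 1,
     164), (206, 1, 220), (173, 0, 171), (177, 1, 210), (196, 0, 197), (213, 1, 197), (192, 1,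
     223), (172, 1, 218), (205, 0, 202), (200, 0, 201), (209, 1, 201), (191, 0, 163), (199, 1,
     196), (225, 0, 213), (204, 0, 205), (230, 1, 200), (208, 0, 209), (229, 1, 209), (193, 0,
     191), (224, 0, 225), (233, 1, 225), (203, 0, 204), (231, 1, 204), (214, 1, 230), (207, 0,
     208), (232, 1, 208), (228, 0, 229), (217, 1, 233), (236, 0, 231), (215, 1, 231), (234, 0,
     232), (227, 1, 232), (216, 0, 217), (235, 1, 236), (237, 1, 234), (226, 0, 227), (238, 0,
     235), (239, 0, 238)]⟩,
  ⟨3,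
    [[5, 0, 4, 3], [4, 4, 2]],
    [(6, 0, 3), (5, 1, 3), (53, 0, 6), (7, 1, 6), (16, 0, 5), (12, 1, 5), (142, 0, 53), (97, 1, 53),
     (45, 0, 7), (36, 1, 7), (71, 0, 16), (28, 1, 16), (4, 1, 12), (190, 0, 142), (167, 1, 142),
     (137, 0, 97), (70, 1, 97), (47, 1, 45), (72, 0, 36), (44, 1, 36), (127, 0, 71), (54, 0,
     28), (49, 1, 28), (194, 0, 190), (159, 1, 190), (195, 0, 167), (166, 1, 167), (121, 0,
     137), (182, 1, 137), (78, 0, 70), (32, 1, 47), (77, 0, 72), (61, 1, 72), (59, 0, 44), (113,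
     0, 127), (135, 1, 127), (102, 0, 54), (98, 1, 54), (15, 1, 49), (207, 0, 194), (164, 1,
     194), (196, 0, 159), (193, 1, 159), (199, 0, 195), (183, 0, 166), (176, 1, 166), (119, 0,
     121), (146, 1, 121), (170, 0, 182), (153, 1, 182), (125, 0, 78), (90, 1, 78), (42, 1, 32),
     (139, 0, 77), (117, 0, 61), (73, 1, 61), (152, 0, 59), (123, 1, 113), (58, 0, 135), (81, 0,
     102), (107, 1, 102), (93, 1, 98), (30, 0, 15), (225, 0, 207), (217, 1, 207), (218, 0, 164),
     (211, 1, 164), (229, 0, 196), (201, 1, 196), (157, 0, 193), (163, 1, 193), (215, 1, 199),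
     (185, 1, 183), (105, 0, 176), (108, 1, 146), (151, 0, 170), (219, 0, 153), (100, 1, 125),
     (145, 0, 117), (40, 0, 73), (101, 0, 107), (65, 0, 93), (231, 0, 225), (178, 0, 218), (233,
     0, 211), (202, 0, 201), (88, 0, 157), (171, 0, 215), (226, 1, 215), (25, 0, 105), (234, 0,
     219), (85, 0, 145), (91, 0, 101), (238, 1, 231), (22, 0, 88)]⟩,
  ⟨1,
    [[3, 0, 4, 3, 4, 3], [5, 0, 5, 5, 1, 3, 4, 2, 2, 0, 4, 4]],
    [(37, 0, 1), (69, 1, 1), (118, 0, 37), (133, 1, 37), (114, 0, 69), (212, 0, 118), (143, 1, 118),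
     (79, 0, 133), (23, 1, 114), (235, 0, 212), (74, 1, 212), (162, 0, 143), (203, 0, 235),
     (179, 1, 235), (109, 0, 203)]⟩,
  ⟨15,
    [[1, 5, 5, 0, 4, 3, 4, 2], [1, 3, 5, 0, 5, 2, 5, 1, 3, 4, 3, 4, 2, 1, 2, 5, 2, 5, 1, 5, 2, 0]],
    [(32, 0, 15), (195, 1, 15), (207, 1, 32)]⟩,
  ⟨9,
    [[1, 5, 5, 1, 3, 5, 2, 5, 1, 2, 5, 2, 5, 1, 5, 2, 5, 0, 4, 2, 2, 0, 4, 2]],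
    [(239, 0, 9)]⟩]

theorem finite_and_card42 :
    Finite (tessGroup 3 4 4 4 2) ∧ Nat.card (tessGroup 3 4 4 4 2) = 2949120 :=
  finite_and_card (n := 240) (Ls := tower42) (T := perms42) (Os := chain42)
    (by decide +kernel) (by decide +kernel) rfl (by decide +kernel) (by decide +kernel)
    (by decide +kernel) (by decide +kernel)

end TessCert

/-- the octahedral {3,4,4} groups G_{3,4,4}(a,b) are finite of the
stated orders (24 times the number of octahedra in Table 1). -/
theorem tessGroup_344_orders :
    (Finite (tessGroup 3 4 4 2 0) ∧ Nat.card (tessGroup 3 4 4 2 0) = 96) ∧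
    (Finite (tessGroup 3 4 4 2 1) ∧ Nat.card (tessGroup 3 4 4 2 1) = 120) ∧
    (Finite (tessGroup 3 4 4 2 2) ∧ Nat.card (tessGroup 3 4 4 2 2) = 384) ∧
    (Finite (tessGroup 3 4 4 3 0) ∧ Nat.card (tessGroup 3 4 4 3 0) = 720) ∧
    (Finite (tessGroup 3 4 4 3 1) ∧ Nat.card (tessGroup 3 4 4 3 1) = 720) ∧
    (Finite (tessGroup 3 4 4 3 2) ∧ Nat.card (tessGroup 3 4 4 3 2) = 2184) ∧
    (Finite (tessGroup 3 4 4 4 1) ∧ Nat.card (tessGroup 3 4 4 4 1) = 4896) ∧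
    (Finite (tessGroup 3 4 4 4 2) ∧ Nat.card (tessGroup 3 4 4 4 2) = 2949120) :=
  ⟨TessCert.finite_and_card20, TessCert.finite_and_card21, TessCert.finite_and_card22,
    TessCert.finite_and_card30, TessCert.finite_and_card31, TessCert.finite_and_card32,
    TessCert.finite_and_card41, TessCert.finite_and_card42⟩
end
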